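/- There is an absolute constant C such that the following holds. Let x ≥ 3 and (log x)^{1.1} ≤ y ≤ x^{1/3}, let q ≥ 1 be an integer, δ ∈ ℝ, L = 2(1 + |δx|), and let j be an integer with 0 ≤ j ≤ (log y)/(log 2). Then, summing over ordered pairs (n₁, n₂) of positive y-smooth integers n₁, n₂ ≤ x/(2^j qLy) with n₁ ≡ n₂ (mod q), one has Σ min{ 2^{j+1}qLy, 1/|(n₁ − n₂)δ| } ≤ C·( 2^j·y·Ψ(x/(2^j qLy), y)²·(qL)^{1−α(x,y)}·(log x)·(log L) + 2^j·qLy²·Ψ(x/(2^j qLy), y) ), where the minimum is interpreted as 2^{j+1}qLy whenever (n₁ − n₂)δ = 0. -/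

import Mathlib

open scoped Classical

noncomputable section

/-- `n` is `y`-smooth: every prime factor of `n` is at most `y`. -/
def IsSmooth (y : ℝ) (n : ℕ) : Prop := ∀ p : ℕ, p.Prime → p ∣ n → (p : ℝ) ≤ y

/-- `Ψ(X, y)`: the number of `y`-smooth integers `n` with `1 ≤ n ≤ X`. -/
def Psi (X y : ℝ) : ℕ := Nat.card {n : ℕ | 1 ≤ n ∧ (n : ℝ) ≤ X ∧ IsSmooth y n}

/-- `e(t) = exp(2πit)`. -/
def e2pi (t : ℝ) : ℂ := Complex.exp (2 * Real.pi * Complex.I * t)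

/-- `alphaEq x y a` says `a` solves `∑_{p ≤ y prime} log p / (p^a - 1) = log x`,
i.e. `a = α(x, y)`. -/
def alphaEq (x y a : ℝ) : Prop :=
  ∑ p ∈ (Finset.range (⌊y⌋₊ + 1)).filter Nat.Prime,
    Real.log p / ((p : ℝ) ^ a - 1) = Real.log x

section SmoothNumbers

open Finset

lemma log4_le : Real.log 4 ≤ 1.3864 := by
  have : (4:ℝ) = 2 ^ 2 := by norm_num
  rw [this, Real.log_pow]
  have := Real.log_two_lt_d9
  push_cast; linarith

/-- The primes up to `y`. -/
def primesUpTo (y : ℝ) : Finset ℕ := (Finset.range (⌊y⌋₊ + 1)).filter Nat.Prime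

lemma mem_primesUpTo {y : ℝ} {p : ℕ} : p ∈ primesUpTo y ↔ p.Prime ∧ (p : ℝ) ≤ y := by
  unfold primesUpTo
  rw [mem_filter, mem_range, Nat.lt_succ_iff, and_comm]
  constructor
  · rintro ⟨hp, h⟩
    exact ⟨hp, (Nat.le_floor_iff' hp.ne_zero).1 h⟩
  · rintro ⟨hp, h⟩
    exact ⟨hp, (Nat.le_floor_iff' hp.ne_zero).2 h⟩

lemma theta_eq_sum_primesUpTo (y : ℝ) :
    Chebyshev.theta y = ∑ p ∈ primesUpTo y, Real.log p := by
  unfold primesUpTo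
  rw [Chebyshev.theta_eq_sum_Icc]
  congr 1
  ext p
  simp only [mem_filter, mem_Icc, mem_range]
  constructor
  · rintro ⟨h, hp⟩; exact ⟨by omega, hp⟩
  · rintro ⟨h, hp⟩; exact ⟨by omega, hp⟩

lemma log_prime_nonneg {y : ℝ} {p : ℕ} (_ : p ∈ primesUpTo y) : 0 ≤ Real.log p :=
  Real.log_natCast_nonneg p

lemma two_le_of_mem {y : ℝ} {p : ℕ} (h : p ∈ primesUpTo y) : (2 : ℝ) ≤ p := by
  exact_mod_cast (mem_primesUpTo.1 h).1.two_le

lemma primesUpTo_mono {y z : ℝ} (h : y ≤ z) : primesUpTo y ⊆ primesUpTo z := by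
  intro p hp
  rw [mem_primesUpTo] at *
  exact ⟨hp.1, hp.2.trans h⟩

lemma exists_theta_lower : ∃ Q₀ : ℝ, 2 ≤ Q₀ ∧ ∀ Q : ℝ, Q₀ ≤ Q → 6 / 10 * Q ≤ Chebyshev.theta Q := by
  have h1 : Filter.Tendsto (fun x : ℝ => Real.log x / x ^ (1/4 : ℝ)) Filter.atTop (nhds 0) :=
    (isLittleO_log_rpow_atTop (by norm_num)).tendsto_div_nhds_zero
  have h2 := (h1.eventually (gt_mem_nhds (show (0:ℝ) < 1/100 by norm_num))).and
    (Filter.eventually_ge_atTop (10000 : ℝ))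
  obtain ⟨Q₀, hQ₀⟩ := Filter.eventually_atTop.1 h2
  refine ⟨max Q₀ 2, le_max_right _ _, fun Q hQ => ?_⟩
  obtain ⟨h3, h4⟩ := hQ₀ Q ((le_max_left _ _).trans hQ)
  have hpos : 0 < Q := by linarith
  have h5 := Chebyshev.theta_ge' (x := Q) (by linarith)
  have h6 : Real.log Q ≤ 1/100 * Q ^ (1/4:ℝ) := by
    rw [div_lt_iff₀ (by positivity)] at h3; exact h3.le
  have h7 : √Q * Q ^ (1/4:ℝ) ≤ Q := by
    rw [Real.sqrt_eq_rpow, ← Real.rpow_add hpos]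
    calc Q ^ ((1:ℝ)/2 + 1/4) ≤ Q ^ (1:ℝ) := Real.rpow_le_rpow_of_exponent_le (by linarith) (by norm_num)
      _ = Q := Real.rpow_one Q
  have h8 : Q ^ (1/4:ℝ) ≤ Q := by
    calc Q ^ ((1:ℝ)/4) ≤ Q ^ (1:ℝ) := Real.rpow_le_rpow_of_exponent_le (by linarith) (by norm_num)
      _ = Q := Real.rpow_one Q
  have h9 : √Q * Real.log Q ≤ 1/100 * Q := by
    calc √Q * Real.log Q ≤ √Q * (1/100 * Q ^ (1/4:ℝ)) := by gcongr
      _ = 1/100 * (√Q * Q ^ (1/4:ℝ)) := by ring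
      _ ≤ _ := by gcongr
  have h10 : Real.log (Q + 2) ≤ 1/100 * Q + 1 := by
    have : Real.log (Q + 2) ≤ Real.log (Q * 2) := Real.log_le_log (by linarith) (by linarith)
    rw [Real.log_mul hpos.ne' (by norm_num)] at this
    have := Real.log_two_lt_d9
    nlinarith
  have := Real.log_two_gt_d9
  have := Real.log_two_lt_d9
  nlinarith

/-- Primes in the dyadic-type block `(Q / 4, Q]` carry a positive proportion of `Q`. -/
lemma exists_block_lower : ∃ Q₀ : ℝ, 2 ≤ Q₀ ∧ ∀ Q : ℝ, Q₀ ≤ Q →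
    Q / 5 ≤ ∑ p ∈ (primesUpTo Q).filter (fun p : ℕ => Q / 4 < (p : ℝ)), Real.log p := by
  obtain ⟨Q₀, h2, hQ₀⟩ := exists_theta_lower
  refine ⟨Q₀, h2, fun Q hQ => ?_⟩
  have h := hQ₀ Q hQ
  have hup := Chebyshev.theta_le_log4_mul_x (x := Q / 4) (by linarith)
  rw [theta_eq_sum_primesUpTo] at h hup
  rw [← Finset.sum_filter_add_sum_filter_not _ (fun p : ℕ => Q / 4 < (p : ℝ))] at h
  have : (primesUpTo Q).filter (fun p : ℕ => ¬ Q / 4 < (p : ℝ)) = primesUpTo (Q / 4) := by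
    ext p
    simp only [mem_filter, mem_primesUpTo, not_lt]
    constructor
    · rintro ⟨⟨h1, -⟩, h3⟩; exact ⟨h1, h3⟩
    · rintro ⟨h1, h3⟩; exact ⟨⟨h1, by linarith⟩, h3⟩
  rw [this] at h
  have := log4_le
  nlinarith

lemma exists_theta_ge_mul : ∃ c : ℝ, 0 < c ∧ c ≤ 1 ∧ ∀ z : ℝ, 2 ≤ z →
    c * z ≤ ∑ p ∈ primesUpTo z, Real.log p := by
  obtain ⟨Q₀, h2, hQ₀⟩ := exists_theta_lower
  have hl := Real.log_two_gt_d9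
  have hl' := Real.log_two_lt_d9
  refine ⟨1 / (2 * Q₀), by positivity, by rw [div_le_one (by positivity)]; linarith, fun z hz => ?_⟩
  rw [← theta_eq_sum_primesUpTo]
  rcases le_total Q₀ z with h | h
  · refine le_trans ?_ (hQ₀ z h)
    have : 1 / (2 * Q₀) ≤ 6 / 10 := by
      rw [div_le_div_iff₀ (by positivity) (by norm_num)]; linarith
    gcongr
  · calc 1 / (2 * Q₀) * z ≤ 1 / (2 * Q₀) * Q₀ := by gcongr
      _ = 1 / 2 := by field_simp
      _ ≤ Real.log 2 := by linarith
      _ ≤ Chebyshev.theta 2 := by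
        rw [theta_eq_sum_primesUpTo]
        have := Finset.single_le_sum (f := fun p : ℕ => Real.log p) (s := primesUpTo 2)
          (fun p hp => log_prime_nonneg hp) (mem_primesUpTo.2 ⟨Nat.prime_two, by norm_num⟩)
        simpa using this
      _ ≤ Chebyshev.theta z := Chebyshev.theta_mono hz

lemma sum_log_primesUpTo_le {z : ℝ} (hz : 0 ≤ z) : ∑ p ∈ primesUpTo z, Real.log p ≤ 1.3864 * z := by
  rw [← theta_eq_sum_primesUpTo]
  refine (Chebyshev.theta_le_log4_mul_x hz).trans ?_
  gcongr; exact log4_le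

lemma card_primesUpTo_mul_log_le {z : ℝ} (hz : 2 ≤ z) :
    ((primesUpTo z).card : ℝ) * Real.log z ≤ 5 * z := by
  have h1 : (primesUpTo z).card = Nat.primeCounting ⌊z⌋₊ := by
    unfold primesUpTo
    rw [Nat.primeCounting, Nat.primeCounting', Nat.count_eq_card_filter_range]
  have h2 := Chebyshev.pi_le_log4_mul_div (x := z) (by linarith)
  rw [h1]
  have hl : 0 < Real.log z := Real.log_pos (by linarith)
  have hs : Real.log √z = Real.log z / 2 := Real.log_sqrt (by linarith)
  rw [hs] at h2
  have h3 : √z * Real.log z ≤ 2 * z := by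
    have h4 : Real.log √z ≤ √z := (Real.log_le_sub_one_of_pos (Real.sqrt_pos.2 (by linarith))).trans (by linarith)
    rw [hs] at h4
    have h5 : √z * √z = z := Real.mul_self_sqrt (by linarith)
    have := Real.sqrt_nonneg z
    nlinarith
  have h6 : Real.log 4 * z / (Real.log z / 2) * Real.log z = 2 * Real.log 4 * z := by
    field_simp
  have := log4_le
  calc _ ≤ (Real.log 4 * z / (Real.log z / 2) + √z) * Real.log z := by gcongr
    _ = 2 * Real.log 4 * z + √z * Real.log z := by rw [add_mul, h6]
    _ ≤ _ := by nlinarith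

/-- The `y`-smooth integers in `[1, t]`. -/
def sm (y t : ℝ) : Finset ℕ := (Icc 1 ⌊t⌋₊).filter (IsSmooth y)

/-- The number of `y`-smooth integers in `[1, t]`, as a real number. -/
def sc (y t : ℝ) : ℝ := ((sm y t).card : ℝ)

lemma mem_sm {y t : ℝ} {n : ℕ} : n ∈ sm y t ↔ 1 ≤ n ∧ (n : ℝ) ≤ t ∧ IsSmooth y n := by
  unfold sm
  rw [mem_filter, mem_Icc]
  constructor
  · rintro ⟨⟨h1, h2⟩, h3⟩
    exact ⟨h1, (Nat.le_floor_iff' (by omega)).1 h2, h3⟩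
  · rintro ⟨h1, h2, h3⟩
    exact ⟨⟨h1, (Nat.le_floor_iff' (by omega)).2 h2⟩, h3⟩

lemma Psi_eq_sc (t y : ℝ) : (Psi t y : ℝ) = sc y t := by
  unfold Psi sc
  have : {n : ℕ | 1 ≤ n ∧ (n : ℝ) ≤ t ∧ IsSmooth y n} = ↑(sm y t) := by
    ext n; simp only [Set.mem_ofPred_eq, mem_coe, mem_sm]
  rw [this]; simp

lemma sc_nonneg (y t : ℝ) : 0 ≤ sc y t := Nat.cast_nonneg _

lemma sm_mono {y s t : ℝ} (h : s ≤ t) : sm y s ⊆ sm y t := by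
  intro n hn
  rw [mem_sm] at *
  exact ⟨hn.1, hn.2.1.trans h, hn.2.2⟩

lemma sc_mono {y s t : ℝ} (h : s ≤ t) : sc y s ≤ sc y t := by
  unfold sc; exact_mod_cast card_le_card (sm_mono h)

lemma sc_le_self {y t : ℝ} (h : 0 ≤ t) : sc y t ≤ t := by
  have : sc y t ≤ (⌊t⌋₊ : ℝ) := by
    unfold sc sm
    exact_mod_cast (card_filter_le _ _).trans (by simp)
  exact this.trans (Nat.floor_le h)

lemma IsSmooth.mul {y : ℝ} {m n : ℕ} (hm : IsSmooth y m) (hn : IsSmooth y n) :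
    IsSmooth y (m * n) := by
  intro p hp h
  rcases hp.dvd_mul.1 h with h | h
  exacts [hm p hp h, hn p hp h]

lemma IsSmooth.of_dvd {y : ℝ} {m n : ℕ} (hn : IsSmooth y n) (h : m ∣ n) : IsSmooth y m :=
  fun p hp hpm => hn p hp (hpm.trans h)

lemma isSmooth_of_mem {y : ℝ} {p : ℕ} (h : p ∈ primesUpTo y) : IsSmooth y p := by
  intro r hr hrp
  rw [mem_primesUpTo] at h
  rw [(Nat.prime_dvd_prime_iff_eq hr h.1).1 hrp]
  exact h.2

lemma IsSmooth.pow {y : ℝ} {m : ℕ} (hm : IsSmooth y m) (k : ℕ) : IsSmooth y (m ^ k) :=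
  fun p hp h => hm p hp (hp.dvd_of_dvd_pow h)

lemma isSmooth_of_le {y : ℝ} {n : ℕ} (hn : 1 ≤ n) (h : (n : ℝ) ≤ y) : IsSmooth y n := by
  intro p _ hpn
  exact le_trans (by exact_mod_cast Nat.le_of_dvd hn hpn) h

lemma half_le_sc {y t : ℝ} (h : 1 ≤ t) (hy : t ≤ y) : t / 2 ≤ sc y t := by
  have h1 : sm y t = Icc 1 ⌊t⌋₊ := by
    ext n
    rw [mem_sm, mem_Icc]
    constructor
    · rintro ⟨h1, h2, -⟩; exact ⟨h1, (Nat.le_floor_iff' (by omega)).2 h2⟩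
    · rintro ⟨h1, h2⟩
      have h2 := (Nat.le_floor_iff' (by omega)).1 h2
      exact ⟨h1, h2, isSmooth_of_le h1 (h2.trans hy)⟩
  unfold sc
  rw [h1]
  have h2 := Nat.lt_floor_add_one t
  have h3 : (1:ℝ) ≤ ⌊t⌋₊ := by exact_mod_cast (Nat.one_le_floor_iff t).2 h
  simp only [Nat.card_Icc, Nat.add_sub_cancel]
  linarith

lemma card_dvd_eq_sc {y T : ℝ} {d : ℕ} (hd : 1 ≤ d) (hs : IsSmooth y d) :
    (((sm y T).filter (fun n => d ∣ n)).card : ℝ) = sc y (T / d) := by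
  unfold sc
  have hd' : (0:ℝ) < d := by exact_mod_cast hd
  congr 1
  symm
  apply card_bij (fun m _ => d * m)
  · intro m hm
    rw [mem_sm] at hm
    rw [mem_filter, mem_sm]
    refine ⟨⟨Nat.mul_pos hd hm.1, ?_, hs.mul hm.2.2⟩, dvd_mul_right _ _⟩
    push_cast
    have := (le_div_iff₀ hd').1 hm.2.1
    linarith
  · intro a _ b _ h
    exact Nat.eq_of_mul_eq_mul_left hd h
  · intro n hn
    rw [mem_filter, mem_sm] at hn
    obtain ⟨⟨h1, h2, h3⟩, m, rfl⟩ := hn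
    refine ⟨m, mem_sm.2 ⟨?_, ?_, h3.of_dvd (dvd_mul_left _ _)⟩, rfl⟩
    · exact Nat.pos_of_ne_zero (by rintro rfl; simp at h1)
    · rw [le_div_iff₀ hd']; push_cast at h2; linarith

lemma sum_factorization_log_le {n : ℕ} (P : Finset ℕ) :
    ∑ p ∈ P, (n.factorization p : ℝ) * Real.log p ≤ Real.log n := by
  rw [Real.log_nat_eq_sum_factorization, Finsupp.sum]
  have hsub : ∑ p ∈ P, (n.factorization p : ℝ) * Real.log p
      = ∑ p ∈ P ∩ n.factorization.support, (n.factorization p : ℝ) * Real.log p := by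
    symm
    apply sum_subset inter_subset_left
    intro p hp hp2
    have : n.factorization p = 0 := by
      by_contra h
      exact hp2 (mem_inter.2 ⟨hp, Finsupp.mem_support_iff.2 h⟩)
    simp [this]
  rw [hsub]
  apply sum_le_sum_of_subset_of_nonneg inter_subset_right
  intro p _ _
  exact mul_nonneg (Nat.cast_nonneg _) (Real.log_natCast_nonneg p)

lemma sum_prime_pow_dvd_le {n : ℕ} (hn : n ≠ 0) (P : Finset ℕ) (hP : ∀ p ∈ P, p.Prime) (K : ℕ) :
    ∑ p ∈ P, ∑ k ∈ Icc 1 K, (if p ^ k ∣ n then Real.log p else 0) ≤ Real.log n := by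
  refine le_trans (sum_le_sum fun p hp => ?_) (sum_factorization_log_le P)
  rw [← sum_filter, sum_const, nsmul_eq_mul]
  refine mul_le_mul_of_nonneg_right ?_ (Real.log_natCast_nonneg p)
  have : (Icc 1 K).filter (fun k => p ^ k ∣ n) ⊆ Icc 1 (n.factorization p) := by
    intro k hk
    rw [mem_filter, mem_Icc] at hk
    rw [mem_Icc]
    exact ⟨hk.1.1, ((hP p hp).pow_dvd_iff_le_factorization hn).1 hk.2⟩
  exact_mod_cast (card_le_card this).trans (by simp)

lemma sum_log_mul_sc_le {y X : ℝ} (P : Finset ℕ) (hP : P ⊆ primesUpTo y) (K : ℕ) :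
    ∑ p ∈ P, ∑ k ∈ Icc 1 K, Real.log p * sc y (X / (p : ℝ) ^ k) ≤ sc y X * Real.log X := by
  have hpr : ∀ p ∈ P, p.Prime := fun p hp => (mem_primesUpTo.1 (hP hp)).1
  have h1 : ∀ p ∈ P, ∀ k ∈ Icc 1 K, Real.log p * sc y (X / (p : ℝ) ^ k) =
      ∑ n ∈ sm y X, (if p ^ k ∣ n then Real.log p else 0) := by
    intro p hp k _
    have := card_dvd_eq_sc (T := X) (Nat.one_le_pow k p (hpr p hp).pos)
      ((isSmooth_of_mem (hP hp)).pow k)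
    push_cast at this
    rw [← this, ← sum_filter, sum_const, nsmul_eq_mul, mul_comm]
  rw [sum_congr rfl fun p hp => sum_congr rfl (h1 p hp)]
  rw [sum_congr rfl fun p hp => sum_comm, sum_comm]
  unfold sc
  rw [← nsmul_eq_mul, ← sum_const]
  refine sum_le_sum fun n hn => ?_
  rw [mem_sm] at hn
  refine (sum_prime_pow_dvd_le (by omega) P hpr K).trans ?_
  exact Real.log_le_log (by exact_mod_cast hn.1) hn.2.1

lemma sum_log_mul_sc_le' {y X : ℝ} (P : Finset ℕ) (hP : P ⊆ primesUpTo y) :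
    ∑ p ∈ P, Real.log p * sc y (X / (p : ℝ)) ≤ sc y X * Real.log X := by
  simpa using sum_log_mul_sc_le (X := X) P hP 1

/-- The sum of `Ψ(t / p)` over large primes. -/
lemma sum_sc_large_le {y t : ℝ} (hy : 1 < y) (P : Finset ℕ) (hP : P ⊆ primesUpTo y)
    (hlarge : ∀ p ∈ P, √y ≤ p) :
    (∑ p ∈ P, sc y (t / p)) * Real.log y ≤ 2 * (sc y t * Real.log t) := by
  have h := sum_log_mul_sc_le' (X := t) P hP
  have h2 : (∑ p ∈ P, sc y (t / p)) * (Real.log y / 2) ≤ ∑ p ∈ P, Real.log p * sc y (t / (p : ℝ)) := by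
    rw [sum_mul]
    refine sum_le_sum fun p hp => ?_
    rw [mul_comm]
    refine mul_le_mul_of_nonneg_right ?_ (sc_nonneg _ _)
    rw [← Real.log_sqrt (by linarith)]
    exact Real.log_le_log (Real.sqrt_pos.2 (by linarith)) (hlarge p hp)
  linarith

/-- Weighted sums over smooth `m > T / y` of `(T / m)` are controlled by `Ψ(T)`. -/
lemma exists_mass_le : ∃ C : ℝ, 2 ≤ C ∧ ∀ y T : ℝ, 2 ≤ y → 1 ≤ T →
    ∑ m ∈ (sm y T).filter (fun m : ℕ => T / y < (m : ℝ)), T / (m : ℝ) ≤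
      C * (sc y T * (1 + Real.log T)) := by
  obtain ⟨c, hc0, hc1, hc⟩ := exists_theta_ge_mul
  refine ⟨2 / c, by rw [le_div_iff₀ hc0]; linarith, fun y T hy hT => ?_⟩
  have hlog : 0 ≤ Real.log T := Real.log_nonneg hT
  have key : ∀ m ∈ (sm y T).filter (fun m : ℕ => T / y < (m : ℝ)), T / (m : ℝ) ≤
      2 + 1 / c * ∑ p ∈ primesUpTo y, (if (p : ℝ) ≤ T / m then Real.log p else 0) := by
    intro m hm
    rw [mem_filter, mem_sm] at hm
    obtain ⟨⟨h1, h2, h3⟩, h4⟩ := hm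
    have hm0 : (0:ℝ) < m := by exact_mod_cast h1
    have hnn : 0 ≤ ∑ p ∈ primesUpTo y, (if (p : ℝ) ≤ T / m then Real.log p else 0) :=
      sum_nonneg fun p hp => by split_ifs; exacts [log_prime_nonneg hp, le_rfl]
    rcases le_total (T / m) 2 with h | h
    · have : 0 ≤ 1 / c * ∑ p ∈ primesUpTo y, (if (p : ℝ) ≤ T / m then Real.log p else 0) := by
        positivity
      linarith
    · have h5 := hc (T / m) h
      have h6 : ∑ p ∈ primesUpTo y, (if (p : ℝ) ≤ T / m then Real.log p else 0) =
          ∑ p ∈ primesUpTo (T / m), Real.log p := by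
        rw [← sum_filter]
        congr 1
        ext p
        simp only [mem_filter, mem_primesUpTo]
        constructor
        · rintro ⟨⟨a, b⟩, d⟩; exact ⟨a, d⟩
        · rintro ⟨a, d⟩
          refine ⟨⟨a, d.trans ?_⟩, d⟩
          rw [div_lt_iff₀ (by linarith)] at h4
          rw [div_le_iff₀ hm0]; linarith
      rw [h6]
      have : T / m ≤ 1 / c * ∑ p ∈ primesUpTo (T / m), Real.log p := by
        rw [one_div, ← div_eq_inv_mul, le_div_iff₀ hc0]; linarith
      linarith
  have h7 : ∑ m ∈ sm y T, ∑ p ∈ primesUpTo y, (if (p : ℝ) ≤ T / m then Real.log p else 0)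
      ≤ sc y T * Real.log T := by
    refine le_trans (le_of_eq ?_) (sum_log_mul_sc_le' (X := T) (primesUpTo y) subset_rfl)
    rw [sum_comm]
    refine sum_congr rfl fun p hp => ?_
    rw [← sum_filter, sum_const, nsmul_eq_mul, mul_comm]
    unfold sc
    congr 3
    ext m
    have hp0 : (0:ℝ) < p := by linarith [two_le_of_mem hp]
    simp only [mem_filter, mem_sm]
    constructor
    · rintro ⟨⟨h1, h2, h3⟩, h4⟩
      have hm0 : (0:ℝ) < m := by exact_mod_cast h1
      refine ⟨h1, ?_, h3⟩
      rw [le_div_iff₀ hm0] at h4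
      rw [le_div_iff₀ hp0]; linarith
    · rintro ⟨h1, h2, h3⟩
      have hm0 : (0:ℝ) < m := by exact_mod_cast h1
      rw [le_div_iff₀ hp0] at h2
      have := two_le_of_mem hp
      refine ⟨⟨h1, by nlinarith, h3⟩, ?_⟩
      rw [le_div_iff₀ hm0]; linarith
  calc _ ≤ ∑ m ∈ (sm y T).filter (fun m : ℕ => T / y < (m : ℝ)),
        (2 + 1 / c * ∑ p ∈ primesUpTo y, (if (p : ℝ) ≤ T / m then Real.log p else 0)) := sum_le_sum key
    _ ≤ ∑ m ∈ sm y T,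
        (2 + 1 / c * ∑ p ∈ primesUpTo y, (if (p : ℝ) ≤ T / m then Real.log p else 0)) := by
      apply sum_le_sum_of_subset_of_nonneg (filter_subset _ _)
      intro m _ _
      have hnn : 0 ≤ ∑ p ∈ primesUpTo y, (if (p : ℝ) ≤ T / m then Real.log p else 0) :=
        sum_nonneg fun p hp => by split_ifs; exacts [log_prime_nonneg hp, le_rfl]
      positivity
    _ = 2 * sc y T + 1 / c * ∑ m ∈ sm y T, ∑ p ∈ primesUpTo y, (if (p : ℝ) ≤ T / m then Real.log p else 0) := by
      rw [sum_add_distrib, ← mul_sum, sum_const, nsmul_eq_mul, mul_comm]; rfl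
    _ ≤ 2 * sc y T + 1 / c * (sc y T * Real.log T) := by gcongr
    _ ≤ 2 / c * sc y T + 2 / c * (sc y T * Real.log T) := by
      have h0 := sc_nonneg y T
      have : (2:ℝ) ≤ 2 / c := by rw [le_div_iff₀ hc0]; linarith
      gcongr
      norm_num
    _ = _ := by ring

lemma card_le_of_modEq {S : Finset ℕ} {M : ℕ} (hM : 1 ≤ M) {a l : ℝ} (hl : 0 ≤ l)
    (hS : ∀ n ∈ S, a ≤ n ∧ (n : ℝ) ≤ a + l) (hmod : ∀ m ∈ S, ∀ n ∈ S, m ≡ n [MOD M]) :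
    (S.card : ℝ) ≤ l / M + 1 := by
  have hM' : (0:ℝ) < M := by exact_mod_cast hM
  rcases S.eq_empty_or_nonempty with rfl | hne
  · simp; positivity
  set n0 := S.min' hne with hn0
  have hmem : n0 ∈ S := S.min'_mem hne
  have hmin : ∀ n ∈ S, n0 ≤ n := fun n hn => S.min'_le n hn
  have hdvd : ∀ n ∈ S, M ∣ n - n0 := fun n hn =>
    (Nat.modEq_iff_dvd' (hmin n hn)).1 (hmod n0 hmem n hn)
  have hcard : S.card ≤ (range (⌊l / M⌋₊ + 1)).card := by
    apply card_le_card_of_injOn (fun n => (n - n0) / M)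
    · intro n hn
      simp only [coe_range, Set.mem_Iio]
      rw [Nat.lt_succ_iff]
      apply Nat.le_floor
      rw [Nat.cast_div (hdvd n hn) hM'.ne', Nat.cast_sub (hmin n hn)]
      have h1 := (hS n hn).2
      have h2 := (hS n0 hmem).1
      gcongr
      linarith
    · intro m hm n hn h
      have h3 : m - n0 = n - n0 := by
        have h4 : (m - n0) / M = (n - n0) / M := h
        rw [← Nat.div_mul_cancel (hdvd m hm), ← Nat.div_mul_cancel (hdvd n hn), h4]
      have := hmin m hm
      have := hmin n hn
      omega
  rw [card_range] at hcard
  calc (S.card : ℝ) ≤ ((⌊l / M⌋₊ + 1 : ℕ) : ℝ) := by exact_mod_cast hcard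
    _ ≤ l / M + 1 := by
      push_cast
      gcongr
      exact Nat.floor_le (by positivity)

lemma exists_dvd_of_lt {y W : ℝ} {n : ℕ} (hW : 1 ≤ W) (hy : 0 < y) (hn : IsSmooth y n)
    (hlt : W < n) : ∃ m : ℕ, m ∣ n ∧ 1 ≤ m ∧ (m : ℝ) ≤ W ∧ W / y < m := by
  have hn0 : n ≠ 0 := by rintro rfl; simp at hlt; linarith
  set D := n.divisors.filter (fun m : ℕ => (m : ℝ) ≤ W) with hD
  have h1 : 1 ∈ D := by simp [hD, hn0, hW]
  obtain ⟨m, hm, hmax⟩ := D.exists_max_image id ⟨1, h1⟩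
  rw [hD, mem_filter, Nat.mem_divisors] at hm
  obtain ⟨⟨hmn, -⟩, hmW⟩ := hm
  have hm1 : 1 ≤ m := hmax 1 h1
  refine ⟨m, hmn, hm1, hmW, ?_⟩
  obtain ⟨k, rfl⟩ := hmn
  have hk : k ≠ 1 := by
    rintro rfl
    rw [mul_one] at hlt; linarith
  obtain ⟨p, hp, hpk⟩ := Nat.exists_prime_and_dvd hk
  have hpy : (p : ℝ) ≤ y := hn p hp (hpk.mul_left m)
  have hgt : W < ((m * p : ℕ) : ℝ) := by
    by_contra! hcon
    have hmem : m * p ∈ D := by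
      rw [hD, mem_filter, Nat.mem_divisors]
      exact ⟨⟨mul_dvd_mul_left m hpk, hn0⟩, hcon⟩
    have h2 : m * p ≤ m := hmax _ hmem
    have := hp.two_le
    nlinarith
  push_cast at hgt
  rw [div_lt_iff₀ hy]
  have : (m : ℝ) * p ≤ m * y := by gcongr
  linarith

lemma exists_card_coprime_class_le : ∃ C : ℝ, 1 ≤ C ∧ ∀ (y W a : ℝ) (q : ℕ) (S : Finset ℕ),
    2 ≤ y → 1 ≤ W → 1 ≤ q →
    (∀ n ∈ S, 1 ≤ n ∧ IsSmooth y n ∧ a ≤ n ∧ (n : ℝ) ≤ a + 2 * q * W) →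
    (∀ m ∈ S, ∀ n ∈ S, m ≡ n [MOD q]) → (∀ n ∈ S, Nat.Coprime n q) →
    (S.card : ℝ) ≤ C * (sc y W * (1 + Real.log W)) := by
  obtain ⟨C, hC2, hC⟩ := exists_mass_le
  refine ⟨1 + 3 * C, by linarith, fun y W a q S hy hW hq hS hmod hcop => ?_⟩
  have hlog : 0 ≤ Real.log W := Real.log_nonneg hW
  have hq' : (0:ℝ) < q := by exact_mod_cast hq
  set M := (sm y W).filter (fun m : ℕ => W / y < (m : ℝ)) with hM
  have hsub : S ⊆ sm y W ∪ M.biUnion (fun m => S.filter (fun n => m ∣ n)) := by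
    intro n hn
    obtain ⟨h1, h2, -, -⟩ := hS n hn
    rw [mem_union]
    rcases le_or_gt (n : ℝ) W with h | h
    · left; exact mem_sm.2 ⟨h1, h, h2⟩
    · right
      obtain ⟨m, hmn, hm1, hmW, hWy⟩ := exists_dvd_of_lt hW (by linarith) h2 h
      rw [mem_biUnion]
      refine ⟨m, ?_, mem_filter.2 ⟨hn, hmn⟩⟩
      rw [hM, mem_filter, mem_sm]
      exact ⟨⟨hm1, hmW, h2.of_dvd hmn⟩, hWy⟩
  have hcount : ∀ m ∈ M, ((S.filter (fun n => m ∣ n)).card : ℝ) ≤ 3 * (W / m) := by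
    intro m hm
    rw [hM, mem_filter, mem_sm] at hm
    obtain ⟨⟨hm1, hmW, -⟩, -⟩ := hm
    have hm0 : (0:ℝ) < m := by exact_mod_cast hm1
    have hWm : 1 ≤ W / m := by rw [le_div_iff₀ hm0]; linarith
    rcases (S.filter (fun n => m ∣ n)).eq_empty_or_nonempty with he | ⟨n0, hn0⟩
    · rw [he]; simp; positivity
    rw [mem_filter] at hn0
    have hmq : Nat.Coprime m q := Nat.Coprime.coprime_dvd_left hn0.2 (hcop n0 hn0.1)
    have := card_le_of_modEq (S := S.filter (fun n => m ∣ n)) (M := m * q) (a := a)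
      (l := 2 * q * W) (Nat.mul_pos hm1 hq) (by positivity)
      (fun n hn => (hS n (mem_filter.1 hn).1).2.2)
      (fun b hb n hn => by
        rw [mem_filter] at hb hn
        rw [← Nat.modEq_and_modEq_iff_modEq_mul hmq]
        exact ⟨(Nat.modEq_zero_iff_dvd.2 hb.2).trans (Nat.modEq_zero_iff_dvd.2 hn.2).symm,
          hmod b hb.1 n hn.1⟩)
    refine this.trans ?_
    push_cast
    have h5 : 2 * q * W / (m * q) = 2 * (W / m) := by field_simp
    rw [h5]; linarith
  calc (S.card : ℝ) ≤ ((sm y W ∪ M.biUnion (fun m => S.filter (fun n => m ∣ n))).card : ℝ) := by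
        exact_mod_cast card_le_card hsub
    _ ≤ (sm y W).card + ∑ m ∈ M, ((S.filter (fun n => m ∣ n)).card : ℝ) := by
        exact_mod_cast (card_union_le _ _).trans (by gcongr; exact card_biUnion_le)
    _ ≤ sc y W + ∑ m ∈ M, 3 * (W / m) := by
        gcongr with m hm
        · exact le_rfl
        · exact hcount m hm
    _ = sc y W + 3 * ∑ m ∈ M, (W / m) := by rw [mul_sum]
    _ ≤ sc y W + 3 * (C * (sc y W * (1 + Real.log W))) := by
        gcongr; exact hC y W hy hW
    _ ≤ _ := by
        have := sc_nonneg y W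
        have : 0 ≤ sc y W * Real.log W := by positivity
        nlinarith

/-- Smooth numbers in one residue class modulo `q`, in an interval of length `2 q W`. -/
lemma exists_card_class_le : ∃ C : ℝ, 1 ≤ C ∧ ∀ (y W a : ℝ) (q : ℕ) (S : Finset ℕ),
    2 ≤ y → 1 ≤ W → 1 ≤ q →
    (∀ n ∈ S, 1 ≤ n ∧ IsSmooth y n ∧ a ≤ n ∧ (n : ℝ) ≤ a + 2 * q * W) →
    (∀ m ∈ S, ∀ n ∈ S, m ≡ n [MOD q]) →
    (S.card : ℝ) ≤ C * (sc y W * (1 + Real.log W)) := by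
  obtain ⟨C, hC1, hC⟩ := exists_card_coprime_class_le
  refine ⟨C, hC1, fun y W a q S hy hW hq hS hmod => ?_⟩
  have hlog : 0 ≤ Real.log W := Real.log_nonneg hW
  rcases S.eq_empty_or_nonempty with rfl | ⟨n0, hn0⟩
  · have := sc_nonneg y W
    simp; positivity
  set d := Nat.gcd n0 q with hd
  have hd1 : 0 < d := Nat.gcd_pos_of_pos_right _ hq
  have hd' : (0:ℝ) < d := by exact_mod_cast hd1
  have hgcd : ∀ n ∈ S, Nat.gcd n q = d := fun n hn => (hmod n hn n0 hn0).gcd_eq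
  have hdn : ∀ n ∈ S, d ∣ n := fun n hn => by rw [← hgcd n hn]; exact Nat.gcd_dvd_left _ _
  have hdq : d ∣ q := Nat.gcd_dvd_right _ _
  have hinj : Set.InjOn (fun n => n / d) (S : Set ℕ) := by
    intro m hm n hn h
    have h4 : m / d = n / d := h
    rw [← Nat.div_mul_cancel (hdn m hm), ← Nat.div_mul_cancel (hdn n hn), h4]
  rw [← card_image_of_injOn hinj]
  apply hC y W (a / d) (q / d) _ hy hW (Nat.div_pos (Nat.le_of_dvd hq hdq) hd1)
  · intro m hm
    obtain ⟨n, hn, rfl⟩ := mem_image.1 hm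
    obtain ⟨h1, h2, h3, h4⟩ := hS n hn
    refine ⟨Nat.div_pos (Nat.le_of_dvd h1 (hdn n hn)) hd1,
      h2.of_dvd (Nat.div_dvd_of_dvd (hdn n hn)), ?_, ?_⟩
    · rw [Nat.cast_div (hdn n hn) hd'.ne']; gcongr
    · rw [Nat.cast_div (hdn n hn) hd'.ne', Nat.cast_div hdq hd'.ne']
      calc (n : ℝ) / d ≤ (a + 2 * q * W) / d := by gcongr
        _ = _ := by field_simp
  · intro b hb b' hb'
    obtain ⟨m, hm, rfl⟩ := mem_image.1 hb
    obtain ⟨n, hn, rfl⟩ := mem_image.1 hb'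
    have h := hmod m hm n hn
    apply Nat.ModEq.mul_left_cancel' (c := d) hd1.ne'
    rw [Nat.mul_div_cancel' (hdn m hm), Nat.mul_div_cancel' (hdn n hn), Nat.mul_div_cancel' hdq]
    exact h
  · intro b hb
    obtain ⟨n, hn, rfl⟩ := mem_image.1 hb
    have h := hgcd n hn
    have := Nat.coprime_div_gcd_div_gcd (m := n) (n := q) (by rw [h]; exact hd1)
    rwa [h] at this

lemma sub_one_le_sc {y t : ℝ} (hy : t ≤ y) : t - 1 ≤ sc y t := by
  have h1 : Icc 1 ⌊t⌋₊ ⊆ sm y t := by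
    intro n hn
    rw [mem_Icc] at hn
    have h2 := (Nat.le_floor_iff' (by omega)).1 hn.2
    exact mem_sm.2 ⟨hn.1, h2, isSmooth_of_le hn.1 (h2.trans hy)⟩
  have h2 : (⌊t⌋₊ : ℝ) ≤ sc y t := by
    unfold sc; exact_mod_cast (by simp : ⌊t⌋₊ ≤ (Icc 1 ⌊t⌋₊).card).trans (card_le_card h1)
  linarith [Nat.lt_floor_add_one t]

lemma sum_log_div_le {y : ℝ} (hy : 1 ≤ y) :
    ∑ p ∈ primesUpTo y, Real.log p / p ≤ Real.log y + 1.3864 := by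
  have h1 := sum_log_mul_sc_le' (X := y) (primesUpTo y) subset_rfl
  have h2 : ∑ p ∈ primesUpTo y, Real.log p * (y / p - 1) ≤ y * Real.log y := by
    refine (sum_le_sum fun p hp => ?_).trans (h1.trans ?_)
    · refine mul_le_mul_of_nonneg_left (sub_one_le_sc ?_) (log_prime_nonneg hp)
      exact div_le_self (by linarith) (by linarith [two_le_of_mem hp])
    · exact mul_le_mul_of_nonneg_right (sc_le_self (by linarith)) (Real.log_nonneg hy)
  have h3 := sum_log_primesUpTo_le (z := y) (by linarith)
  have h4 : ∑ p ∈ primesUpTo y, Real.log p * (y / p - 1) =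
      y * ∑ p ∈ primesUpTo y, Real.log p / p - ∑ p ∈ primesUpTo y, Real.log p := by
    rw [mul_sum, ← sum_sub_distrib]
    refine sum_congr rfl fun p _ => by ring
  rw [h4] at h2
  have : y * ∑ p ∈ primesUpTo y, Real.log p / p ≤ y * (Real.log y + 1.3864) := by linarith
  exact le_of_mul_le_mul_left this (by linarith)

lemma exists_sum_log_rpow_le : ∃ C : ℝ, 0 ≤ C ∧ ∀ s : Finset ℕ,
    ∑ n ∈ s, Real.log n * (n : ℝ) ^ (-(7/6) : ℝ) ≤ C := by
  have hs : Summable (fun n : ℕ => 12 * (n : ℝ) ^ (-(13/12) : ℝ)) :=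
    (Real.summable_nat_rpow.2 (by norm_num)).mul_left _
  refine ⟨∑' n : ℕ, 12 * (n : ℝ) ^ (-(13/12) : ℝ), tsum_nonneg fun n => by positivity, fun s => ?_⟩
  refine le_trans (sum_le_sum fun n _ => ?_) (hs.sum_le_tsum s fun n _ => by positivity)
  rcases Nat.eq_zero_or_pos n with rfl | hn
  · simp
  have hn' : (0:ℝ) < n := by exact_mod_cast hn
  have h := Real.log_le_rpow_div hn'.le (ε := 1/12) (by norm_num)
  calc Real.log n * (n : ℝ) ^ (-(7/6) : ℝ) ≤ (n : ℝ) ^ (1/12 : ℝ) / (1/12) * (n : ℝ) ^ (-(7/6) : ℝ) := by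
        gcongr
    _ = 12 * ((n : ℝ) ^ (1/12 : ℝ) * (n : ℝ) ^ (-(7/6) : ℝ)) := by ring
    _ = _ := by rw [← Real.rpow_add hn']; norm_num

/-- The saddle point sum `∑_{p ≤ y} log p / (p ^ a - 1)`. -/
def mu (y a : ℝ) : ℝ := ∑ p ∈ primesUpTo y, Real.log p / ((p : ℝ) ^ a - 1)

lemma rpow_sub_one_pos {y : ℝ} {p : ℕ} (hp : p ∈ primesUpTo y) {a : ℝ} (ha : 0 < a) :
    0 < (p : ℝ) ^ a - 1 := by
  have := Real.one_lt_rpow (show (1:ℝ) < p by linarith [two_le_of_mem hp]) ha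
  linarith

lemma mu_antitone {y a b : ℝ} (ha : 0 < a) (hab : a ≤ b) : mu y b ≤ mu y a := by
  unfold mu
  refine sum_le_sum fun p hp => ?_
  have h1 := rpow_sub_one_pos hp ha
  refine div_le_div_of_nonneg_left (log_prime_nonneg hp) h1 ?_
  have := Real.rpow_le_rpow_of_exponent_le (show (1:ℝ) ≤ p by linarith [two_le_of_mem hp]) hab
  linarith

lemma mu_nonneg {y a : ℝ} (ha : 0 < a) : 0 ≤ mu y a :=
  sum_nonneg fun _ hp => div_nonneg (log_prime_nonneg hp) (rpow_sub_one_pos hp ha).le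

lemma mu_nonpos {y a : ℝ} (ha : a ≤ 0) : mu y a ≤ 0 := by
  refine sum_nonpos fun p hp => div_nonpos_of_nonneg_of_nonpos (log_prime_nonneg hp) ?_
  have := Real.rpow_le_one_of_one_le_of_nonpos (show (1:ℝ) ≤ p by linarith [two_le_of_mem hp]) ha
  linarith

lemma mu_continuousOn (y : ℝ) : ContinuousOn (mu y) (Set.Ioi 0) := by
  unfold mu
  refine continuousOn_finsetSum _ fun p hp => ?_
  refine ContinuousOn.div continuousOn_const ?_ fun a ha => (rpow_sub_one_pos hp ha).ne'
  refine ContinuousOn.sub ?_ continuousOn_const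
  refine ContinuousOn.rpow continuousOn_const continuousOn_id fun a _ => ?_
  left
  linarith [two_le_of_mem hp]

lemma exists_mu_eq {y a b v : ℝ} (ha : 0 < a) (hab : a ≤ b) (h1 : mu y b ≤ v) (h2 : v ≤ mu y a) :
    ∃ t, a ≤ t ∧ t ≤ b ∧ mu y t = v := by
  have hc : ContinuousOn (mu y) (Set.Icc a b) :=
    (mu_continuousOn y).mono fun t ht => lt_of_lt_of_le ha ht.1
  obtain ⟨t, ht, h⟩ := intermediate_value_Icc' hab hc ⟨h1, h2⟩
  exact ⟨t, ht.1, ht.2, h⟩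

lemma exists_mu_one_le : ∃ C : ℝ, 0 ≤ C ∧ ∀ y : ℝ, 1 ≤ y → mu y 1 ≤ Real.log y + C := by
  obtain ⟨C, hC0, hC⟩ := exists_sum_log_rpow_le
  refine ⟨1.3864 + 2 * C, by positivity, fun y hy => ?_⟩
  have h1 := sum_log_div_le hy
  have h2 := hC (primesUpTo y)
  have h3 : mu y 1 ≤ ∑ p ∈ primesUpTo y, Real.log p / p +
      2 * ∑ p ∈ primesUpTo y, Real.log p * (p : ℝ) ^ (-(7/6) : ℝ) := by
    unfold mu
    rw [mul_sum, ← sum_add_distrib]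
    refine sum_le_sum fun p hp => ?_
    have hp2 := two_le_of_mem hp
    rw [Real.rpow_one]
    have hl := log_prime_nonneg hp
    have h5 : (p : ℝ) ^ (-2 : ℝ) ≤ (p : ℝ) ^ (-(7/6) : ℝ) :=
      Real.rpow_le_rpow_of_exponent_le (by linarith) (by norm_num)
    have h6 : (p : ℝ) ^ (-2 : ℝ) = 1 / ((p : ℝ) ^ 2) := by
      rw [Real.rpow_neg (by linarith)]; norm_num
    have h7 : 1 / ((p : ℝ) - 1) ≤ 1 / p + 2 * (1 / (p : ℝ) ^ 2) := by
      have : 1 / (p : ℝ) + 2 * (1 / (p : ℝ) ^ 2) = (p + 2) / (p : ℝ) ^ 2 := by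
        field_simp
      rw [this, div_le_div_iff₀ (by linarith) (by positivity)]
      nlinarith
    calc Real.log p / (p - 1) = Real.log p * (1 / ((p : ℝ) - 1)) := by ring
      _ ≤ Real.log p * (1 / p + 2 * (p : ℝ) ^ (-(7/6) : ℝ)) := by
        gcongr; rw [h6] at h5; linarith
      _ = _ := by ring
  linarith

/-- The primes in `(z, w]`. -/
def primesIn (z w : ℝ) : Finset ℕ := (primesUpTo w).filter (fun p : ℕ => z < (p : ℝ))

lemma mem_primesIn {z w : ℝ} {p : ℕ} : p ∈ primesIn z w ↔ p.Prime ∧ z < p ∧ (p : ℝ) ≤ w := by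
  unfold primesIn
  rw [mem_filter, mem_primesUpTo]; tauto

lemma primesIn_subset {z w v : ℝ} (h : w ≤ v) : primesIn z w ⊆ primesUpTo v :=
  (filter_subset _ _).trans (primesUpTo_mono h)

lemma sum_primesIn_split (f : ℕ → ℝ) {z w v : ℝ} (h1 : z ≤ w) (h2 : w ≤ v) :
    ∑ p ∈ primesIn z v, f p = ∑ p ∈ primesIn z w, f p + ∑ p ∈ primesIn w v, f p := by
  rw [← sum_union]
  · congr 1
    ext p
    simp only [mem_union, mem_primesIn]
    constructor
    · rintro ⟨a, b, c⟩
      rcases le_or_gt (p : ℝ) w with h | h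
      · exact Or.inl ⟨a, b, h⟩
      · exact Or.inr ⟨a, h, c⟩
    · rintro (⟨a, b, c⟩ | ⟨a, b, c⟩)
      · exact ⟨a, b, c.trans h2⟩
      · exact ⟨a, h1.trans_lt b, c⟩
  · rw [disjoint_left]
    intro p hp hq
    rw [mem_primesIn] at hp hq
    linarith [hp.2.2, hq.2.1]

/-- A threshold beyond which prime blocks satisfy Chebyshev lower bounds. -/
lemma exists_block_rpow_lower : ∃ Q₀ : ℝ, 2 ≤ Q₀ ∧ ∀ Q a : ℝ, Q₀ ≤ Q → 0 ≤ a →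
    Q ^ (1 - a) / 5 ≤ ∑ p ∈ primesIn (Q / 4) Q, Real.log p * (p : ℝ) ^ (-a) := by
  obtain ⟨Q₀, h2, hQ₀⟩ := exists_block_lower
  refine ⟨Q₀, h2, fun Q a hQ ha => ?_⟩
  have h := hQ₀ Q hQ
  have hQ0 : 0 < Q := by linarith
  calc Q ^ (1 - a) / 5 = Q / 5 * Q ^ (-a) := by
        rw [Real.rpow_sub hQ0, Real.rpow_neg hQ0.le, Real.rpow_one]; ring
    _ ≤ (∑ p ∈ primesIn (Q / 4) Q, Real.log p) * Q ^ (-a) := by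
        gcongr; exact h
    _ ≤ _ := by
        rw [sum_mul]
        refine sum_le_sum fun p hp => ?_
        rw [mem_primesIn] at hp
        have : (0:ℝ) < p := by exact_mod_cast hp.1.pos
        refine mul_le_mul_of_nonneg_left ?_ (Real.log_natCast_nonneg p)
        exact Real.rpow_le_rpow_of_nonpos this hp.2.2 (by linarith)

lemma block_rpow_upper {Q a : ℝ} (hQ : 0 < Q) (ha : 0 ≤ a) (ha1 : a ≤ 1) :
    ∑ p ∈ primesIn (Q / 4) Q, Real.log p * (p : ℝ) ^ (-a) ≤ 6 * Q ^ (1 - a) := by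
  calc ∑ p ∈ primesIn (Q / 4) Q, Real.log p * (p : ℝ) ^ (-a)
      ≤ ∑ p ∈ primesIn (Q / 4) Q, Real.log p * (Q / 4) ^ (-a) := by
        refine sum_le_sum fun p hp => ?_
        rw [mem_primesIn] at hp
        refine mul_le_mul_of_nonneg_left ?_ (Real.log_natCast_nonneg p)
        exact Real.rpow_le_rpow_of_nonpos (by positivity) hp.2.1.le (by linarith)
    _ = (∑ p ∈ primesIn (Q / 4) Q, Real.log p) * (Q / 4) ^ (-a) := by rw [sum_mul]
    _ ≤ (1.3864 * Q) * (Q / 4) ^ (-a) := by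
        gcongr
        refine le_trans ?_ (sum_log_primesUpTo_le hQ.le)
        apply sum_le_sum_of_subset_of_nonneg (filter_subset _ _)
        intro p _ _; exact Real.log_natCast_nonneg p
    _ = 1.3864 * 4 ^ a * Q ^ (1 - a) := by
        rw [Real.div_rpow hQ.le (by norm_num), Real.rpow_sub hQ, Real.rpow_neg hQ.le,
          Real.rpow_neg (by norm_num), Real.rpow_one]
        field_simp
    _ ≤ _ := by
        have : (4:ℝ) ^ a ≤ 4 ^ (1:ℝ) := Real.rpow_le_rpow_of_exponent_le (by norm_num) ha1
        rw [Real.rpow_one] at this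
        gcongr
        linarith

lemma exists_blocks_lower : ∃ Q₀ : ℝ, 2 ≤ Q₀ ∧ ∀ (Q a : ℝ) (n : ℕ), 0 < Q → Q₀ ≤ 4 * Q / 4 ^ n → 0 ≤ a →
    (∑ i ∈ range n, (Q / 4 ^ i) ^ (1 - a)) / 5 ≤
      ∑ p ∈ primesIn (Q / 4 ^ n) Q, Real.log p * (p : ℝ) ^ (-a) := by
  obtain ⟨Q₀, h2, hQ₀⟩ := exists_block_rpow_lower
  refine ⟨Q₀, h2, fun Q a n hQ hn ha => ?_⟩
  induction n with
  | zero => simp; exact sum_nonneg fun p _ => mul_nonneg (Real.log_natCast_nonneg p) (by positivity)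
  | succ n ih =>
    have h3 : 4 * Q / 4 ^ (n + 1) = Q / 4 ^ n := by field_simp; ring
    rw [h3] at hn
    have h5 : Q / 4 ^ (n + 1) = Q / 4 ^ n / 4 := by field_simp; ring
    have h4 := ih (by
      rw [mul_div_assoc]; linarith [show 0 < Q / 4 ^ n by positivity])
    rw [sum_range_succ, sum_primesIn_split _ (w := Q / 4 ^ n), h5]
    · have := hQ₀ (Q / 4 ^ n) a hn ha
      linarith
    · rw [h5]; exact div_le_self (by positivity) (by norm_num)
    · exact div_le_self hQ.le (one_le_pow₀ (by norm_num))

lemma blocks_upper {Q a : ℝ} (n : ℕ) (hQ : 0 < Q) (ha : 0 ≤ a) (ha1 : a ≤ 1) :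
    ∑ p ∈ primesIn (Q / 4 ^ n) Q, Real.log p * (p : ℝ) ^ (-a) ≤
      6 * ∑ i ∈ range n, (Q / 4 ^ i) ^ (1 - a) := by
  induction n with
  | zero =>
    have : primesIn (Q / 4 ^ 0) Q = ∅ := by
      ext p; simp [mem_primesIn]
    rw [this]; simp
  | succ n ih =>
    have h5 : Q / 4 ^ (n + 1) = Q / 4 ^ n / 4 := by field_simp; ring
    rw [sum_range_succ, sum_primesIn_split _ (w := Q / 4 ^ n), h5]
    · have := block_rpow_upper (Q := Q / 4 ^ n) (by positivity) ha ha1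
      linarith
    · rw [h5]; exact div_le_self (by positivity) (by norm_num)
    · exact div_le_self hQ.le (one_le_pow₀ (by norm_num))

lemma sum_log_rpow_le_mu {y a : ℝ} (ha : 0 < a) (P : Finset ℕ) (hP : P ⊆ primesUpTo y) :
    ∑ p ∈ P, Real.log p * (p : ℝ) ^ (-a) ≤ mu y a := by
  unfold mu
  refine le_trans (sum_le_sum fun p hp => ?_) (sum_le_sum_of_subset_of_nonneg hP fun p hp _ =>
    div_nonneg (log_prime_nonneg hp) (rpow_sub_one_pos hp ha).le)
  have h0 := two_le_of_mem (hP hp)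
  rw [Real.rpow_neg (by linarith), ← div_eq_mul_inv]
  exact div_le_div_of_nonneg_left (log_prime_nonneg (hP hp)) (rpow_sub_one_pos (hP hp) ha)
    (by linarith)

lemma exists_alpha_bounds : ∃ y₀ : ℝ, 2 ≤ y₀ ∧ ∀ x y a : ℝ, y₀ ≤ y →
    Real.log x ≤ y ^ (10/11 : ℝ) → 3 * Real.log y ≤ Real.log x → mu y a = Real.log x →
    1/12 ≤ a ∧ a ≤ 1 := by
  obtain ⟨C, hC0, hC⟩ := exists_mu_one_le
  obtain ⟨Q₀, h2, hQ₀⟩ := exists_block_rpow_lower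
  have ht : Filter.Tendsto (fun y : ℝ => y ^ (1/132 : ℝ)) Filter.atTop Filter.atTop :=
    tendsto_rpow_atTop (by norm_num)
  obtain ⟨y₁, hy₁⟩ := Filter.eventually_atTop.1 ((ht.eventually_gt_atTop 5).and
    (Real.tendsto_log_atTop.eventually_gt_atTop C))
  refine ⟨max Q₀ y₁, h2.trans (le_max_left _ _), fun x y a hy hx1 hx3 hmu => ?_⟩
  obtain ⟨h5, hCl⟩ := hy₁ y ((le_max_right _ _).trans hy)
  have hyQ : Q₀ ≤ y := (le_max_left _ _).trans hy
  have hy0 : 0 < y := by linarith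
  have hl : 0 < Real.log y := Real.log_pos (by linarith)
  constructor
  · by_contra! hlt
    have ha : 0 < a := by
      by_contra! h
      have := mu_nonpos (y := y) h
      linarith
    have h6 := hQ₀ y (1/12) hyQ (by norm_num)
    have h7 := sum_log_rpow_le_mu (y := y) (a := 1/12) (by norm_num) _ (primesIn_subset (z := y/4) le_rfl)
    have h8 := mu_antitone (y := y) ha hlt.le
    have h9 : y ^ (1 - 1/12 : ℝ) = y ^ (10/11 : ℝ) * y ^ (1/132 : ℝ) := by
      rw [← Real.rpow_add hy0]; norm_num
    have : 0 < y ^ (10/11 : ℝ) := by positivity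
    nlinarith
  · by_contra! hlt
    have h6 := hC y (by linarith)
    have h8 := mu_antitone (y := y) one_pos hlt.le
    linarith

/-- The truncated Euler product `∏_{p ≤ y} (1 - p ^ (-a))⁻¹`. -/
def eulerZ (y a : ℝ) : ℝ := ∏ p ∈ primesUpTo y, (1 - (p : ℝ) ^ (-a))⁻¹

/-- The number of elements of `P₀` dividing `n`. -/
def omegaIn (P₀ : Finset ℕ) (n : ℕ) : ℕ := (P₀.filter (fun p => p ∣ n)).card

lemma omegaIn_mul {P₀ : Finset ℕ} (hP : ∀ p ∈ P₀, p.Prime) {m n : ℕ} (h : m.Coprime n) :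
    omegaIn P₀ (m * n) = omegaIn P₀ m + omegaIn P₀ n := by
  unfold omegaIn
  rw [← card_union_of_disjoint]
  · congr 1
    ext p
    simp only [mem_filter, mem_union]
    constructor
    · rintro ⟨h1, h2⟩
      rcases (hP p h1).dvd_mul.1 h2 with h3 | h3
      exacts [Or.inl ⟨h1, h3⟩, Or.inr ⟨h1, h3⟩]
    · rintro (⟨h1, h2⟩ | ⟨h1, h2⟩)
      exacts [⟨h1, h2.mul_right _⟩, ⟨h1, h2.mul_left _⟩]
  · rw [disjoint_left]
    intro p hp hq
    rw [mem_filter] at hp hq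
    have := Nat.dvd_gcd hp.2 hq.2
    rw [h] at this
    exact (hP p hp.1).one_lt.ne' (Nat.dvd_one.1 this)

lemma omegaIn_mono_dvd {P₀ : Finset ℕ} {m n : ℕ} (h : m ∣ n) : omegaIn P₀ m ≤ omegaIn P₀ n := by
  unfold omegaIn
  apply card_le_card
  intro p hp
  rw [mem_filter] at *
  exact ⟨hp.1, hp.2.trans h⟩

lemma omegaIn_one {P₀ : Finset ℕ} (hP : ∀ p ∈ P₀, p.Prime) : omegaIn P₀ 1 = 0 := by
  unfold omegaIn
  rw [card_eq_zero, filter_eq_empty_iff]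
  intro p hp h
  exact (hP p hp).one_lt.ne' (Nat.dvd_one.1 h)

lemma omegaIn_prime_pow {P₀ : Finset ℕ} (hP : ∀ p ∈ P₀, p.Prime) {p : ℕ} (hp : p.Prime) (k : ℕ) :
    omegaIn P₀ (p ^ (k + 1)) = if p ∈ P₀ then 1 else 0 := by
  unfold omegaIn
  have : P₀.filter (fun r => r ∣ p ^ (k + 1)) = P₀.filter (fun r => r = p) := by
    apply filter_congr
    intro r hr
    constructor
    · intro h; exact (Nat.prime_dvd_prime_iff_eq (hP r hr) hp).1 ((hP r hr).dvd_of_dvd_pow h)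
    · rintro rfl; exact dvd_pow_self _ (by omega)
  rw [this, filter_eq']
  split_ifs <;> simp

lemma rpow_neg_lt_one {p : ℕ} (hp : 2 ≤ p) {a : ℝ} (ha : 0 < a) : (p : ℝ) ^ (-a) < 1 :=
  Real.rpow_lt_one_of_one_lt_of_neg (by exact_mod_cast hp) (by linarith)

lemma rpow_neg_pos {p : ℕ} (hp : 2 ≤ p) {a : ℝ} : 0 < (p : ℝ) ^ (-a) :=
  Real.rpow_pos_of_pos (by exact_mod_cast (by omega : 0 < p)) _

lemma mem_smoothNumbers_iff {y : ℝ} (hy : 0 ≤ y) {n : ℕ} :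
    n ∈ Nat.smoothNumbers (⌊y⌋₊ + 1) ↔ IsSmooth y n := by
  rw [Nat.mem_smoothNumbers']
  unfold IsSmooth
  refine forall_congr' fun p => forall_congr' fun hp => forall_congr' fun _ => ?_
  rw [Nat.lt_succ_iff, Nat.le_floor_iff hy]

lemma hasSum_smooth_weighted (y : ℝ) {a : ℝ} (ha : 0 < a) {P₀ : Finset ℕ}
    (hP : ∀ p ∈ P₀, p.Prime) :
    HasSum (fun m : Nat.smoothNumbers (⌊y⌋₊ + 1) =>
        ((m : ℕ) : ℝ) ^ (-a) * Real.exp (-(omegaIn P₀ m : ℝ)))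
      (∏ p ∈ primesUpTo y, (1 + (if p ∈ P₀ then Real.exp (-1) else 1) *
        ((p : ℝ) ^ (-a) * (1 - (p : ℝ) ^ (-a))⁻¹))) := by
  set f : ℕ → ℝ := fun n => (n : ℝ) ^ (-a) * Real.exp (-(omegaIn P₀ n : ℝ)) with hf
  have hf1 : f 1 = 1 := by simp [hf, omegaIn_one hP]
  have hmul : ∀ {m n : ℕ}, Nat.Coprime m n → f (m * n) = f m * f n := by
    intro m n h
    simp only [hf]
    rw [omegaIn_mul hP h]
    push_cast
    rw [Real.mul_rpow (Nat.cast_nonneg _) (Nat.cast_nonneg _), neg_add, Real.exp_add]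
    ring
  have hpow : ∀ {p : ℕ}, p.Prime → HasSum (fun k : ℕ => f (p ^ k))
      (1 + (if p ∈ P₀ then Real.exp (-1) else 1) * ((p : ℝ) ^ (-a) * (1 - (p : ℝ) ^ (-a))⁻¹)) := by
    intro p hp
    have h0 := rpow_neg_pos hp.two_le (a := a)
    have h1 := rpow_neg_lt_one hp.two_le ha
    have h2 : ∀ k : ℕ, f (p ^ (k + 1)) = (if p ∈ P₀ then Real.exp (-1) else 1) *
        ((p : ℝ) ^ (-a) * ((p : ℝ) ^ (-a)) ^ k) := by
      intro k
      simp only [hf]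
      rw [omegaIn_prime_pow hP hp]
      push_cast
      rw [← pow_succ', ← Real.rpow_natCast, ← Real.rpow_natCast, ← Real.rpow_mul (Nat.cast_nonneg _),
        ← Real.rpow_mul (Nat.cast_nonneg _), mul_comm (-a)]
      split_ifs <;> simp [mul_comm]
    rw [add_comm, show (1:ℝ) = ∑ i ∈ range 1, f (p ^ i) by simp [hf1]]
    refine (hasSum_nat_add_iff 1).1 ?_
    have h3 := ((hasSum_geometric_of_lt_one h0.le h1).mul_left ((p : ℝ) ^ (-a))).mul_left
      (if p ∈ P₀ then Real.exp (-1) else 1)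
    simp only [h2]
    simpa [hf1] using h3
  have hnn : ∀ n, 0 ≤ f n := fun n => by positivity
  have h := (EulerProduct.summable_and_hasSum_smoothNumbers_prod_primesBelow_tsum hf1 hmul
    (fun hp => by simpa only [Real.norm_of_nonneg (hnn _)] using (hpow hp).summable) (⌊y⌋₊ + 1)).2
  have he : ∏ p ∈ primesUpTo y, (1 + (if p ∈ P₀ then Real.exp (-1) else 1) *
      ((p : ℝ) ^ (-a) * (1 - (p : ℝ) ^ (-a))⁻¹)) = ∏ p ∈ primesUpTo y, ∑' k : ℕ, f (p ^ k) :=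
    prod_congr rfl fun p hp => (hpow (mem_primesUpTo.1 hp).1).tsum_eq.symm
  rw [he]
  exact h

lemma euler_factor_eq {X : ℝ} (h1 : X < 1) : 1 + X * (1 - X)⁻¹ = (1 - X)⁻¹ := by
  have : 1 - X ≠ 0 := by linarith
  field_simp; ring

lemma hasSum_smooth (y : ℝ) {a : ℝ} (ha : 0 < a) :
    HasSum (fun m : Nat.smoothNumbers (⌊y⌋₊ + 1) => ((m : ℕ) : ℝ) ^ (-a)) (eulerZ y a) := by
  have h := hasSum_smooth_weighted y ha (P₀ := ∅) (by simp)
  have h2 : ∀ n, omegaIn ∅ n = 0 := fun n => by simp [omegaIn]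
  simp only [h2, notMem_empty, if_false, one_mul, Nat.cast_zero, neg_zero, Real.exp_zero,
    mul_one] at h
  unfold eulerZ
  convert h using 1
  refine prod_congr rfl fun p hp => ?_
  exact (euler_factor_eq (rpow_neg_lt_one (mem_primesUpTo.1 hp).1.two_le ha)).symm

lemma eulerZ_pos {y a : ℝ} (ha : 0 < a) : 0 < eulerZ y a := by
  unfold eulerZ
  refine prod_pos fun p hp => inv_pos.2 ?_
  have := rpow_neg_lt_one (mem_primesUpTo.1 hp).1.two_le ha
  linarith

lemma sum_le_of_hasSum_smooth {y : ℝ} (hy : 0 ≤ y) {f : ℕ → ℝ} (hf : ∀ n, 0 ≤ f n) {A : ℝ}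
    (h : HasSum (fun m : Nat.smoothNumbers (⌊y⌋₊ + 1) => f m) A) (S : Finset ℕ)
    (hS : ∀ n ∈ S, 1 ≤ n ∧ IsSmooth y n) : ∑ n ∈ S, f n ≤ A := by
  have h1 : ∀ n ∈ S, n ∈ Nat.smoothNumbers (⌊y⌋₊ + 1) := fun n hn =>
    (mem_smoothNumbers_iff hy).2 (hS n hn).2
  have h2 := sum_le_hasSum (S.subtype (fun n => n ∈ Nat.smoothNumbers (⌊y⌋₊ + 1)))
    (fun i _ => hf i) h
  rwa [sum_subtype_of_mem f h1] at h2

lemma sum_smooth_le {y a : ℝ} (hy : 0 ≤ y) (ha : 0 < a) (S : Finset ℕ)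
    (hS : ∀ n ∈ S, 1 ≤ n ∧ IsSmooth y n) : ∑ n ∈ S, (n : ℝ) ^ (-a) ≤ eulerZ y a :=
  sum_le_of_hasSum_smooth hy (f := fun n => (n : ℝ) ^ (-a)) (fun n => by positivity)
    (hasSum_smooth y ha) S hS

lemma exists_sum_smooth_ge {y a : ℝ} (hy : 0 ≤ y) (ha : 0 < a) : ∃ S : Finset ℕ,
    (∀ n ∈ S, 1 ≤ n ∧ IsSmooth y n) ∧ 0.9 * eulerZ y a ≤ ∑ n ∈ S, (n : ℝ) ^ (-a) := by
  have h := hasSum_smooth y ha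
  have hz := eulerZ_pos (y := y) ha
  have h2 := h.eventually (lt_mem_nhds (show 0.9 * eulerZ y a < eulerZ y a by linarith))
  obtain ⟨s, hs⟩ := h2.exists
  refine ⟨s.map (Function.Embedding.subtype _), ?_, ?_⟩
  · intro n hn
    rw [mem_map] at hn
    obtain ⟨m, -, rfl⟩ := hn
    have : 1 ≤ (m : ℕ) := Nat.pos_of_ne_zero (Nat.ne_zero_of_mem_smoothNumbers m.2)
    exact ⟨this, (mem_smoothNumbers_iff hy).1 m.2⟩
  · rw [sum_map]; exact hs.le

lemma sum_smooth_weighted_le {y a : ℝ} (hy : 0 ≤ y) (ha : 0 < a) (P₀ : Finset ℕ)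
    (hP : P₀ ⊆ primesUpTo y) (S : Finset ℕ) (hS : ∀ n ∈ S, 1 ≤ n ∧ IsSmooth y n) :
    ∑ n ∈ S, (n : ℝ) ^ (-a) * Real.exp (-(omegaIn P₀ n : ℝ)) ≤
      eulerZ y a * Real.exp (-(6 / 10) * ∑ p ∈ P₀, (p : ℝ) ^ (-a)) := by
  refine (sum_le_of_hasSum_smooth hy (f := fun n => (n : ℝ) ^ (-a) * Real.exp (-(omegaIn P₀ n : ℝ)))
    (fun n => by positivity)
    (hasSum_smooth_weighted y ha fun p hp => (mem_primesUpTo.1 (hP hp)).1) S hS).trans ?_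
  have h1 : ∑ p ∈ P₀, (p : ℝ) ^ (-a) = ∑ p ∈ primesUpTo y, if p ∈ P₀ then (p : ℝ) ^ (-a) else 0 := by
    rw [← sum_filter, filter_mem_eq_inter, inter_eq_right.2 hP]
  rw [h1, mul_sum, Real.exp_sum]
  unfold eulerZ
  rw [← prod_mul_distrib]
  have he : Real.exp (-1) ≤ 4 / 10 := by
    have := Real.exp_one_gt_d9
    rw [Real.exp_neg, inv_le_comm₀ (Real.exp_pos _) (by norm_num)]
    norm_num; linarith
  refine prod_le_prod (fun p hp => ?_) fun p hp => ?_
  · have := rpow_neg_lt_one (mem_primesUpTo.1 hp).1.two_le ha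
    have h4 : 0 ≤ (1 - (p : ℝ) ^ (-a))⁻¹ := inv_nonneg.2 (by linarith)
    split_ifs <;> positivity
  · have h2 := rpow_neg_pos (mem_primesUpTo.1 hp).1.two_le (a := a)
    have h3 := rpow_neg_lt_one (mem_primesUpTo.1 hp).1.two_le ha
    set X := (p : ℝ) ^ (-a)
    have h4 : 0 < (1 - X)⁻¹ := inv_pos.2 (by linarith)
    split_ifs
    · have h5 : 1 + 4 / 10 * (X * (1 - X)⁻¹) = (1 - X)⁻¹ * (1 - 6 / 10 * X) := by
        have : 1 - X ≠ 0 := by linarith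
        field_simp; ring
      calc 1 + Real.exp (-1) * (X * (1 - X)⁻¹) ≤ 1 + 4 / 10 * (X * (1 - X)⁻¹) := by gcongr
        _ = (1 - X)⁻¹ * (1 - 6 / 10 * X) := h5
        _ ≤ (1 - X)⁻¹ * Real.exp (-(6 / 10) * X) := by
          gcongr
          have := Real.add_one_le_exp (-(6 / 10) * X)
          linarith
    · rw [one_mul, mul_zero, Real.exp_zero, mul_one, euler_factor_eq h3]

/-- The tangent line bound for the convex function `a ↦ log Z(a)`. -/
lemma eulerZ_tangent {y a b : ℝ} (ha : 0 < a) (hb : 0 < b) :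
    eulerZ y a * Real.exp (-(b - a) * mu y a) ≤ eulerZ y b := by
  unfold mu eulerZ
  rw [mul_sum, Real.exp_sum, ← prod_mul_distrib]
  refine prod_le_prod (fun p hp => ?_) fun p hp => ?_
  · have := rpow_neg_lt_one (mem_primesUpTo.1 hp).1.two_le ha
    have h4 : 0 ≤ (1 - (p : ℝ) ^ (-a))⁻¹ := inv_nonneg.2 (by linarith)
    positivity
  · have hp0 : (0:ℝ) < p := by linarith [two_le_of_mem hp]
    have h2 := rpow_neg_pos (mem_primesUpTo.1 hp).1.two_le (a := a)
    have h3 := rpow_neg_lt_one (mem_primesUpTo.1 hp).1.two_le ha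
    have h5 := rpow_neg_lt_one (mem_primesUpTo.1 hp).1.two_le hb
    have h6 := rpow_sub_one_pos hp ha
    set h := (b - a) * Real.log p with hh
    set X := (p : ℝ) ^ (-a) with hX
    have hXb : (p : ℝ) ^ (-b) = X * Real.exp (-h) := by
      rw [hX, Real.rpow_def_of_pos hp0, Real.rpow_def_of_pos hp0, ← Real.exp_add, hh]
      congr 1; ring
    have hXa : Real.log p / ((p : ℝ) ^ a - 1) = Real.log p * (X / (1 - X)) := by
      have : (p : ℝ) ^ a = X⁻¹ := by rw [hX, Real.rpow_neg hp0.le, inv_inv]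
      rw [this] at h6 ⊢
      have : 1 - X ≠ 0 := by linarith
      rw [show X⁻¹ - 1 = (1 - X) / X by field_simp]
      field_simp
    have hexp : -(b - a) * (Real.log p / ((p : ℝ) ^ a - 1)) = -(h * (X / (1 - X))) := by
      rw [hXa, hh]; ring
    have hpos : 0 < 1 - X * Real.exp (-h) := by rw [← hXb]; linarith
    have hpos2 : 0 < 1 - X := by linarith
    rw [hexp, hXb, Real.exp_neg, ← mul_inv]
    refine inv_anti₀ hpos ?_
    calc 1 - X * Real.exp (-h) ≤ 1 - X * (1 - h) := by
          have := Real.add_one_le_exp (-h)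
          nlinarith
      _ = (1 - X) * (h * (X / (1 - X)) + 1) := by field_simp; ring
      _ ≤ _ := by
          gcongr
          exact Real.add_one_le_exp _

lemma exists_mu_compare : ∃ C : ℝ, 1 ≤ C ∧ ∀ y a η : ℝ, 2 ≤ y → 1 / 24 ≤ a → 0 ≤ η →
    η * Real.log y ≤ 1 → mu y a ≤ (1 + C * η * Real.log y) * mu y (a + η) := by
  set k : ℝ := 2 ^ (1 / 24 : ℝ) - 1 with hk
  have hk0 : 0 < k := by
    have := Real.one_lt_rpow (show (1:ℝ) < 2 by norm_num) (show (0:ℝ) < 1 / 24 by norm_num)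
    linarith
  refine ⟨2 * (1 + 1 / k), ?_, fun y a η hy ha hη hηl => ?_⟩
  · have : 0 < 1 / k := by positivity
    linarith
  unfold mu
  rw [mul_sum]
  refine sum_le_sum fun p hp => ?_
  have hp2 := two_le_of_mem hp
  have hp0 : (0:ℝ) < p := by linarith
  have h1 := rpow_sub_one_pos hp (show 0 < a by linarith)
  have h2 := rpow_sub_one_pos hp (show 0 < a + η by linarith)
  have hl : Real.log p ≤ Real.log y := Real.log_le_log hp0 (mem_primesUpTo.1 hp).2
  have hl0 := log_prime_nonneg hp
  have h3 : (p : ℝ) ^ η ≤ 1 + 2 * (η * Real.log y) := by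
    rw [Real.rpow_def_of_pos hp0]
    have h4 : Real.log p * η ≤ η * Real.log y := by
      rw [mul_comm]; gcongr
    refine (Real.exp_le_exp.2 h4).trans ?_
    have h5 : 0 ≤ η * Real.log y := mul_nonneg hη (by linarith)
    have := Real.abs_exp_sub_one_le (x := η * Real.log y) (by rwa [abs_of_nonneg h5])
    rw [abs_of_nonneg h5] at this
    linarith [le_abs_self (Real.exp (η * Real.log y) - 1)]
  have h4 : k ≤ (p : ℝ) ^ a - 1 := by
    rw [hk]
    have : (2:ℝ) ^ (1 / 24 : ℝ) ≤ (p : ℝ) ^ a :=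
      (Real.rpow_le_rpow (by norm_num) hp2 (by norm_num)).trans
        (Real.rpow_le_rpow_of_exponent_le (by linarith) ha)
    linarith
  have h5 : (p : ℝ) ^ (a + η) - 1 ≤ (1 + 2 * (1 + 1 / k) * η * Real.log y) * ((p : ℝ) ^ a - 1) := by
    rw [Real.rpow_add hp0]
    have h6 : (p : ℝ) ^ a ≤ (1 + 1 / k) * ((p : ℝ) ^ a - 1) := by
      have : 1 ≤ 1 / k * ((p : ℝ) ^ a - 1) := by
        rw [one_div, ← div_eq_inv_mul, le_div_iff₀ hk0]; linarith
      linarith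
    have h7 : 0 ≤ η * Real.log y := mul_nonneg hη (by linarith)
    calc (p : ℝ) ^ a * (p : ℝ) ^ η - 1 ≤ (p : ℝ) ^ a * (1 + 2 * (η * Real.log y)) - 1 := by gcongr
      _ = ((p : ℝ) ^ a - 1) + 2 * (η * Real.log y) * (p : ℝ) ^ a := by ring
      _ ≤ ((p : ℝ) ^ a - 1) + 2 * (η * Real.log y) * ((1 + 1 / k) * ((p : ℝ) ^ a - 1)) := by gcongr
      _ = _ := by ring
  rw [mul_div_assoc', div_le_div_iff₀ h1 h2]
  calc Real.log p * ((p : ℝ) ^ (a + η) - 1)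
      ≤ Real.log p * ((1 + 2 * (1 + 1 / k) * η * Real.log y) * ((p : ℝ) ^ a - 1)) := by gcongr
    _ = _ := by ring

/-- At the saddle point, half of the Euler product comes from `n` with `log n` near `μ(b)`. -/
lemma exists_window : ∃ K : ℝ, 1 ≤ K ∧ ∀ y b U : ℝ, 0 ≤ y → 24 ≤ Real.log y → 1 / 12 ≤ b → 1 ≤ U →
    mu y b = U * Real.log y → ∃ S : Finset ℕ, (∀ n ∈ S, 1 ≤ n ∧ IsSmooth y n) ∧
      (∀ n ∈ S, |Real.log n - U * Real.log y| ≤ K * √U * Real.log y) ∧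
      eulerZ y b / 2 ≤ ∑ n ∈ S, (n : ℝ) ^ (-b) := by
  obtain ⟨C, hC1, hC⟩ := exists_mu_compare
  refine ⟨C + 3, by linarith, fun y b U hy0 hl hb hU hmu => ?_⟩
  have hy2 : 2 ≤ y := by
    by_contra! h
    have : Real.log y ≤ y - 1 := by
      rcases hy0.eq_or_lt with h0 | h0
      · rw [← h0] at hl; simp at hl; linarith
      · exact Real.log_le_sub_one_of_pos h0
    linarith
  obtain ⟨S, hS, hge⟩ := exists_sum_smooth_ge (y := y) (a := b) hy0 (by linarith)
  set l := Real.log y with hldef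
  set s := √U with hs
  have hs1 : 1 ≤ s := Real.one_le_sqrt.2 hU
  have hss : s * s = U := Real.mul_self_sqrt (by linarith)
  have hl0 : 0 < l := by linarith
  set η := 1 / (s * l) with hη
  have hη0 : 0 < η := by positivity
  have hηl : η * l = 1 / s := by rw [hη]; field_simp
  have hηl1 : η * l ≤ 1 := by rw [hηl, div_le_one (by linarith)]; exact hs1
  have hη24 : η ≤ 1 / 24 := by
    rw [hη]; gcongr; nlinarith
  set m := mu y b with hm
  have hquad : C * η * l * (η * m) = C := by
    rw [hmu, ← hss, hη]; field_simp
  have hΔ : η * ((C + 3) * s * l) = C + 3 := by rw [hη]; field_simp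
  have hZ := eulerZ_pos (y := y) (a := b) (by linarith)
  have h20 : Real.exp (-3) ≤ 1 / 10 := by
    have h1 := Real.exp_one_gt_d9
    have h2 : Real.exp 3 = Real.exp 1 ^ 3 := by rw [← Real.exp_nat_mul]; norm_num
    rw [Real.exp_neg, h2]
    have h3 : (10:ℝ) ≤ Real.exp 1 ^ 3 := by
      calc (10:ℝ) ≤ 2.7 ^ 3 := by norm_num
        _ ≤ _ := by gcongr; linarith
    rw [inv_le_comm₀ (by positivity) (by norm_num)]; norm_num; linarith
  -- upper tail
  have hup : ∑ n ∈ S.filter (fun n : ℕ => m + (C + 3) * s * l < Real.log n), (n : ℝ) ^ (-b) ≤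
      1 / 10 * eulerZ y b := by
    have ht := eulerZ_tangent (y := y) (a := b - η) (b := b) (by linarith) (by linarith)
    have hc := hC y (b - η) η hy2 (by linarith) hη0.le hηl1
    rw [sub_add_cancel] at hc
    have h1 : ∑ n ∈ S.filter (fun n : ℕ => m + (C + 3) * s * l < Real.log n), (n : ℝ) ^ (-b) ≤
        Real.exp (-(η * (m + (C + 3) * s * l))) * eulerZ y (b - η) := by
      refine le_trans ?_ (mul_le_mul_of_nonneg_left (sum_smooth_le (y := y) (a := b - η) hy0 (by linarith)
        (S.filter (fun n : ℕ => m + (C + 3) * s * l < Real.log n))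
        fun n hn => hS n (mem_filter.1 hn).1) (Real.exp_pos _).le)
      rw [mul_sum]
      refine sum_le_sum fun n hn => ?_
      rw [mem_filter] at hn
      have hn0 : (0:ℝ) < n := by exact_mod_cast (hS n hn.1).1
      rw [Real.rpow_def_of_pos hn0, Real.rpow_def_of_pos hn0, ← Real.exp_add]
      apply Real.exp_le_exp.2
      nlinarith [hn.2]
    have h2 : eulerZ y (b - η) ≤ eulerZ y b * Real.exp (η * ((1 + C * η * l) * m)) := by
      have h3 : eulerZ y (b - η) * Real.exp (-(η * ((1 + C * η * l) * m))) ≤ eulerZ y b := by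
        refine le_trans ?_ ht
        have := eulerZ_pos (y := y) (a := b - η) (by linarith)
        gcongr
        have : η * mu y (b - η) ≤ η * ((1 + C * η * l) * m) := by gcongr
        linarith
      calc eulerZ y (b - η) = eulerZ y (b - η) * Real.exp (-(η * ((1 + C * η * l) * m))) *
            Real.exp (η * ((1 + C * η * l) * m)) := by
            rw [mul_assoc, ← Real.exp_add]; simp
        _ ≤ _ := by gcongr
    calc _ ≤ _ := h1
      _ ≤ Real.exp (-(η * (m + (C + 3) * s * l))) * (eulerZ y b * Real.exp (η * ((1 + C * η * l) * m))) := by gcongr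
      _ = Real.exp (-3) * eulerZ y b := by
        have : -(η * (m + (C + 3) * s * l)) + η * ((1 + C * η * l) * m) = -3 := by
          linear_combination hquad - hΔ
        rw [mul_comm (eulerZ y b), ← mul_assoc, ← Real.exp_add, this]
      _ ≤ _ := by gcongr
  have hlo : ∑ n ∈ S.filter (fun n : ℕ => Real.log n < m - (C + 3) * s * l), (n : ℝ) ^ (-b) ≤
      1 / 10 * eulerZ y b := by
    have ht := eulerZ_tangent (y := y) (a := b + η) (b := b) (by linarith) (by linarith)
    rw [show -(b - (b + η)) = η by ring] at ht
    have hc := hC y b η hy2 (by linarith) hη0.le hηl1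
    have hm0 : 0 ≤ m := mu_nonneg (by linarith)
    have hc' : (1 - C * η * l) * m ≤ mu y (b + η) := by
      have hx : 0 ≤ C * η * l := by positivity
      have hmu0 : 0 ≤ mu y (b + η) := mu_nonneg (by linarith)
      rcases le_total 1 (C * η * l) with h | h
      · nlinarith
      · nlinarith [mul_nonneg (mul_nonneg hx hx) hmu0]
    have h1 : ∑ n ∈ S.filter (fun n : ℕ => Real.log n < m - (C + 3) * s * l), (n : ℝ) ^ (-b) ≤
        Real.exp (η * (m - (C + 3) * s * l)) * eulerZ y (b + η) := by
      refine le_trans ?_ (mul_le_mul_of_nonneg_left (sum_smooth_le (y := y) (a := b + η) hy0 (by linarith)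
        (S.filter (fun n : ℕ => Real.log n < m - (C + 3) * s * l))
        fun n hn => hS n (mem_filter.1 hn).1) (Real.exp_pos _).le)
      rw [mul_sum]
      refine sum_le_sum fun n hn => ?_
      rw [mem_filter] at hn
      have hn0 : (0:ℝ) < n := by exact_mod_cast (hS n hn.1).1
      rw [Real.rpow_def_of_pos hn0, Real.rpow_def_of_pos hn0, ← Real.exp_add]
      apply Real.exp_le_exp.2
      nlinarith [hn.2]
    have h2 : eulerZ y (b + η) ≤ eulerZ y b * Real.exp (-(η * ((1 - C * η * l) * m))) := by
      have h3 : eulerZ y (b + η) * Real.exp (η * ((1 - C * η * l) * m)) ≤ eulerZ y b := by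
        refine le_trans ?_ ht
        have := eulerZ_pos (y := y) (a := b + η) (by linarith)
        gcongr
      calc eulerZ y (b + η) = eulerZ y (b + η) * Real.exp (η * ((1 - C * η * l) * m)) *
            Real.exp (-(η * ((1 - C * η * l) * m))) := by
            rw [mul_assoc, ← Real.exp_add]; simp
        _ ≤ _ := by gcongr
    calc _ ≤ _ := h1
      _ ≤ Real.exp (η * (m - (C + 3) * s * l)) * (eulerZ y b * Real.exp (-(η * ((1 - C * η * l) * m)))) := by gcongr
      _ = Real.exp (-3) * eulerZ y b := by
        have : η * (m - (C + 3) * s * l) + -(η * ((1 - C * η * l) * m)) = -3 := by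
          linear_combination hquad - hΔ
        rw [mul_comm (eulerZ y b), ← mul_assoc, ← Real.exp_add, this]
      _ ≤ _ := by gcongr
  refine ⟨S.filter (fun n : ℕ => |Real.log n - m| ≤ (C + 3) * s * l),
    fun n hn => hS n (mem_filter.1 hn).1, fun n hn => ?_, ?_⟩
  · rw [← hmu]; exact (mem_filter.1 hn).2
  · have hsplit : ∑ n ∈ S, (n : ℝ) ^ (-b) ≤
        ∑ n ∈ S.filter (fun n : ℕ => |Real.log n - m| ≤ (C + 3) * s * l), (n : ℝ) ^ (-b) +
        ∑ n ∈ S.filter (fun n : ℕ => m + (C + 3) * s * l < Real.log n), (n : ℝ) ^ (-b) +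
        ∑ n ∈ S.filter (fun n : ℕ => Real.log n < m - (C + 3) * s * l), (n : ℝ) ^ (-b) := by
      rw [sum_filter, sum_filter, sum_filter, ← sum_add_distrib, ← sum_add_distrib]
      refine sum_le_sum fun n _ => ?_
      have h0 : 0 ≤ (n : ℝ) ^ (-b) := by positivity
      by_cases h1 : |Real.log n - m| ≤ (C + 3) * s * l
      · rw [if_pos h1]
        have : ∀ P : Prop, [Decidable P] → 0 ≤ (if P then (n : ℝ) ^ (-b) else 0) := fun P _ => by
          split_ifs <;> simp [h0]
        linarith [this (m + (C + 3) * s * l < Real.log n), this (Real.log n < m - (C + 3) * s * l)]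
      · rw [if_neg h1]
        rw [abs_le, not_and_or, not_le, not_le] at h1
        rcases h1 with h1 | h1
        · rw [if_pos (show Real.log n < m - (C + 3) * s * l by linarith)]
          split_ifs <;> linarith
        · rw [if_pos (show m + (C + 3) * s * l < Real.log n by linarith)]
          split_ifs <;> linarith
    linarith

lemma exists_block_count {L : ℝ} (hL : 5 ≤ L) :
    ∃ n : ℕ, (4:ℝ) ^ n ≤ Real.exp L ∧ L / 2 ≤ n ∧ (n : ℝ) ≤ L := by
  have h4 := log4_le
  have h41 : 1 ≤ Real.log 4 := by
    have : (4:ℝ) = 2 ^ 2 := by norm_num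
    rw [this, Real.log_pow]
    have := Real.log_two_gt_d9
    push_cast; linarith
  have hfl := Nat.floor_le (show 0 ≤ L / 1.3864 by positivity)
  have hlt := Nat.lt_floor_add_one (L / 1.3864)
  have h1 : L / 1.3864 * 1.3864 = L := by field_simp
  refine ⟨⌊L / 1.3864⌋₊, ?_, ?_, ?_⟩
  · have : (4:ℝ) ^ ⌊L / 1.3864⌋₊ = Real.exp (⌊L / 1.3864⌋₊ * Real.log 4) := by
      rw [← Real.log_pow, Real.exp_log (by positivity)]
    rw [this]
    apply Real.exp_le_exp.2
    calc (⌊L / 1.3864⌋₊ : ℝ) * Real.log 4 ≤ L / 1.3864 * 1.3864 := by gcongr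
      _ = L := h1
  · nlinarith
  · nlinarith

lemma primesIn_subset_primesIn {z z' w w' : ℝ} (h : z' ≤ z) (h' : w ≤ w') :
    primesIn z w ⊆ primesIn z' w' := by
  intro p hp
  rw [mem_primesIn] at *
  exact ⟨hp.1, h.trans_lt hp.2.1, hp.2.2.trans h'⟩

lemma exists_mertens_lower : ∃ y₀ : ℝ, 2 ≤ y₀ ∧ ∀ y Q : ℝ, y₀ ≤ y → √y ≤ Q →
    Real.log y / 80 ≤ ∑ p ∈ primesIn (Q / Real.exp (Real.log y / 8)) Q, Real.log p / (p : ℝ) := by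
  obtain ⟨Q₀, h2, hQ₀⟩ := exists_blocks_lower
  obtain ⟨y₁, hy₁⟩ := Filter.eventually_atTop.1
    ((Real.tendsto_log_atTop.eventually_ge_atTop 40).and
    ((tendsto_rpow_atTop (show (0:ℝ) < 3 / 8 by norm_num)).eventually_ge_atTop Q₀))
  refine ⟨max 2 y₁, le_max_left _ _, fun y Q hy hQ => ?_⟩
  obtain ⟨hl, h3⟩ := hy₁ y ((le_max_right _ _).trans hy)
  have hy0 : 0 < y := by linarith [(le_max_left 2 y₁).trans hy]
  have hQ0 : 0 < Q := (Real.sqrt_pos.2 hy0).trans_le hQ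
  obtain ⟨n, hn1, hn2, -⟩ := exists_block_count (L := Real.log y / 8) (by linarith)
  have hQn : y ^ (3 / 8 : ℝ) ≤ Q / 4 ^ n := by
    rw [le_div_iff₀ (by positivity)]
    calc y ^ (3 / 8 : ℝ) * 4 ^ n ≤ y ^ (3 / 8 : ℝ) * Real.exp (Real.log y / 8) := by gcongr
      _ = √y := by
        rw [Real.rpow_def_of_pos hy0, ← Real.exp_add, Real.sqrt_eq_rpow, Real.rpow_def_of_pos hy0]
        congr 1; ring
      _ ≤ Q := hQ
  have h4 := hQ₀ Q 1 n hQ0 (by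
    rw [mul_div_assoc]
    have : 0 < y ^ (3 / 8 : ℝ) := by positivity
    linarith) (by norm_num)
  simp only [sub_self, Real.rpow_zero, sum_const, card_range, nsmul_eq_mul, mul_one] at h4
  calc Real.log y / 80 ≤ (n : ℝ) / 5 := by linarith
    _ ≤ _ := h4
    _ ≤ ∑ p ∈ primesIn (Q / Real.exp (Real.log y / 8)) Q, Real.log p * (p : ℝ) ^ (-1 : ℝ) := by
      apply sum_le_sum_of_subset_of_nonneg
      · apply primesIn_subset_primesIn _ le_rfl
        gcongr
      · intro p _ _; exact mul_nonneg (Real.log_natCast_nonneg p) (by positivity)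
    _ = _ := sum_congr rfl fun p _ => by rw [Real.rpow_neg_one, div_eq_mul_inv]

/-- `Ψ(t) ≫ t` when `t` is bounded by a fixed power of `y`. -/
lemma exists_sc_ge_mul : ∃ y₀ : ℝ, 2 ≤ y₀ ∧ ∀ k : ℕ, ∃ c : ℝ, 0 < c ∧ ∀ y t : ℝ, y₀ ≤ y → 1 ≤ t →
    Real.log t ≤ (1 + k / 2) * Real.log y → c * t ≤ sc y t := by
  obtain ⟨y₀, h2, hy₀⟩ := exists_mertens_lower
  refine ⟨y₀, h2, fun k => ?_⟩
  induction k with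
  | zero =>
    refine ⟨1 / 2, by norm_num, fun y t hy ht hlt => ?_⟩
    simp only [Nat.cast_zero, zero_div, add_zero, one_mul] at hlt
    have := half_le_sc ht ((Real.log_le_log_iff (by linarith) (by linarith)).1 hlt)
    linarith
  | succ k ih =>
    obtain ⟨c, hc0, hc⟩ := ih
    refine ⟨min c (c / (160 * (1 + (k + 1) / 2))), by positivity, fun y t hy ht hlt => ?_⟩
    by_cases hk : Real.log t ≤ (1 + k / 2) * Real.log y
    · refine le_trans ?_ (hc y t hy ht hk)
      gcongr; exact min_le_left _ _
    push Not at hk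
    have hy0 : 0 < y := by linarith
    have hl : 0 < Real.log y := Real.log_pos (by linarith)
    have hsq : Real.log √y = Real.log y / 2 := Real.log_sqrt hy0.le
    have hM := hy₀ y y hy (by
      rw [Real.sqrt_le_left hy0.le]; nlinarith)
    set P := primesIn (y / Real.exp (Real.log y / 8)) y with hP
    have hlarge : ∀ p ∈ P, √y ≤ p := by
      intro p hp
      rw [hP, mem_primesIn] at hp
      refine le_trans ?_ hp.2.1.le
      rw [Real.sqrt_eq_rpow, Real.rpow_def_of_pos hy0, le_div_iff₀ (Real.exp_pos _), ← Real.exp_add]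
      conv_rhs => rw [← Real.exp_log hy0]
      apply Real.exp_le_exp.2
      linarith
    have h1 := sum_sc_large_le (t := t) (show 1 < y by linarith) P (primesIn_subset le_rfl) hlarge
    have h3 : ∀ p ∈ P, c * t * (1 / p) ≤ sc y (t / p) := by
      intro p hp
      have hp' := hlarge p hp
      rw [hP, mem_primesIn] at hp
      have hp0 : (0:ℝ) < p := by exact_mod_cast hp.1.pos
      have hlp : Real.log y / 2 ≤ Real.log p := by
        rw [← hsq]; exact Real.log_le_log (Real.sqrt_pos.2 hy0) hp'
      have hlp2 : Real.log p ≤ Real.log y := Real.log_le_log hp0 hp.2.2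
      have := hc y (t / p) hy (by
        rw [le_div_iff₀ hp0, one_mul]
        refine hp.2.2.trans ?_
        apply (Real.log_le_log_iff hy0 (by linarith)).1
        have : 0 ≤ (k:ℝ) / 2 * Real.log y := by positivity
        linarith) (by
        rw [Real.log_div (by linarith) hp0.ne']
        push_cast at hlt
        linarith)
      calc c * t * (1 / p) = c * (t / p) := by ring
        _ ≤ _ := this
    have h4 : 1 / 80 ≤ ∑ p ∈ P, 1 / (p : ℝ) := by
      have h5 : ∑ p ∈ P, Real.log p / (p : ℝ) ≤ Real.log y * ∑ p ∈ P, 1 / (p : ℝ) := by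
        rw [mul_sum]
        refine sum_le_sum fun p hp => ?_
        rw [hP, mem_primesIn] at hp
        have hp0 : (0:ℝ) < p := by exact_mod_cast hp.1.pos
        rw [mul_one_div]
        gcongr
        exact hp.2.2
      have : Real.log y * (1 / 80) ≤ Real.log y * ∑ p ∈ P, 1 / (p : ℝ) := by linarith
      exact le_of_mul_le_mul_left this hl
    have h6 : c * t * (1 / 80) ≤ ∑ p ∈ P, sc y (t / p) := by
      calc c * t * (1 / 80) ≤ c * t * ∑ p ∈ P, 1 / (p : ℝ) := by gcongr
        _ ≤ _ := by rw [mul_sum]; exact sum_le_sum h3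
    push_cast at hlt
    have h7 : c * t * (1 / 80) * Real.log y ≤ 2 * (sc y t * ((1 + (k + 1) / 2) * Real.log y)) := by
      have := sc_nonneg y t
      calc c * t * (1 / 80) * Real.log y ≤ (∑ p ∈ P, sc y (t / p)) * Real.log y := by gcongr
        _ ≤ _ := h1
        _ ≤ _ := by gcongr
    have h8 : c * t * (1 / 80) ≤ 2 * (sc y t * (1 + (k + 1) / 2)) := by
      refine le_of_mul_le_mul_right ?_ hl
      linarith
    refine le_trans (mul_le_mul_of_nonneg_right (min_le_right _ _) (by linarith)) ?_
    rw [div_mul_eq_mul_div, div_le_iff₀ (by positivity)]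
    linarith

lemma sum_range_mul_le {f : ℕ → ℝ} (hf : Antitone f) (m n : ℕ) :
    ∑ i ∈ range (m * n), f i ≤ m * ∑ i ∈ range n, f i := by
  induction m with
  | zero => simp
  | succ m ih =>
    rw [add_mul, one_mul, sum_range_add]
    push_cast
    have : ∑ x ∈ range n, f (m * n + x) ≤ ∑ i ∈ range n, f i :=
      sum_le_sum fun i _ => hf (Nat.le_add_left _ _)
    linarith

lemma antitone_blocks {y a : ℝ} (hy : 0 < y) (ha : a ≤ 1) :
    Antitone (fun i : ℕ => (y / 4 ^ i) ^ (1 - a)) := by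
  intro i j hij
  have h4 : (4:ℝ) ^ i ≤ 4 ^ j := pow_le_pow_right₀ (by norm_num) hij
  apply Real.rpow_le_rpow (by positivity) _ (by linarith)
  gcongr

lemma exists_rpow_one_sub_le : ∃ y₀ : ℝ, 2 ≤ y₀ ∧ ∀ y a u : ℝ, y₀ ≤ y → 1 / 12 ≤ a → a ≤ 1 →
    1 ≤ u → mu y a = (u + 1) * Real.log y → y ^ (1 - a) ≤ 2916 * u ^ 2 := by
  obtain ⟨Q₀, h2, hQ₀⟩ := exists_blocks_lower
  obtain ⟨y₁, hy₁⟩ := Filter.eventually_atTop.1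
    ((Real.tendsto_log_atTop.eventually_ge_atTop 40).and
    ((tendsto_rpow_atTop (show (0:ℝ) < 5 / 8 by norm_num)).eventually_ge_atTop Q₀))
  refine ⟨max 2 y₁, le_max_left _ _, fun y a u hy ha ha1 hu hmu => ?_⟩
  obtain ⟨hl, h3⟩ := hy₁ y ((le_max_right _ _).trans hy)
  have hy0 : 0 < y := by linarith [(le_max_left 2 y₁).trans hy]
  obtain ⟨n, hn1, hn2, -⟩ := exists_block_count (L := 3 * Real.log y / 8) (by linarith)
  have hQn : y ^ (5 / 8 : ℝ) ≤ y / 4 ^ n := by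
    rw [le_div_iff₀ (by positivity)]
    calc y ^ (5 / 8 : ℝ) * 4 ^ n ≤ y ^ (5 / 8 : ℝ) * Real.exp (3 * Real.log y / 8) := by gcongr
      _ = y := by
        rw [Real.rpow_def_of_pos hy0, ← Real.exp_add]
        conv_rhs => rw [← Real.exp_log hy0]
        congr 1; ring
  have h4 := hQ₀ y a n hy0 (by
    rw [mul_div_assoc]
    have : 0 < y ^ (5 / 8 : ℝ) := by positivity
    linarith) (by linarith)
  have h5 := sum_log_rpow_le_mu (y := y) (a := a) (by linarith) _ (primesIn_subset (z := y / 4 ^ n) le_rfl)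
  set w := (y ^ (5 / 8 : ℝ)) ^ (1 - a) with hw
  have hw0 : 0 ≤ w := by positivity
  have h6 : (n : ℝ) * w ≤ ∑ i ∈ range n, (y / 4 ^ i) ^ (1 - a) := by
    have : ∀ i ∈ range n, w ≤ (y / 4 ^ i) ^ (1 - a) := fun i hi => by
      refine le_trans ?_ (antitone_blocks hy0 ha1 (mem_range.1 hi).le)
      exact Real.rpow_le_rpow (by positivity) hQn (by linarith)
    simpa using card_nsmul_le_sum _ _ _ this
  have h7 : w ≤ 54 * u := by
    have h8 : 3 * Real.log y / 16 * w ≤ n * w := by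
      gcongr; linarith
    have h9 : Real.log y * (3 * w) ≤ Real.log y * (80 * (u + 1)) := by
      rw [hmu] at h5; nlinarith
    have := le_of_mul_le_mul_left h9 (by linarith)
    linarith
  have h10 : y ^ (1 - a) = w ^ (8 / 5 : ℝ) := by
    rw [hw, ← Real.rpow_mul hy0.le, ← Real.rpow_mul hy0.le]
    congr 1; ring
  rw [h10]
  calc w ^ (8 / 5 : ℝ) ≤ (54 * u) ^ (8 / 5 : ℝ) := by gcongr
    _ ≤ (54 * u) ^ (2 : ℝ) := Real.rpow_le_rpow_of_exponent_le (by linarith) (by norm_num)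
    _ = _ := by norm_num; ring

lemma exists_mu_le_sum : ∃ C : ℝ, 1 ≤ C ∧ ∀ y a : ℝ, 1 / 12 ≤ a →
    mu y a ≤ C * ∑ p ∈ primesUpTo y, Real.log p * (p : ℝ) ^ (-a) := by
  set k : ℝ := 2 ^ (1 / 12 : ℝ) - 1 with hk
  have hk0 : 0 < k := by
    have := Real.one_lt_rpow (show (1:ℝ) < 2 by norm_num) (show (0:ℝ) < 1 / 12 by norm_num)
    linarith
  have hk1 : 0 < 1 / k := by positivity
  refine ⟨1 + 1 / k, by linarith, fun y a ha => ?_⟩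
  unfold mu
  rw [mul_sum]
  refine sum_le_sum fun p hp => ?_
  have hp2 := two_le_of_mem hp
  have hp0 : (0:ℝ) < p := by linarith
  have h1 := rpow_sub_one_pos hp (show 0 < a by linarith)
  have h4 : k ≤ (p : ℝ) ^ a - 1 := by
    rw [hk]
    have : (2:ℝ) ^ (1 / 12 : ℝ) ≤ (p : ℝ) ^ a :=
      (Real.rpow_le_rpow (by norm_num) hp2 (by norm_num)).trans
        (Real.rpow_le_rpow_of_exponent_le (by linarith) ha)
    linarith
  have h6 : (p : ℝ) ^ a ≤ (1 + 1 / k) * ((p : ℝ) ^ a - 1) := by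
    have : 1 ≤ 1 / k * ((p : ℝ) ^ a - 1) := by
      rw [one_div, ← div_eq_inv_mul, le_div_iff₀ hk0]; linarith
    linarith
  have hpa : 0 < (p : ℝ) ^ a := by positivity
  have hl0 := log_prime_nonneg hp
  rw [Real.rpow_neg hp0.le, div_le_iff₀ h1]
  calc Real.log p = Real.log p * ((p : ℝ) ^ a)⁻¹ * (p : ℝ) ^ a := by field_simp
    _ ≤ Real.log p * ((p : ℝ) ^ a)⁻¹ * ((1 + 1 / k) * ((p : ℝ) ^ a - 1)) := by gcongr
    _ = _ := by ring

/-- A large share of the saddle point sum comes from primes in `(√y, y / r]`. -/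
lemma exists_sum_primesIn_ge : ∃ c y₀ : ℝ, 0 < c ∧ 2 ≤ y₀ ∧ ∀ y a u r : ℝ, y₀ ≤ y → 1 / 12 ≤ a →
    a ≤ 1 → 1 ≤ u → mu y a = (u + 1) * Real.log y → 1 ≤ r → Real.log r ≤ Real.log y / 8 →
    c * u * r ^ (-(1 - a)) ≤ ∑ p ∈ primesIn (√y) (y / r), (p : ℝ) ^ (-a) := by
  obtain ⟨Q₀, h2, hQ₀⟩ := exists_blocks_lower
  obtain ⟨C, hC1, hC⟩ := exists_mu_le_sum
  obtain ⟨y₁, hy₁⟩ := Filter.eventually_atTop.1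
    ((Real.tendsto_log_atTop.eventually_ge_atTop 40).and
    ((tendsto_rpow_atTop (show (0:ℝ) < 1 / 2 by norm_num)).eventually_ge_atTop Q₀))
  refine ⟨1 / (180 * C), max 2 y₁, by positivity, le_max_left _ _, fun y a u r hy ha ha1 hu hmu hr hlr => ?_⟩
  obtain ⟨hl, h3⟩ := hy₁ y ((le_max_right _ _).trans hy)
  have hy0 : 0 < y := by linarith [(le_max_left 2 y₁).trans hy]
  have hr0 : 0 < r := by linarith
  obtain ⟨n, hn1, hn2, -⟩ := exists_block_count (L := 3 * Real.log y / 8) (by linarith)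
  have hrexp : r ≤ Real.exp (Real.log y / 8) := by
    rw [← Real.exp_log hr0]; exact Real.exp_le_exp.2 hlr
  have hsq : √y = y ^ (1 / 2 : ℝ) := Real.sqrt_eq_rpow y
  have hQn : √y ≤ y / r / 4 ^ n := by
    rw [div_div, le_div_iff₀ (by positivity)]
    calc √y * (r * 4 ^ n) ≤ √y * (Real.exp (Real.log y / 8) * Real.exp (3 * Real.log y / 8)) := by gcongr
      _ = y := by
        rw [hsq, Real.rpow_def_of_pos hy0, ← Real.exp_add, ← Real.exp_add]
        conv_rhs => rw [← Real.exp_log hy0]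
        congr 1; ring
  have h4 := hQ₀ (y / r) a n (by positivity) (by
    rw [mul_div_assoc]
    have : 0 ≤ √y := Real.sqrt_nonneg y
    rw [← hsq] at h3
    linarith) (by linarith)
  have h5 : ∑ p ∈ primesIn (y / r / 4 ^ n) (y / r), Real.log p * (p : ℝ) ^ (-a) ≤
      Real.log y * ∑ p ∈ primesIn (√y) (y / r), (p : ℝ) ^ (-a) := by
    rw [mul_sum]
    calc ∑ p ∈ primesIn (y / r / 4 ^ n) (y / r), Real.log p * (p : ℝ) ^ (-a)
        ≤ ∑ p ∈ primesIn (√y) (y / r), Real.log p * (p : ℝ) ^ (-a) := by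
          apply sum_le_sum_of_subset_of_nonneg (primesIn_subset_primesIn hQn le_rfl)
          intro p _ _; exact mul_nonneg (Real.log_natCast_nonneg p) (by positivity)
      _ ≤ _ := by
          refine sum_le_sum fun p hp => ?_
          rw [mem_primesIn] at hp
          have hp0 : (0:ℝ) < p := by exact_mod_cast hp.1.pos
          gcongr
          exact hp.2.2.trans (div_le_self hy0.le hr)
  have h6 : ∑ i ∈ range n, (y / r / 4 ^ i) ^ (1 - a) =
      r ^ (-(1 - a)) * ∑ i ∈ range n, (y / 4 ^ i) ^ (1 - a) := by
    rw [mul_sum]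
    refine sum_congr rfl fun i _ => ?_
    rw [show y / r / 4 ^ i = r⁻¹ * (y / 4 ^ i) by field_simp,
      Real.mul_rpow (by positivity) (by positivity), Real.inv_rpow hr0.le, Real.rpow_neg hr0.le]
  have h7 : mu y a ≤ C * (6 * (6 * ∑ i ∈ range n, (y / 4 ^ i) ^ (1 - a))) := by
    refine (hC y a ha).trans ?_
    have hy4 : y / 4 ^ (6 * n) < 2 := by
      rw [div_lt_iff₀ (by positivity)]
      have h8 : y ≤ 4 ^ (6 * n) := by
        rw [← Real.log_le_log_iff hy0 (by positivity), Real.log_pow]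
        have h41 : 1 ≤ Real.log 4 := by
          have : (4:ℝ) = 2 ^ 2 := by norm_num
          rw [this, Real.log_pow]
          have := Real.log_two_gt_d9
          push_cast; linarith
        push_cast
        nlinarith
      linarith
    have h9 : primesUpTo y = primesIn (y / 4 ^ (6 * n)) y := by
      ext p
      rw [mem_primesIn]
      constructor
      · intro hp; exact ⟨(mem_primesUpTo.1 hp).1, by linarith [two_le_of_mem hp], (mem_primesUpTo.1 hp).2⟩
      · rintro ⟨h, -, h'⟩; exact mem_primesUpTo.2 ⟨h, h'⟩
    have h10 := blocks_upper (6 * n) hy0 (by linarith) ha1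
    have h11 := sum_range_mul_le (antitone_blocks hy0 ha1) 6 n
    push_cast at h11
    rw [h9]
    gcongr
    linarith
  set B₁ := ∑ i ∈ range n, (y / 4 ^ i) ^ (1 - a)
  rw [h6] at h4
  rw [hmu] at h7
  have hl0 : 0 < Real.log y := by linarith
  have hR : 0 < r ^ (-(1 - a)) := by positivity
  refine le_of_mul_le_mul_left ?_ hl0
  refine le_trans ?_ (h4.trans h5)
  have h12 : u * Real.log y ≤ 36 * C * B₁ := by nlinarith
  calc Real.log y * (1 / (180 * C) * u * r ^ (-(1 - a)))
      = 1 / (180 * C) * r ^ (-(1 - a)) * (u * Real.log y) := by ring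
    _ ≤ 1 / (180 * C) * r ^ (-(1 - a)) * (36 * C * B₁) := by gcongr
    _ = _ := by field_simp; ring

lemma exists_sum_primesIn_ge_rpow : ∃ c y₀ : ℝ, 0 < c ∧ 2 ≤ y₀ ∧ ∀ y a u r : ℝ, y₀ ≤ y → 1 / 12 ≤ a →
    a ≤ 1 → 1 ≤ u → mu y a = (u + 1) * Real.log y → 1 ≤ r → Real.log r ≤ Real.log y / 8 →
    c * u ^ (3 / 4 : ℝ) ≤ ∑ p ∈ primesIn (√y) (y / r), (p : ℝ) ^ (-a) := by
  obtain ⟨c, y₁, hc0, hy₁2, hc⟩ := exists_sum_primesIn_ge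
  obtain ⟨y₂, hy₂2, hy₂⟩ := exists_rpow_one_sub_le
  refine ⟨c / 3, max y₁ y₂, by positivity, hy₁2.trans (le_max_left _ _),
    fun y a u r hy ha ha1 hu hmu hr hlr => ?_⟩
  refine le_trans ?_ (hc y a u r ((le_max_left _ _).trans hy) ha ha1 hu hmu hr hlr)
  have h1 := hy₂ y a u ((le_max_right _ _).trans hy) ha ha1 hu hmu
  have hy0 : 0 < y := by linarith [(le_max_left _ _).trans hy]
  have hr0 : 0 < r := by linarith
  have h2 : r ^ (1 - a) ≤ 3 * u ^ (1 / 4 : ℝ) := by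
    calc r ^ (1 - a) ≤ (y ^ (1 / 8 : ℝ)) ^ (1 - a) := by
          apply Real.rpow_le_rpow hr0.le _ (by linarith)
          rw [Real.rpow_def_of_pos hy0, ← Real.exp_log hr0]
          apply Real.exp_le_exp.2
          linarith
      _ = (y ^ (1 - a)) ^ (1 / 8 : ℝ) := by
          rw [← Real.rpow_mul hy0.le, ← Real.rpow_mul hy0.le, mul_comm]
      _ ≤ (2916 * u ^ 2) ^ (1 / 8 : ℝ) := by gcongr
      _ ≤ (3 ^ 8 * u ^ 2) ^ (1 / 8 : ℝ) := by gcongr; norm_num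
      _ = 3 * u ^ (1 / 4 : ℝ) := by
          rw [Real.mul_rpow (by norm_num) (by positivity), ← Real.rpow_natCast, ← Real.rpow_natCast,
            ← Real.rpow_mul (by norm_num), ← Real.rpow_mul (by linarith)]
          norm_num
  have h3 : u = u ^ (3 / 4 : ℝ) * u ^ (1 / 4 : ℝ) := by
    rw [← Real.rpow_add (by linarith)]; norm_num
  have hu4 : 0 < u ^ (3 / 4 : ℝ) := by positivity
  have hra : 0 < r ^ (1 - a) := by positivity
  rw [Real.rpow_neg hr0.le, ← div_eq_mul_inv, le_div_iff₀ hra]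
  calc c / 3 * u ^ (3 / 4 : ℝ) * r ^ (1 - a) ≤ c / 3 * u ^ (3 / 4 : ℝ) * (3 * u ^ (1 / 4 : ℝ)) := by gcongr
    _ = c * (u ^ (3 / 4 : ℝ) * u ^ (1 / 4 : ℝ)) := by ring
    _ = c * u := by rw [← h3]

lemma sum_vonMangoldt_sm_le {y z : ℝ} (hz : 1 ≤ z) :
    ∑ d ∈ sm y z, ArithmeticFunction.vonMangoldt d ≤
      ((primesUpTo (min y z)).card : ℝ) * Real.log z := by
  have h1 : ∑ d ∈ sm y z, ArithmeticFunction.vonMangoldt d =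
      ∑ d ∈ (sm y z).filter IsPrimePow, Real.log d.minFac := by
    rw [sum_filter]
    rfl
  have hmaps : ∀ d ∈ (sm y z).filter IsPrimePow, d.minFac ∈ primesUpTo (min y z) := by
    intro d hd
    rw [mem_filter, mem_sm] at hd
    have hd1 : d ≠ 1 := hd.2.ne_one
    rw [mem_primesUpTo]
    refine ⟨Nat.minFac_prime hd1, le_min (hd.1.2.2 _ (Nat.minFac_prime hd1) (Nat.minFac_dvd d)) ?_⟩
    exact le_trans (by exact_mod_cast Nat.minFac_le (by omega)) hd.1.2.1
  rw [h1, ← sum_fiberwise_of_maps_to hmaps, ← nsmul_eq_mul, ← sum_const]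
  refine sum_le_sum fun p hp => ?_
  have hpp := (mem_primesUpTo.1 hp).1
  rw [sum_congr rfl fun d hd => by rw [(mem_filter.1 hd).2], sum_const, nsmul_eq_mul]
  have hsub : ((sm y z).filter IsPrimePow).filter (fun d => d.minFac = p) ⊆
      (Icc 1 (Nat.log p ⌊z⌋₊)).image (fun k => p ^ k) := by
    intro d hd
    rw [mem_filter, mem_filter, mem_sm] at hd
    obtain ⟨⟨⟨hd1, hd2, -⟩, hd3⟩, hd4⟩ := hd
    rw [isPrimePow_nat_iff] at hd3
    obtain ⟨r, k, hr, hk, rfl⟩ := hd3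
    rw [Nat.Prime.pow_minFac hr hk.ne'] at hd4
    subst hd4
    refine mem_image_of_mem _ (mem_Icc.2 ⟨hk, ?_⟩)
    exact Nat.le_log_of_pow_le hr.one_lt (Nat.le_floor hd2)
  have hcard := (card_le_card hsub).trans card_image_le
  rw [Nat.card_Icc, Nat.add_sub_cancel] at hcard
  have hfl : ⌊z⌋₊ ≠ 0 := (Nat.floor_pos.2 hz).ne'
  calc _ ≤ (Nat.log p ⌊z⌋₊ : ℝ) * Real.log p :=
        mul_le_mul_of_nonneg_right (by exact_mod_cast hcard) (Real.log_natCast_nonneg p)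
    _ = Real.log ((p : ℝ) ^ Nat.log p ⌊z⌋₊) := (Real.log_pow _ _).symm
    _ ≤ Real.log z := by
        apply Real.log_le_log (pow_pos (by exact_mod_cast hpp.pos) _)
        refine le_trans ?_ (Nat.floor_le (by linarith : (0:ℝ) ≤ z))
        exact_mod_cast Nat.pow_log_le_self p hfl

lemma sum_vonMangoldt_sm_le_rpow {y z a : ℝ} (hy : 1 ≤ Real.log y) (hy0 : 2 ≤ y) (hz : 1 ≤ z)
    (ha : 1 / 12 ≤ a) (ha1 : a ≤ 1) :
    ∑ d ∈ sm y z, ArithmeticFunction.vonMangoldt d ≤ 65 * y ^ (1 - a) * z ^ a := by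
  refine (sum_vonMangoldt_sm_le hz).trans ?_
  have hy' : 0 < y := by linarith
  have hz' : 0 < z := by linarith
  rcases le_total z y with h | h
  · rw [min_eq_right h]
    have h1 : z ≤ y ^ (1 - a) * z ^ a := by
      calc z = z ^ (1 - a) * z ^ a := by
            rw [← Real.rpow_add hz']; simp
        _ ≤ _ := by gcongr
    rcases le_or_gt 2 z with h2 | h2
    · have := card_primesUpTo_mul_log_le h2
      linarith
    · have : primesUpTo z = ∅ := by
        rw [eq_empty_iff_forall_notMem]
        intro p hp
        linarith [two_le_of_mem hp, (mem_primesUpTo.1 hp).2]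
      rw [this, card_empty, Nat.cast_zero, zero_mul]; positivity
  · rw [min_eq_left h]
    have h1 := card_primesUpTo_mul_log_le hy0
    set N : ℝ := ((primesUpTo y).card : ℝ)
    have hN : 0 ≤ N := Nat.cast_nonneg _
    have hq : 1 ≤ z / y := by rwa [one_le_div hy']
    have h2 : Real.log z ≤ Real.log y * (13 * (z / y) ^ a) := by
      have h3 : Real.log z = Real.log y + Real.log (z / y) := by
        rw [Real.log_div hz'.ne' hy'.ne']; ring
      have h4 : Real.log (z / y) ≤ 12 * (z / y) ^ a := by
        refine (Real.log_le_rpow_div (by positivity) (by linarith : 0 < a)).trans ?_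
        rw [div_le_iff₀ (by linarith)]
        have : 0 ≤ (z / y) ^ a := by positivity
        nlinarith
      have h5 : 1 ≤ (z / y) ^ a := Real.one_le_rpow hq (by linarith)
      nlinarith
    calc N * Real.log z ≤ N * (Real.log y * (13 * (z / y) ^ a)) := by gcongr
      _ = N * Real.log y * (13 * (z / y) ^ a) := by ring
      _ ≤ 5 * y * (13 * (z / y) ^ a) := by gcongr
      _ = 65 * (y ^ (1 : ℝ) / y ^ a) * z ^ a := by
          rw [Real.div_rpow hz'.le hy'.le, Real.rpow_one]; ring
      _ = _ := by rw [← Real.rpow_sub hy']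

lemma sum_log_le_sum_vonMangoldt {y T : ℝ} {R : ℕ → Prop} (hR : ∀ m n : ℕ, m ∣ n → R n → R m) :
    ∑ n ∈ (sm y T).filter R, Real.log n ≤
      ∑ m ∈ (sm y T).filter R, ∑ d ∈ sm y (T / m), ArithmeticFunction.vonMangoldt d := by
  set M := (sm y T).filter R
  have h1 : ∀ n ∈ M, Real.log n =
      ∑ m ∈ M, if m ∣ n then ArithmeticFunction.vonMangoldt (n / m) else 0 := by
    intro n hn
    have hn' := mem_filter.1 hn
    have hn2 := mem_sm.1 hn'.1
    rw [← ArithmeticFunction.vonMangoldt_sum, ← Nat.sum_div_divisors, ← sum_filter]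
    refine sum_congr ?_ fun _ _ => rfl
    ext m
    rw [Nat.mem_divisors, mem_filter]
    constructor
    · rintro ⟨h, -⟩
      refine ⟨mem_filter.2 ⟨mem_sm.2 ⟨Nat.pos_of_dvd_of_pos h hn2.1, ?_, hn2.2.2.of_dvd h⟩, hR _ _ h hn'.2⟩, h⟩
      exact le_trans (by exact_mod_cast Nat.le_of_dvd hn2.1 h) hn2.2.1
    · rintro ⟨-, h⟩
      exact ⟨h, by omega⟩
  rw [sum_congr rfl h1, sum_comm]
  refine sum_le_sum fun m hm => ?_
  have hm1 := (mem_sm.1 (mem_filter.1 hm).1).1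
  rw [← sum_filter]
  have hinj : Set.InjOn (fun n => n / m) (M.filter (fun n => m ∣ n) : Finset ℕ) := by
    intro n hn n' hn' h
    rw [mem_coe, mem_filter] at hn hn'
    exact (Nat.div_left_inj hn.2 hn'.2).1 h
  rw [← sum_image (f := fun d => ArithmeticFunction.vonMangoldt d) hinj]
  refine sum_le_sum_of_subset_of_nonneg ?_ fun _ _ _ => ArithmeticFunction.vonMangoldt_nonneg
  intro d hd
  obtain ⟨n, hn, rfl⟩ := mem_image.1 hd
  rw [mem_filter, mem_filter, mem_sm] at hn
  obtain ⟨⟨⟨hn1, hn2, hn3⟩, -⟩, k, rfl⟩ := hn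
  have hmr : (0:ℝ) < m := by exact_mod_cast hm1
  simp only [Nat.mul_div_cancel_left k hm1]
  rw [mem_sm]
  refine ⟨Nat.pos_of_ne_zero fun h => by simp [h] at hn1, ?_, hn3.of_dvd (Dvd.intro_left m rfl)⟩
  rw [le_div_iff₀ hmr]
  push_cast at hn2; linarith

lemma sm_le_of_mem {y T : ℝ} {n : ℕ} (h : n ∈ sm y T) : (0:ℝ) < n ∧ (n : ℝ) ≤ T :=
  ⟨by exact_mod_cast (mem_sm.1 h).1, (mem_sm.1 h).2.1⟩

lemma sc_le_rpow_mul_eulerZ {y T a : ℝ} (hy : 0 ≤ y) (hT : 0 ≤ T) (ha : 0 < a) :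
    sc y T ≤ T ^ a * eulerZ y a := by
  refine le_trans ?_ (mul_le_mul_of_nonneg_left (sum_smooth_le hy ha (sm y T) fun n hn =>
    ⟨(mem_sm.1 hn).1, (mem_sm.1 hn).2.2⟩) (by positivity))
  unfold sc
  rw [mul_sum, ← mul_one ((sm y T).card : ℝ), ← nsmul_eq_mul, ← sum_const]
  refine sum_le_sum fun n hn => ?_
  obtain ⟨h1, h2⟩ := sm_le_of_mem hn
  rw [Real.rpow_neg h1.le, ← div_eq_mul_inv, one_le_div (by positivity)]
  gcongr

/-- Counting smooth numbers in a divisor closed set. -/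
lemma card_divisor_closed_le {y T a : ℝ} {R : ℕ → Prop} (hR : ∀ m n : ℕ, m ∣ n → R n → R m)
    (hy : 1 ≤ Real.log y) (hy0 : 2 ≤ y) (hT : 1 < T) (ha : 1 / 12 ≤ a) (ha1 : a ≤ 1) :
    (((sm y T).filter R).card : ℝ) ≤ T ^ (a / 2) * eulerZ y a +
      130 * y ^ (1 - a) / Real.log T * T ^ a * ∑ m ∈ (sm y T).filter R, (m : ℝ) ^ (-a) := by
  have hl : 0 < Real.log T := Real.log_pos hT
  have hT0 : 0 < T := by linarith
  have h1 : ∑ n ∈ (sm y T).filter R, Real.log n ≤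
      65 * y ^ (1 - a) * T ^ a * ∑ m ∈ (sm y T).filter R, (m : ℝ) ^ (-a) := by
    refine (sum_log_le_sum_vonMangoldt hR).trans ?_
    rw [mul_sum]
    refine sum_le_sum fun m hm => ?_
    obtain ⟨hm0, hm1⟩ := sm_le_of_mem (mem_filter.1 hm).1
    refine (sum_vonMangoldt_sm_le_rpow hy hy0 (by rwa [one_le_div hm0]) ha ha1).trans_eq ?_
    rw [Real.div_rpow hT0.le hm0.le, Real.rpow_neg hm0.le]; ring
  have h2 : ∀ n ∈ (sm y T).filter R, Real.log T / 2 ≤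
      (if (n : ℝ) ≤ √T then Real.log T / 2 else 0) + Real.log n := by
    intro n hn
    have := Real.log_natCast_nonneg n
    split_ifs with h
    · linarith
    · rw [zero_add, ← Real.log_sqrt hT0.le]
      exact Real.log_le_log (Real.sqrt_pos.2 hT0) (by linarith)
  have h3 := sum_le_sum h2
  rw [sum_const, nsmul_eq_mul, sum_add_distrib, ← sum_filter, sum_const, nsmul_eq_mul] at h3
  have h4 : ((((sm y T).filter R).filter (fun n : ℕ => (n : ℝ) ≤ √T)).card : ℝ) ≤
      T ^ (a / 2) * eulerZ y a := by
    have h5 : ((sm y T).filter R).filter (fun n : ℕ => (n : ℝ) ≤ √T) ⊆ sm y (√T) := by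
      intro n hn
      rw [mem_filter, mem_filter, mem_sm] at hn
      exact mem_sm.2 ⟨hn.1.1.1, hn.2, hn.1.1.2.2⟩
    refine le_trans (Nat.cast_le.2 (card_le_card h5)) ((sc_le_rpow_mul_eulerZ (by linarith) (Real.sqrt_nonneg T) (by linarith : 0 < a)).trans_eq ?_)
    rw [Real.sqrt_eq_rpow, ← Real.rpow_mul hT0.le]
    congr 2; ring
  set D := ∑ m ∈ (sm y T).filter R, (m : ℝ) ^ (-a)
  set B := (((sm y T).filter R).card : ℝ)
  have h6 : B * (Real.log T / 2) ≤ T ^ (a / 2) * eulerZ y a * (Real.log T / 2) +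
      65 * y ^ (1 - a) * T ^ a * D := by
    refine h3.trans (add_le_add ?_ h1)
    gcongr
  have h7 : T ^ (a / 2) * eulerZ y a + 130 * y ^ (1 - a) / Real.log T * T ^ a * D =
      (T ^ (a / 2) * eulerZ y a * (Real.log T / 2) + 65 * y ^ (1 - a) * T ^ a * D) / (Real.log T / 2) := by
    field_simp; ring
  rw [h7, le_div_iff₀ (by positivity)]
  exact h6

lemma sum_few_prime_factors_le {y a : ℝ} (hy : 0 ≤ y) (ha : 0 < a) (P₀ : Finset ℕ)
    (hP : P₀ ⊆ primesUpTo y) (S : Finset ℕ) (hS : ∀ n ∈ S, 1 ≤ n ∧ IsSmooth y n) :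
    ∑ n ∈ S.filter (fun n => (omegaIn P₀ n : ℝ) < (∑ p ∈ P₀, (p : ℝ) ^ (-a)) / 2), (n : ℝ) ^ (-a) ≤
      eulerZ y a * Real.exp (-(1 / 10) * ∑ p ∈ P₀, (p : ℝ) ^ (-a)) := by
  set E := ∑ p ∈ P₀, (p : ℝ) ^ (-a)
  have h1 := sum_smooth_weighted_le hy ha P₀ hP (S.filter (fun n => (omegaIn P₀ n : ℝ) < E / 2))
    fun n hn => hS n (mem_filter.1 hn).1
  have h2 : ∑ n ∈ S.filter (fun n => (omegaIn P₀ n : ℝ) < E / 2), (n : ℝ) ^ (-a) ≤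
      Real.exp (E / 2) * ∑ n ∈ S.filter (fun n => (omegaIn P₀ n : ℝ) < E / 2),
        (n : ℝ) ^ (-a) * Real.exp (-(omegaIn P₀ n : ℝ)) := by
    rw [mul_sum]
    refine sum_le_sum fun n hn => ?_
    have h3 : 1 ≤ Real.exp (E / 2) * Real.exp (-(omegaIn P₀ n : ℝ)) := by
      rw [← Real.exp_add]
      exact Real.one_le_exp (by linarith [(mem_filter.1 hn).2])
    have h4 : (0:ℝ) ≤ (n : ℝ) ^ (-a) := by positivity
    nlinarith
  refine h2.trans ((mul_le_mul_of_nonneg_left h1 (Real.exp_pos _).le).trans_eq ?_)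
  rw [mul_left_comm, ← Real.exp_add]
  congr 2; ring

/-- Smooth numbers with few prime factors in `P₀` are rare. -/
lemma card_few_prime_factors_le {y T a : ℝ} (hy : 1 ≤ Real.log y) (hy0 : 2 ≤ y) (hT : 1 < T)
    (ha : 1 / 12 ≤ a) (ha1 : a ≤ 1) (P₀ : Finset ℕ) (hP : P₀ ⊆ primesUpTo y) :
    (((sm y T).filter (fun n => (omegaIn P₀ n : ℝ) < (∑ p ∈ P₀, (p : ℝ) ^ (-a)) / 2)).card : ℝ) ≤
      T ^ (a / 2) * eulerZ y a + 130 * y ^ (1 - a) / Real.log T * T ^ a *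
        (eulerZ y a * Real.exp (-(1 / 10) * ∑ p ∈ P₀, (p : ℝ) ^ (-a))) := by
  have hl : 0 < Real.log T := Real.log_pos hT
  refine (card_divisor_closed_le (fun m n hmn h => ?_) hy hy0 hT ha ha1).trans ?_
  · refine lt_of_le_of_lt ?_ h
    exact_mod_cast omegaIn_mono_dvd hmn
  · have := sum_few_prime_factors_le (by linarith : 0 ≤ y) (by linarith : 0 < a) P₀ hP (sm y T)
      fun n hn => ⟨(mem_sm.1 hn).1, (mem_sm.1 hn).2.2⟩
    gcongr

/-- The sum of `n ^ (-b)` over the `y`-smooth integers `n` in `(v / √y, v]`. -/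
def cellSum (y b v : ℝ) : ℝ := ∑ n ∈ (sm y v).filter (fun n : ℕ => v / √y < (n : ℝ)), (n : ℝ) ^ (-b)

lemma cellSum_nonneg (y b v : ℝ) : 0 ≤ cellSum y b v := sum_nonneg fun _ _ => by positivity

lemma exists_cellSum_step : ∃ y₀ : ℝ, 2 ≤ y₀ ∧ ∀ y b v : ℝ, y₀ ≤ y → 0 ≤ b → b ≤ 1 → 0 < v →
    Real.log y * cellSum y b v ≤ 80 * (Real.log (v * √y) * cellSum y b (v * √y)) := by
  obtain ⟨y₀, hy₀2, hy₀⟩ := exists_mertens_lower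
  refine ⟨y₀, hy₀2, fun y b v hy hb hb1 hv => ?_⟩
  have hy0 : 0 < y := by linarith
  have hl : 0 < Real.log y := Real.log_pos (by linarith)
  have hs : 0 < √y := Real.sqrt_pos.2 hy0
  have hss : √y * √y = y := Real.mul_self_sqrt hy0.le
  set e := Real.exp (Real.log y / 8) with he
  have hes : e ≤ √y := by
    rw [he, Real.sqrt_eq_rpow, Real.rpow_def_of_pos hy0]
    exact Real.exp_le_exp.2 (by linarith)
  have he1 : 1 ≤ e := Real.one_le_exp (by linarith)
  set M := (sm y v).filter (fun n : ℕ => v / √y < (n : ℝ)) with hM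
  set N := (sm y (v * √y)).filter (fun n : ℕ => v * √y / √y < (n : ℝ)) with hN
  have h1 : ∑ n ∈ N, ∑ p ∈ primesUpTo y, (if p ∣ n then Real.log p * (n : ℝ) ^ (-b) else 0) ≤
      Real.log (v * √y) * cellSum y b (v * √y) := by
    unfold cellSum
    rw [mul_sum]
    refine sum_le_sum fun n hn => ?_
    have hn1 := mem_sm.1 (mem_filter.1 hn).1
    have h2 := sum_prime_pow_dvd_le (show n ≠ 0 by omega) (primesUpTo y)
      (fun p hp => (mem_primesUpTo.1 hp).1) 1
    simp only [Icc_self, sum_singleton, pow_one] at h2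
    have h3 : ∑ p ∈ primesUpTo y, (if p ∣ n then Real.log p * (n : ℝ) ^ (-b) else 0) =
        (∑ p ∈ primesUpTo y, (if p ∣ n then Real.log p else 0)) * (n : ℝ) ^ (-b) := by
      rw [sum_mul]
      exact sum_congr rfl fun p _ => by split_ifs <;> simp
    rw [h3]
    refine mul_le_mul_of_nonneg_right (h2.trans ?_) (by positivity)
    exact Real.log_le_log (by exact_mod_cast hn1.1) hn1.2.1
  have h4 : ∑ p ∈ primesUpTo y, ∑ n ∈ M, (if p ∈ primesIn (v * √y / n / e) (v * √y / n) then
      Real.log p * ((p * n : ℕ) : ℝ) ^ (-b) else 0) ≤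
      ∑ n ∈ N, ∑ p ∈ primesUpTo y, (if p ∣ n then Real.log p * (n : ℝ) ^ (-b) else 0) := by
    rw [sum_comm (s := N)]
    refine sum_le_sum fun p hp => ?_
    have hp1 := (mem_primesUpTo.1 hp).1
    rw [← sum_filter, ← sum_filter]
    have hinj : Set.InjOn (fun n => p * n)
        (M.filter (fun n : ℕ => p ∈ primesIn (v * √y / n / e) (v * √y / n)) : Finset ℕ) := by
      intro n _ m _ h
      exact Nat.eq_of_mul_eq_mul_left hp1.pos h
    rw [← sum_image (f := fun n : ℕ => Real.log p * (n : ℝ) ^ (-b)) hinj]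
    refine sum_le_sum_of_subset_of_nonneg ?_ fun n _ _ =>
      mul_nonneg (Real.log_natCast_nonneg p) (by positivity)
    intro m hm
    obtain ⟨n, hn, rfl⟩ := mem_image.1 hm
    rw [mem_filter, hM, mem_filter, mem_sm, mem_primesIn] at hn
    obtain ⟨⟨⟨hn1, hn2, hn3⟩, hn4⟩, -, hp2, hp3⟩ := hn
    have hn0 : (0:ℝ) < n := by exact_mod_cast hn1
    rw [mem_filter, hN, mem_filter, mem_sm]
    rw [le_div_iff₀ hn0] at hp3
    refine ⟨⟨⟨Nat.mul_pos hp1.pos hn1, by push_cast; exact hp3,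
      (isSmooth_of_mem hp).mul hn3⟩, ?_⟩, dvd_mul_right p n⟩
    push_cast
    rw [mul_div_cancel_right₀ _ hs.ne']
    rw [div_div, div_lt_iff₀ (by positivity)] at hp2
    have h5 : v * √y < p * n * √y := by
      calc v * √y < p * (n * e) := hp2
        _ = p * n * e := by ring
        _ ≤ _ := by gcongr
    exact lt_of_mul_lt_mul_right h5 hs.le
  have h6 : Real.log y / 80 * cellSum y b v ≤
      ∑ p ∈ primesUpTo y, ∑ n ∈ M, (if p ∈ primesIn (v * √y / n / e) (v * √y / n) then
      Real.log p * ((p * n : ℕ) : ℝ) ^ (-b) else 0) := by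
    rw [sum_comm]
    unfold cellSum
    rw [mul_sum]
    refine sum_le_sum fun n hn => ?_
    rw [mem_filter, mem_sm] at hn
    obtain ⟨⟨hn1, hn2, hn3⟩, hn4⟩ := hn
    have hn0 : (0:ℝ) < n := by exact_mod_cast hn1
    have hq1 : √y ≤ v * √y / n := by
      rw [le_div_iff₀ hn0, mul_comm]; gcongr
    have hq2 : v * √y / n ≤ y := by
      rw [div_lt_iff₀ hs] at hn4
      rw [div_le_iff₀ hn0]
      calc v * √y ≤ n * √y * √y := by gcongr
        _ = y * n := by rw [mul_assoc, hss, mul_comm]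
    have h7 := hy₀ y (v * √y / n) hy hq1
    have h8 : (primesUpTo y).filter (fun p => p ∈ primesIn (v * √y / n / e) (v * √y / n)) =
        primesIn (v * √y / n / e) (v * √y / n) := by
      ext p
      rw [mem_filter]
      exact ⟨fun h => h.2, fun h => ⟨primesIn_subset hq2 h, h⟩⟩
    rw [← sum_filter, h8]
    refine (mul_le_mul_of_nonneg_right h7 (by positivity)).trans ?_
    rw [sum_mul]
    refine sum_le_sum fun p hp => ?_
    rw [mem_primesIn] at hp
    have hp1 : (1:ℝ) ≤ p := by exact_mod_cast hp.1.one_le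
    push_cast
    rw [Real.mul_rpow (by positivity) hn0.le, div_eq_mul_inv, ← mul_assoc]
    have h9 : (p : ℝ)⁻¹ ≤ (p : ℝ) ^ (-b) := by
      rw [← Real.rpow_neg_one]
      exact Real.rpow_le_rpow_of_exponent_le hp1 (by linarith)
    gcongr
  have := h6.trans (h4.trans h1)
  linarith

lemma cellSum_iterate {y b T u : ℝ} (hs : ∀ v : ℝ, 0 < v → Real.log y * cellSum y b v ≤
    80 * (Real.log (v * √y) * cellSum y b (v * √y))) (hy : 1 < y) (hT : 0 < T) (hu : 0 ≤ u)
    (hTu : Real.log T = u * Real.log y) (i : ℕ) :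
    cellSum y b (T / √y ^ i) ≤ (80 * u) ^ i * cellSum y b T := by
  have hl := Real.log_pos hy
  have hsq : 0 < √y := Real.sqrt_pos.2 (by linarith)
  have hsq1 : 1 ≤ √y := Real.one_le_sqrt.2 hy.le
  induction i with
  | zero => simp
  | succ i ih =>
    have h1 := hs (T / √y ^ (i + 1)) (by positivity)
    have h2 : T / √y ^ (i + 1) * √y = T / √y ^ i := by
      rw [pow_succ]; field_simp
    rw [h2] at h1
    have h3 : Real.log (T / √y ^ i) ≤ u * Real.log y := by
      rw [← hTu]
      exact Real.log_le_log (by positivity) (div_le_self hT.le (one_le_pow₀ hsq1))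
    have h4 := cellSum_nonneg y b (T / √y ^ i)
    have h5 : Real.log y * cellSum y b (T / √y ^ (i + 1)) ≤
        Real.log y * (80 * u * cellSum y b (T / √y ^ i)) := by
      have := mul_le_mul_of_nonneg_right h3 h4
      linarith
    refine (le_of_mul_le_mul_left h5 hl).trans ?_
    rw [pow_succ' (80 * u), mul_assoc (80 * u)]
    exact mul_le_mul_of_nonneg_left ih (by positivity)

lemma sum_le_sum_cellSum (y b T : ℝ) (hy : 0 < y) (I : ℕ) :
    ∑ n ∈ (sm y T).filter (fun n : ℕ => T / √y ^ I < (n : ℝ)), (n : ℝ) ^ (-b) ≤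
      ∑ i ∈ range I, cellSum y b (T / √y ^ i) := by
  have hs : 0 < √y := Real.sqrt_pos.2 hy
  induction I with
  | zero =>
    rw [range_zero, sum_empty]
    refine (sum_eq_zero fun n hn => ?_).le
    rw [mem_filter, mem_sm] at hn
    simp only [pow_zero, div_one] at hn
    linarith [hn.1.2.1, hn.2]
  | succ I ih =>
    rw [sum_range_succ]
    refine le_trans ?_ (add_le_add_left ih _)
    unfold cellSum
    rw [← sum_filter_add_sum_filter_not _ (fun n : ℕ => T / √y ^ I < (n : ℝ)), filter_filter,
      filter_filter]
    apply add_le_add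
    · apply sum_le_sum_of_subset_of_nonneg
      · intro n hn
        rw [mem_filter] at *
        exact ⟨hn.1, hn.2.2⟩
      · intros; positivity
    · apply sum_le_sum_of_subset_of_nonneg
      · intro n hn
        rw [mem_filter, mem_sm] at *
        refine ⟨⟨hn.1.1, not_lt.1 hn.2.2, hn.1.2.2⟩, ?_⟩
        rw [div_div, ← pow_succ]; exact hn.2.1
      · intros; positivity

set_option maxHeartbeats 400000 in
lemma exists_eulerZ_le : ∃ K C y₀ : ℝ, 1 ≤ K ∧ 0 < C ∧ 2 ≤ y₀ ∧ ∀ y a T u : ℝ, y₀ ≤ y → 1 / 12 ≤ a →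
    a ≤ 1 → 0 < T → 4 * K ^ 2 ≤ u → Real.log T = u * Real.log y → mu y a = (u + 1) * Real.log y →
    T ^ a * eulerZ y a ≤ C * u ^ 2 * (80 * u) ^ (12 * K * √u) * ((1 + Real.log T) * sc y T) := by
  obtain ⟨K, hK1, hK⟩ := exists_window
  obtain ⟨y₁, hy₁2, hy₁⟩ := exists_cellSum_step
  obtain ⟨y₂, hy₂2, hy₂⟩ := exists_rpow_one_sub_le
  obtain ⟨C₁, hC₁2, hC₁⟩ := exists_mass_le
  obtain ⟨C₀, hC₀0, hC₀⟩ := exists_mu_one_le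
  obtain ⟨y₃, hy₃⟩ := Filter.eventually_atTop.1
    (Real.tendsto_log_atTop.eventually_ge_atTop (max 24 C₀))
  refine ⟨K, 2916 * C₁, max (max y₁ y₂) y₃, hK1, by positivity, ?_,
    fun y a T u hy ha ha1 hT hu hTu hmu => ?_⟩
  · exact hy₁2.trans ((le_max_left _ _).trans (le_max_left _ _))
  have hy1 : y₁ ≤ y := ((le_max_left _ _).trans (le_max_left _ _)).trans hy
  have hy2 : y₂ ≤ y := ((le_max_right _ _).trans (le_max_left _ _)).trans hy
  have hlm := hy₃ y ((le_max_right _ _).trans hy)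
  have hl24 : 24 ≤ Real.log y := (le_max_left _ _).trans hlm
  have hlC : C₀ ≤ Real.log y := (le_max_right _ _).trans hlm
  set l := Real.log y with hl
  have hl0 : 0 < l := by linarith
  have hy0 : 0 < y := by linarith
  have hu4 : 4 ≤ u := by nlinarith
  have hu0 : 0 ≤ u := by linarith
  have hsu : 2 * K ≤ √u := by
    apply Real.le_sqrt_of_sq_le; linarith
  have hsu2 : √u * √u = u := Real.mul_self_sqrt hu0
  have hsu0 : 0 < √u := by linarith
  have hKsu : 2 ≤ K * √u := by nlinarith
  set U := u - K * √u with hU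
  have hUu : U ≤ u := by
    have : 0 ≤ K * √u := by positivity
    linarith
  have hU2 : 2 ≤ U := by nlinarith
  obtain ⟨b, hab, hb1, hmub⟩ := exists_mu_eq (y := y) (a := a) (b := 1) (v := U * l) (by linarith) ha1
    (by have := hC₀ y (by linarith); nlinarith) (by rw [hmu]; gcongr; linarith)
  have hb0 : 0 < b := by linarith
  obtain ⟨S, hS1, hS2, hS3⟩ := hK y b U hy0.le hl24 (by linarith) (by linarith) hmub
  set I := ⌈4 * K * √u⌉₊ + 1 with hI
  have hI1 : 4 * K * √u < I := by
    have := Nat.le_ceil (4 * K * √u)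
    rw [hI]; push_cast; linarith
  have hI2 : (I : ℝ) ≤ 4 * K * √u + 2 := by
    have := Nat.ceil_lt_add_one (show 0 ≤ 4 * K * √u by positivity)
    rw [hI]; push_cast; linarith
  have hsU : K * √U ≤ K * √u := by gcongr
  have hsq : 0 < √y := Real.sqrt_pos.2 hy0
  have hlsq : Real.log √y = l / 2 := Real.log_sqrt hy0.le
  have hSsub : S ⊆ (sm y T).filter (fun n : ℕ => T / √y ^ I < (n : ℝ)) := by
    intro n hn
    obtain ⟨hn1, hn2⟩ := hS1 n hn
    have hn0 : (0:ℝ) < n := by exact_mod_cast hn1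
    have h3 := abs_le.1 (hS2 n hn)
    rw [mem_filter, mem_sm]
    refine ⟨⟨hn1, ?_, hn2⟩, ?_⟩
    · rw [← Real.log_le_log_iff hn0 hT, hTu]
      nlinarith
    · rw [← Real.log_lt_log_iff (by positivity) hn0, Real.log_div hT.ne' (by positivity), Real.log_pow,
        hlsq, hTu]
      nlinarith
  set H := cellSum y b T with hH
  have hH0 : 0 ≤ H := cellSum_nonneg _ _ _
  have h80 : 320 ≤ 80 * u := by linarith
  have h5 : eulerZ y b / 2 ≤ I * ((80 * u) ^ I * H) := by
    refine hS3.trans ((sum_le_sum_of_subset_of_nonneg hSsub fun _ _ _ => by positivity).trans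
      ((sum_le_sum_cellSum y b T hy0 I).trans ?_))
    have : ∀ i ∈ range I, cellSum y b (T / √y ^ i) ≤ (80 * u) ^ I * H := by
      intro i hi
      refine (cellSum_iterate (fun v hv => hy₁ y b v hy1 hb0.le hb1 hv) (by linarith) hT hu0 hTu i).trans ?_
      have : (80 * u) ^ i ≤ (80 * u) ^ I := pow_le_pow_right₀ (by linarith) (mem_range.1 hi).le
      gcongr
    simpa using sum_le_card_nsmul _ _ _ this
  have h6 : eulerZ y b ≤ (80 * u) ^ (12 * K * √u) * H := by
    have h7 : (I : ℝ) ≤ 2 ^ I := by exact_mod_cast Nat.lt_two_pow_self.le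
    have h8 : (2:ℝ) ≤ 2 ^ I := by
      calc (2:ℝ) = 2 ^ 1 := by norm_num
        _ ≤ 2 ^ I := pow_le_pow_right₀ (by norm_num) (by omega)
    have h9 : (2:ℝ) ^ I * 2 ^ I ≤ (80 * u) ^ I := by
      rw [← mul_pow]
      exact pow_le_pow_left₀ (by norm_num) (by linarith) I
    have h10 : 2 * (I : ℝ) ≤ (80 * u) ^ I := by
      calc 2 * (I : ℝ) ≤ 2 ^ I * 2 ^ I := by gcongr
        _ ≤ _ := h9
    calc eulerZ y b ≤ 2 * I * ((80 * u) ^ I * H) := by linarith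
      _ ≤ (80 * u) ^ I * ((80 * u) ^ I * H) := by gcongr
      _ = (80 * u) ^ ((2 * I : ℕ) : ℝ) * H := by
          rw [Real.rpow_natCast, ← mul_assoc, ← pow_add, two_mul]
      _ ≤ _ := by
          gcongr
          · linarith
          · push_cast; linarith
  have hT1 : 1 ≤ T := by
    have : Real.log 1 ≤ Real.log T := by rw [Real.log_one, hTu]; positivity
    exact (Real.log_le_log_iff one_pos hT).1 this
  have h11 : T ^ b * H ≤ C₁ * (sc y T * (1 + Real.log T)) := by
    refine le_trans ?_ (hC₁ y T (by linarith) hT1)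
    rw [hH]; unfold cellSum
    rw [mul_sum]
    have hsub : (sm y T).filter (fun n : ℕ => T / √y < (n : ℝ)) ⊆
        (sm y T).filter (fun n : ℕ => T / y < (n : ℝ)) := by
      intro n hn
      rw [mem_filter] at *
      refine ⟨hn.1, lt_of_le_of_lt ?_ hn.2⟩
      gcongr
      rw [Real.sqrt_le_left hy0.le]; nlinarith
    refine le_trans (sum_le_sum fun n hn => ?_)
      (sum_le_sum_of_subset_of_nonneg hsub fun _ _ _ => by positivity)
    obtain ⟨hn0, hnT⟩ := sm_le_of_mem (mem_filter.1 hn).1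
    rw [Real.rpow_neg hn0.le, ← div_eq_mul_inv, ← Real.div_rpow hT.le hn0.le]
    calc (T / n) ^ b ≤ (T / n) ^ (1:ℝ) :=
          Real.rpow_le_rpow_of_exponent_le (by rwa [one_le_div hn0]) hb1
      _ = _ := Real.rpow_one _
  have h12 : T ^ a * eulerZ y a ≤ 2916 * u ^ 2 * (T ^ b * eulerZ y b) := by
    have h13 := eulerZ_tangent (y := y) (show 0 < a by linarith) hb0
    have h14 := hy₂ y a u hy2 ha ha1 (by linarith) hmu
    have hZb := eulerZ_pos (y := y) hb0
    have hZa := eulerZ_pos (y := y) (show 0 < a by linarith)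
    rw [hmu] at h13
    have h15 : T ^ a = T ^ b * Real.exp (-(b - a) * ((u + 1) * l)) * y ^ (b - a) := by
      rw [Real.rpow_def_of_pos hT, Real.rpow_def_of_pos hT, Real.rpow_def_of_pos hy0, hTu,
        ← Real.exp_add, ← Real.exp_add]
      congr 1; ring
    have h16 : y ^ (b - a) ≤ y ^ (1 - a) :=
      Real.rpow_le_rpow_of_exponent_le (by linarith) (by linarith)
    rw [h15]
    calc T ^ b * Real.exp (-(b - a) * ((u + 1) * l)) * y ^ (b - a) * eulerZ y a
        = T ^ b * (eulerZ y a * Real.exp (-(b - a) * ((u + 1) * l))) * y ^ (b - a) := by ring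
      _ ≤ T ^ b * eulerZ y b * (2916 * u ^ 2) := by
          gcongr
          exact h16.trans h14
      _ = _ := by ring
  calc T ^ a * eulerZ y a ≤ 2916 * u ^ 2 * (T ^ b * eulerZ y b) := h12
    _ ≤ 2916 * u ^ 2 * (T ^ b * ((80 * u) ^ (12 * K * √u) * H)) := by gcongr
    _ = 2916 * u ^ 2 * (80 * u) ^ (12 * K * √u) * (T ^ b * H) := by ring
    _ ≤ 2916 * u ^ 2 * (80 * u) ^ (12 * K * √u) * (C₁ * (sc y T * (1 + Real.log T))) := by gcongr
    _ = _ := by ring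

lemma eventually_rpow_le_exp (A K c : ℝ) (hc : 0 < c) : ∀ᶠ u : ℝ in Filter.atTop,
    A * u ^ 4 * (80 * u) ^ (K * √u) ≤ Real.exp (c * u ^ (3 / 4 : ℝ)) := by
  have h1 : ∀ᶠ u : ℝ in Filter.atTop, Real.log u ≤ c / (4 * (|K| + 5)) * u ^ (1 / 4 : ℝ) := by
    have h := (isLittleO_log_rpow_atTop (show (0:ℝ) < 1 / 4 by norm_num)).def
      (show 0 < c / (4 * (|K| + 5)) by positivity)
    filter_upwards [h, Filter.eventually_ge_atTop 1] with u hu hu1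
    rwa [Real.norm_of_nonneg (Real.log_nonneg hu1),
      Real.norm_of_nonneg (Real.rpow_nonneg (by linarith) _)] at hu
  filter_upwards [h1, Filter.eventually_ge_atTop 80, Filter.eventually_ge_atTop A] with u hu hu80 huA
  have hu0 : 0 < u := by linarith
  have hlu : 0 ≤ Real.log u := Real.log_nonneg (by linarith)
  have hs1 : 1 ≤ √u := Real.one_le_sqrt.2 (by linarith)
  have h2 : (80 * u) ^ (K * √u) ≤ Real.exp (2 * Real.log u * (|K| * √u)) := by
    rw [Real.rpow_def_of_pos (by positivity)]
    apply Real.exp_le_exp.2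
    have h3 : Real.log (80 * u) ≤ 2 * Real.log u := by
      rw [Real.log_mul (by norm_num) hu0.ne']
      linarith [Real.log_le_log (by norm_num) hu80]
    have h4 : 0 ≤ Real.log (80 * u) := Real.log_nonneg (by linarith)
    calc Real.log (80 * u) * (K * √u) ≤ Real.log (80 * u) * (|K| * √u) := by
          gcongr; exact le_abs_self K
      _ ≤ _ := by gcongr
  have h5 : A * u ^ 4 ≤ Real.exp (5 * Real.log u * √u) := by
    calc A * u ^ 4 ≤ u * u ^ 4 := by gcongr
      _ = Real.exp (5 * Real.log u) := by
          rw [mul_comm 5, Real.exp_mul, Real.exp_log hu0]; norm_cast; ring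
      _ ≤ _ := Real.exp_le_exp.2 (le_mul_of_one_le_right (by positivity) hs1)
  have h6 : u ^ (3 / 4 : ℝ) = u ^ (1 / 4 : ℝ) * √u := by
    rw [Real.sqrt_eq_rpow, ← Real.rpow_add hu0]; norm_num
  calc A * u ^ 4 * (80 * u) ^ (K * √u)
      ≤ Real.exp (5 * Real.log u * √u) * Real.exp (2 * Real.log u * (|K| * √u)) := by gcongr
    _ = Real.exp ((2 * |K| + 5) * √u * Real.log u) := by rw [← Real.exp_add]; congr 1; ring
    _ ≤ Real.exp ((4 * (|K| + 5)) * √u * (c / (4 * (|K| + 5)) * u ^ (1 / 4 : ℝ))) := by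
        apply Real.exp_le_exp.2
        have := abs_nonneg K
        gcongr
        linarith
    _ = _ := by rw [h6]; congr 1; field_simp

/-- Most smooth numbers have many prime factors in `(√y, y / r]`. -/
lemma exists_card_bad_le : ∃ U₀ y₀ : ℝ, 1 ≤ U₀ ∧ 2 ≤ y₀ ∧ ∀ y a T u r : ℝ, y₀ ≤ y → 1 / 12 ≤ a →
    a ≤ 1 → 0 < T → U₀ ≤ u → Real.log T = u * Real.log y → mu y a = (u + 1) * Real.log y →
    1 ≤ r → Real.log r ≤ Real.log y / 8 →
    (((sm y T).filter (fun n => (omegaIn (primesIn (√y) (y / r)) n : ℝ) <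
      (∑ p ∈ primesIn (√y) (y / r), (p : ℝ) ^ (-a)) / 2)).card : ℝ) ≤ sc y T / 2 := by
  obtain ⟨K, C, y₁, hK1, hC0, hy₁2, hy₁⟩ := exists_eulerZ_le
  obtain ⟨c, y₂, hc0, hy₂2, hy₂⟩ := exists_sum_primesIn_ge_rpow
  obtain ⟨y₃, hy₃2, hy₃⟩ := exists_rpow_one_sub_le
  obtain ⟨y₄, hy₄⟩ := Filter.eventually_atTop.1
    (Real.tendsto_log_atTop.eventually_ge_atTop 1)
  set c' := min (1 / 48) (c / 10) with hc'
  have hc'0 : 0 < c' := by positivity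
  obtain ⟨U₁, hU₁⟩ := Filter.eventually_atTop.1
    (eventually_rpow_le_exp (4 * 260 * 2916 * C) (12 * K) c' hc'0)
  refine ⟨max (max 1 U₁) (4 * K ^ 2), max (max y₁ y₂) (max y₃ y₄),
    (le_max_left _ _).trans (le_max_left _ _),
    hy₁2.trans ((le_max_left _ _).trans (le_max_left _ _)),
    fun y a T u r hy ha ha1 hT hu hTu hmu hr hlr => ?_⟩
  have hy1 : y₁ ≤ y := ((le_max_left _ _).trans (le_max_left _ _)).trans hy
  have hy2 : y₂ ≤ y := ((le_max_right _ _).trans (le_max_left _ _)).trans hy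
  have hy3 : y₃ ≤ y := ((le_max_left _ _).trans (le_max_right _ _)).trans hy
  have hl1 := hy₄ y (((le_max_right _ _).trans (le_max_right _ _)).trans hy)
  have hu1 : 1 ≤ u := ((le_max_left _ _).trans (le_max_left _ _)).trans hu
  have hE := hU₁ u (((le_max_right _ _).trans (le_max_left _ _)).trans hu)
  have hZ := hy₁ y a T u hy1 ha ha1 hT ((le_max_right _ _).trans hu) hTu hmu
  have hP := hy₂ y a u r hy2 ha ha1 hu1 hmu hr hlr
  have hY := hy₃ y a u hy3 ha ha1 hu1 hmu
  set l := Real.log y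
  have hy0 : 0 < y := by linarith
  have hu0 : 0 < u := by linarith
  have hul : 1 ≤ u * l := by nlinarith
  have hT1 : 1 < T := by
    rw [← Real.log_lt_log_iff one_pos hT, Real.log_one, hTu]; linarith
  have hsub : primesIn (√y) (y / r) ⊆ primesUpTo y := primesIn_subset (div_le_self hy0.le hr)
  refine (card_few_prime_factors_le hl1 (by linarith) hT1 ha ha1 _ hsub).trans ?_
  set E := ∑ p ∈ primesIn (√y) (y / r), (p : ℝ) ^ (-a)
  set G := (80 * u) ^ (12 * K * √u)
  have hG0 : 0 ≤ G := by positivity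
  set v := u ^ (3 / 4 : ℝ)
  have hv0 : 0 ≤ v := by positivity
  have hvu : v ≤ u := by
    calc v ≤ u ^ (1 : ℝ) := Real.rpow_le_rpow_of_exponent_le hu1 (by norm_num)
      _ = u := Real.rpow_one u
  have hs0 := sc_nonneg y T
  have hZ0 := eulerZ_pos (y := y) (show 0 < a by linarith)
  rw [hTu] at hZ ⊢
  have hGE : 4 * 260 * 2916 * C * u ^ 4 * G * Real.exp (-c' * v) ≤ 1 := by
    calc _ ≤ Real.exp (c' * v) * Real.exp (-c' * v) := by gcongr
      _ = 1 := by rw [← Real.exp_add]; simp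
  have hu24 : u ^ 2 ≤ u ^ 4 := pow_le_pow_right₀ hu1 (by norm_num)
  have h1 : T ^ (a / 2) * eulerZ y a ≤ sc y T / 4 := by
    have h2 : T ^ (a / 2) ≤ T ^ a * Real.exp (-(u * l) / 24) := by
      rw [Real.rpow_def_of_pos hT, Real.rpow_def_of_pos hT, ← Real.exp_add, hTu]
      apply Real.exp_le_exp.2
      nlinarith
    have h3 : 1 + u * l ≤ 48 * Real.exp (u * l / 48) := by
      have := Real.add_one_le_exp (u * l / 48)
      linarith
    have h4 : (1 + u * l) * Real.exp (-(u * l) / 24) ≤ 48 * Real.exp (-c' * v) := by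
      calc (1 + u * l) * Real.exp (-(u * l) / 24)
          ≤ 48 * Real.exp (u * l / 48) * Real.exp (-(u * l) / 24) := by gcongr
        _ = 48 * Real.exp (-(u * l) / 48) := by
            rw [mul_assoc, ← Real.exp_add]; congr 2; ring
        _ ≤ _ := by
            gcongr
            have h5 : c' * v ≤ 1 / 48 * u := mul_le_mul (min_le_left _ _) hvu hv0 (by norm_num)
            nlinarith
    calc T ^ (a / 2) * eulerZ y a ≤ T ^ a * Real.exp (-(u * l) / 24) * eulerZ y a := by gcongr
      _ = T ^ a * eulerZ y a * Real.exp (-(u * l) / 24) := by ring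
      _ ≤ C * u ^ 2 * G * ((1 + u * l) * sc y T) * Real.exp (-(u * l) / 24) := by gcongr
      _ = C * u ^ 2 * G * ((1 + u * l) * Real.exp (-(u * l) / 24)) * sc y T := by ring
      _ ≤ C * u ^ 4 * G * (48 * Real.exp (-c' * v)) * sc y T := by gcongr
      _ = 48 / (4 * 260 * 2916) * (4 * 260 * 2916 * C * u ^ 4 * G * Real.exp (-c' * v)) * sc y T := by
          ring
      _ ≤ 48 / (4 * 260 * 2916) * 1 * sc y T := by gcongr
      _ ≤ _ := by linarith
  have h6 : 130 * y ^ (1 - a) / (u * l) * T ^ a * (eulerZ y a * Real.exp (-(1 / 10) * E)) ≤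
      sc y T / 4 := by
    have h7 : Real.exp (-(1 / 10) * E) ≤ Real.exp (-c' * v) := by
      apply Real.exp_le_exp.2
      have h5 : c' * v ≤ c / 10 * v := mul_le_mul_of_nonneg_right (min_le_right _ _) hv0
      linarith
    have hl0 : 0 < u * l := by linarith
    calc 130 * y ^ (1 - a) / (u * l) * T ^ a * (eulerZ y a * Real.exp (-(1 / 10) * E))
        = 130 * y ^ (1 - a) / (u * l) * (T ^ a * eulerZ y a) * Real.exp (-(1 / 10) * E) := by ring
      _ ≤ 130 * (2916 * u ^ 2) / (u * l) * (C * u ^ 2 * G * ((1 + u * l) * sc y T)) *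
          Real.exp (-c' * v) := by gcongr
      _ ≤ 130 * (2916 * u ^ 2) / (u * l) * (C * u ^ 2 * G * ((2 * (u * l)) * sc y T)) *
          Real.exp (-c' * v) := by gcongr; linarith
      _ = 1 / 4 * (4 * 260 * 2916 * C * u ^ 4 * G * Real.exp (-c' * v)) * sc y T := by
          field_simp; ring
      _ ≤ 1 / 4 * 1 * sc y T := by gcongr
      _ = _ := by ring
  linarith

lemma sum_sc_primesIn_ge {y T E : ℝ} {P : Finset ℕ} (hP : P ⊆ primesUpTo y) (hE : 0 ≤ E)
    (h : (((sm y T).filter (fun n => (omegaIn P n : ℝ) < E / 2)).card : ℝ) ≤ sc y T / 2) :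
    E / 4 * sc y T ≤ ∑ p ∈ P, sc y (T / p) := by
  have h1 : ∑ p ∈ P, sc y (T / p) = ∑ n ∈ sm y T, (omegaIn P n : ℝ) := by
    have h2 : ∀ p ∈ P, sc y (T / p) = ∑ n ∈ sm y T, (if p ∣ n then (1:ℝ) else 0) := by
      intro p hp
      rw [← card_dvd_eq_sc (mem_primesUpTo.1 (hP hp)).1.one_le (isSmooth_of_mem (hP hp)), sum_boole]
    rw [sum_congr rfl h2, sum_comm]
    refine sum_congr rfl fun n _ => ?_
    rw [sum_boole]; rfl
  have h3 : ∀ n ∈ sm y T, E / 2 - (if (omegaIn P n : ℝ) < E / 2 then E / 2 else 0) ≤ omegaIn P n := by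
    intro n _
    split_ifs with h4
    · simp
    · linarith
  have h5 := sum_le_sum h3
  rw [sum_sub_distrib, sum_const, nsmul_eq_mul, ← sum_filter, sum_const, nsmul_eq_mul] at h5
  rw [h1]
  refine le_trans ?_ h5
  change _ ≤ sc y T * (E / 2) - _
  nlinarith

lemma block_shift : ∃ Q₀ : ℝ, 2 ≤ Q₀ ∧ ∀ y T r Q : ℝ, 0 < T → 1 ≤ r → Q₀ ≤ r * Q / 4 →
    r * ∑ p ∈ primesIn (Q / 4) Q, Real.log p * sc y (T / p) ≤
      120 * ∑ p ∈ primesIn (r * Q / 4 / 4) (r * Q / 4), Real.log p * sc y (r * T / p) := by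
  obtain ⟨Q₀, h2, hQ₀⟩ := exists_block_rpow_lower
  refine ⟨Q₀, h2, fun y T r Q hT hr hQ => ?_⟩
  have hr0 : 0 < r := by linarith
  have hQ0 : 0 < Q := by
    by_contra! h
    nlinarith
  have h1 := hQ₀ (r * Q / 4) 0 hQ le_rfl
  have h3 := block_rpow_upper hQ0 le_rfl zero_le_one
  simp only [sub_zero, Real.rpow_one, neg_zero, Real.rpow_zero, mul_one] at h1 h3
  have hs := sc_nonneg y (4 * T / Q)
  have h4 : ∑ p ∈ primesIn (Q / 4) Q, Real.log p * sc y (T / p) ≤ 6 * Q * sc y (4 * T / Q) := by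
    refine le_trans ?_ (mul_le_mul_of_nonneg_right h3 hs)
    rw [sum_mul]
    refine sum_le_sum fun p hp => mul_le_mul_of_nonneg_left ?_ (Real.log_natCast_nonneg p)
    rw [mem_primesIn] at hp
    have hp0 : (0:ℝ) < p := by exact_mod_cast hp.1.pos
    apply sc_mono
    rw [div_le_div_iff₀ hp0 hQ0]
    nlinarith [hp.2.1]
  have h5 : r * Q / 4 / 5 * sc y (4 * T / Q) ≤
      ∑ p ∈ primesIn (r * Q / 4 / 4) (r * Q / 4), Real.log p * sc y (r * T / p) := by
    refine (mul_le_mul_of_nonneg_right h1 hs).trans ?_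
    rw [sum_mul]
    refine sum_le_sum fun p hp => mul_le_mul_of_nonneg_left ?_ (Real.log_natCast_nonneg p)
    rw [mem_primesIn] at hp
    have hp0 : (0:ℝ) < p := by exact_mod_cast hp.1.pos
    apply sc_mono
    rw [div_le_div_iff₀ hQ0 hp0]
    nlinarith [hp.2.2]
  have h6 := mul_le_mul_of_nonneg_left h4 hr0.le
  linarith

lemma exists_blocks_shift : ∃ Q₀ : ℝ, 2 ≤ Q₀ ∧ ∀ (y T r w : ℝ) (n : ℕ), 0 < T → 1 ≤ r → 0 < w →
    Q₀ ≤ r * w / 4 ^ n →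
    r * ∑ p ∈ primesIn (w / 4 ^ n) w, Real.log p * sc y (T / p) ≤
      120 * ∑ p ∈ primesIn (r * w / 4 / 4 ^ n) (r * w / 4), Real.log p * sc y (r * T / p) := by
  obtain ⟨Q₀, h2, hQ₀⟩ := block_shift
  refine ⟨Q₀, h2, fun y T r w n hT hr hw hn => ?_⟩
  have hr0 : 0 < r := by linarith
  induction n with
  | zero =>
    have : ∀ z : ℝ, primesIn (z / 4 ^ 0) z = ∅ := fun z => by ext p; simp [mem_primesIn]
    rw [this, this]; simp
  | succ n ih =>
    have h5 : ∀ z : ℝ, z / 4 ^ (n + 1) = z / 4 ^ n / 4 := fun z => by field_simp; ring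
    have h6 : r * w / 4 ^ (n + 1) = r * (w / 4 ^ n) / 4 := by field_simp; ring
    have h4 := ih (by
      rw [h5] at hn
      linarith [show 0 < r * w / 4 ^ n by positivity])
    have h7 := hQ₀ y T r (w / 4 ^ n) hT hr (by rw [← h6]; exact hn)
    rw [sum_primesIn_split _ (w := w / 4 ^ n), sum_primesIn_split _ (v := r * w / 4) (w := r * w / 4 / 4 ^ n), h5,
      h5]
    · have h8 : r * (w / 4 ^ n) / 4 = r * w / 4 / 4 ^ n := by ring
      rw [h8] at h7
      linarith
    · rw [h5]; exact div_le_self (by positivity) (by norm_num)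
    · exact div_le_self (by positivity) (one_le_pow₀ (by norm_num))
    · rw [h5]; exact div_le_self (by positivity) (by norm_num)
    · exact div_le_self hw.le (one_le_pow₀ (by norm_num))

/-- Local growth of `Ψ` for large `u = log T / log y`. -/
lemma exists_sc_mul_ge : ∃ c U₀ y₀ : ℝ, 0 < c ∧ 1 ≤ U₀ ∧ 2 ≤ y₀ ∧ ∀ y a T u r : ℝ, y₀ ≤ y →
    1 / 12 ≤ a → a ≤ 1 → 0 < T → U₀ ≤ u → Real.log T = u * Real.log y →
    mu y a = (u + 1) * Real.log y → 1 ≤ r → Real.log r ≤ Real.log y / 8 →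
    c * r ^ a * sc y T ≤ sc y (r * T) := by
  obtain ⟨U₀, y₁, hU₀1, hy₁2, hy₁⟩ := exists_card_bad_le
  obtain ⟨c, y₂, hc0, hy₂2, hy₂⟩ := exists_sum_primesIn_ge
  obtain ⟨Q₀, hQ₀2, hQ₀⟩ := exists_blocks_shift
  refine ⟨c / 1920, U₀, max (max y₁ y₂) ((4 * Q₀) ^ 2), by positivity, hU₀1,
    hy₁2.trans ((le_max_left _ _).trans (le_max_left _ _)),
    fun y a T u r hy ha ha1 hT hu hTu hmu hr hlr => ?_⟩
  have hy1 : y₁ ≤ y := ((le_max_left _ _).trans (le_max_left _ _)).trans hy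
  have hy2 : y₂ ≤ y := ((le_max_right _ _).trans (le_max_left _ _)).trans hy
  have hyQ : 4 * Q₀ ≤ √y := Real.le_sqrt_of_sq_le ((le_max_right _ _).trans hy)
  have hy0 : 0 < y := by linarith
  have hl : 0 < Real.log y := Real.log_pos (by linarith)
  have hsq0 : 0 < √y := Real.sqrt_pos.2 hy0
  have hss : √y * √y = y := Real.mul_self_sqrt hy0.le
  have hr0 : 0 < r := by linarith
  have hbad := hy₁ y a T u r hy1 ha ha1 hT hu hTu hmu hr hlr
  have hE := hy₂ y a u r hy2 ha ha1 (hU₀1.trans hu) hmu hr hlr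
  set E := ∑ p ∈ primesIn (√y) (y / r), (p : ℝ) ^ (-a)
  have hE0 : 0 ≤ E := sum_nonneg fun _ _ => by positivity
  have h1 := sum_sc_primesIn_ge (primesIn_subset (div_le_self hy0.le hr)) hE0 hbad
  obtain ⟨m, hm1, hm2⟩ := exists_nat_pow_near (show 1 ≤ √y by linarith) (show (1:ℝ) < 4 by norm_num)
  have hw : 0 < y / r := by positivity
  have hrw : r * (y / r) = y := by field_simp
  have h3 := hQ₀ y T r (y / r) (m + 1) hT hr hw (by
    rw [hrw, le_div_iff₀ (by positivity)]
    calc Q₀ * 4 ^ (m + 1) = 4 * Q₀ * 4 ^ m := by ring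
      _ ≤ √y * √y := by gcongr
      _ = y := hss)
  rw [hrw] at h3
  have h4 : Real.log y / 2 * ∑ p ∈ primesIn (√y) (y / r), sc y (T / p) ≤
      ∑ p ∈ primesIn (y / r / 4 ^ (m + 1)) (y / r), Real.log p * sc y (T / p) := by
    rw [mul_sum]
    have hz : y / r / 4 ^ (m + 1) ≤ √y := by
      rw [div_div, div_le_iff₀ (by positivity)]
      calc y = √y * (1 * √y) := by rw [one_mul, hss]
        _ ≤ _ := by gcongr
    refine le_trans (sum_le_sum fun p hp => ?_)
      (sum_le_sum_of_subset_of_nonneg (primesIn_subset_primesIn hz le_rfl) fun p _ _ =>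
        mul_nonneg (Real.log_natCast_nonneg p) (sc_nonneg _ _))
    refine mul_le_mul_of_nonneg_right ?_ (sc_nonneg _ _)
    rw [← Real.log_sqrt hy0.le]
    exact Real.log_le_log hsq0 (mem_primesIn.1 hp).2.1.le
  have h5 : ∑ p ∈ primesIn (y / 4 / 4 ^ (m + 1)) (y / 4), Real.log p * sc y (r * T / p) ≤
      sc y (r * T) * Real.log (r * T) :=
    sum_log_mul_sc_le' _ (primesIn_subset (by linarith))
  have h6 : Real.log (r * T) ≤ 2 * u * Real.log y := by
    rw [Real.log_mul hr0.ne' hT.ne', hTu]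
    nlinarith
  have hs := sc_nonneg y (r * T)
  have hsT := sc_nonneg y T
  have hu1 : 1 ≤ u := hU₀1.trans hu
  have h7 : r ^ a = r * r ^ (-(1 - a)) := by
    nth_rewrite 2 [← Real.rpow_one r]
    rw [← Real.rpow_add hr0]; congr 1; ring
  have h8 : r * (Real.log y / 2 * (c * u * r ^ (-(1 - a)) / 4 * sc y T)) ≤
      120 * (sc y (r * T) * (2 * u * Real.log y)) := by
    calc r * (Real.log y / 2 * (c * u * r ^ (-(1 - a)) / 4 * sc y T))
        ≤ r * (Real.log y / 2 * (E / 4 * sc y T)) := by gcongr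
      _ ≤ r * (Real.log y / 2 * ∑ p ∈ primesIn (√y) (y / r), sc y (T / p)) := by gcongr
      _ ≤ r * ∑ p ∈ primesIn (y / r / 4 ^ (m + 1)) (y / r), Real.log p * sc y (T / p) := by gcongr
      _ ≤ 120 * (sc y (r * T) * Real.log (r * T)) := h3.trans (by gcongr)
      _ ≤ _ := by gcongr
  have hul : 0 < 240 * (u * Real.log y) := by positivity
  refine le_of_mul_le_mul_left ?_ hul
  rw [h7]
  linarith

lemma iterate_sc_mul_ge {y α c t r : ℝ} (hc : 0 ≤ c) (hr : 0 < r) (n : ℕ)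
    (h : ∀ i : ℕ, i < n → c * r ^ α * sc y (r ^ i * t) ≤ sc y (r * (r ^ i * t))) :
    c ^ n * (r ^ n) ^ α * sc y t ≤ sc y (r ^ n * t) := by
  induction n with
  | zero => simp
  | succ n ih =>
    have h1 := ih fun i hi => h i (by omega)
    have h2 := h n (by omega)
    have h3 : (r ^ (n + 1)) ^ α = r ^ α * (r ^ n) ^ α := by
      rw [pow_succ', Real.mul_rpow hr.le (by positivity)]
    rw [h3, pow_succ' r, mul_assoc r]
    refine le_trans ?_ h2
    calc c ^ (n + 1) * (r ^ α * (r ^ n) ^ α) * sc y t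
        = c * r ^ α * (c ^ n * (r ^ n) ^ α * sc y t) := by ring
      _ ≤ _ := by gcongr

/-- Comparison of `Ψ` at two points within a factor `y ^ 13`. -/
lemma exists_local_comparison : ∃ c y₀ : ℝ, 0 < c ∧ 2 ≤ y₀ ∧ ∀ y α W T : ℝ, y₀ ≤ y → 1 / 12 ≤ α →
    α ≤ 1 → 1 ≤ W → W ≤ T → Real.log T ≤ Real.log W + 13 * Real.log y →
    Real.log T + Real.log y ≤ mu y α → c * (T / W) ^ α * sc y W ≤ sc y T := by
  obtain ⟨c, U₀, y₁, hc0, hU₀1, hy₁2, hy₁⟩ := exists_sc_mul_ge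
  obtain ⟨y₂, hy₂2, hy₂⟩ := exists_sc_ge_mul
  obtain ⟨C₀, hC₀0, hC₀⟩ := exists_mu_one_le
  obtain ⟨y₃, hy₃⟩ := Filter.eventually_atTop.1
    (Real.tendsto_log_atTop.eventually_ge_atTop (max 1 C₀))
  obtain ⟨c₁, hc₁0, hc₁⟩ := hy₂ ⌈2 * (U₀ + 13)⌉₊
  refine ⟨min c₁ (c ^ 104), max (max y₁ y₂) y₃, by positivity,
    hy₁2.trans ((le_max_left _ _).trans (le_max_left _ _)),
    fun y α W T hy hα hα1 hW hWT hT hmu => ?_⟩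
  have hy1 : y₁ ≤ y := ((le_max_left _ _).trans (le_max_left _ _)).trans hy
  have hy2 : y₂ ≤ y := ((le_max_right _ _).trans (le_max_left _ _)).trans hy
  have hlm := hy₃ y ((le_max_right _ _).trans hy)
  have hl1 : 1 ≤ Real.log y := (le_max_left _ _).trans hlm
  have hlC : C₀ ≤ Real.log y := (le_max_right _ _).trans hlm
  set l := Real.log y with hl
  have hy0 : 0 < y := by linarith
  have hW0 : 0 < W := by linarith
  have hT0 : 0 < T := by linarith
  have hTW : 1 ≤ T / W := by rwa [one_le_div hW0]
  have hs := sc_nonneg y W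
  rcases lt_or_ge (Real.log W) (U₀ * l) with h | h
  · have h1 := hc₁ y T hy2 (by linarith) (by
      have := Nat.le_ceil (2 * (U₀ + 13))
      nlinarith)
    refine le_trans ?_ h1
    have h2 : (T / W) ^ α ≤ T / W := by
      calc (T / W) ^ α ≤ (T / W) ^ (1:ℝ) := Real.rpow_le_rpow_of_exponent_le hTW hα1
        _ = _ := Real.rpow_one _
    have h3 : sc y W ≤ W := sc_le_self hW0.le
    calc min c₁ (c ^ 104) * (T / W) ^ α * sc y W ≤ c₁ * (T / W) * W := by
          gcongr
          exact min_le_left _ _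
      _ = c₁ * T := by field_simp
  · set r := (T / W) ^ (1 / 104 : ℝ) with hr
    have hr1 : 1 ≤ r := Real.one_le_rpow hTW (by norm_num)
    have hr0 : 0 < r := by linarith
    have hrn : r ^ 104 = T / W := by
      rw [hr, ← Real.rpow_natCast, ← Real.rpow_mul (by positivity)]
      norm_num
    have hlr : Real.log r ≤ l / 8 := by
      rw [hr, Real.log_rpow (by positivity), Real.log_div hT0.ne' hW0.ne']
      linarith
    have hstep : ∀ i : ℕ, i < 104 → c * r ^ α * sc y (r ^ i * W) ≤ sc y (r * (r ^ i * W)) := by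
      intro i hi
      have hri : 1 ≤ r ^ i := one_le_pow₀ hr1
      set t := r ^ i * W with ht
      have ht0 : 0 < t := by positivity
      have htT : t ≤ T := by
        calc t ≤ r ^ 104 * W := by rw [ht]; gcongr
          _ = T := by rw [hrn]; field_simp
      have hlW : Real.log W ≤ Real.log t := Real.log_le_log hW0 (le_mul_of_one_le_left hW0.le hri)
      have hlT : Real.log t ≤ Real.log T := Real.log_le_log ht0 htT
      have hu : U₀ ≤ Real.log t / l := by
        rw [le_div_iff₀ (by linarith)]; linarith
      have hul : (Real.log t / l + 1) * l = Real.log t + l := by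
        field_simp
      obtain ⟨a, ha1, ha2, hmua⟩ := exists_mu_eq (y := y) (a := α) (b := 1)
        (v := (Real.log t / l + 1) * l) (by linarith) hα1
        (by rw [hul]; have := hC₀ y (by linarith); nlinarith) (by rw [hul]; linarith)
      have := hy₁ y a t (Real.log t / l) r hy1 (by linarith) ha2 ht0 hu (by rw [div_mul_cancel₀ _ (by linarith : l ≠ 0)]) hmua hr1 hlr
      refine le_trans ?_ this
      have hst := sc_nonneg y t
      gcongr
    have h4 := iterate_sc_mul_ge hc0.le hr0 104 hstep
    rw [hrn, div_mul_cancel₀ _ hW0.ne'] at h4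
    refine le_trans ?_ h4
    gcongr
    exact min_le_right _ _

lemma exists_truncated_mu_ge : ∃ C : ℝ, 0 ≤ C ∧ ∀ y α : ℝ, 1 / 12 ≤ α →
    mu y α - C ≤ ∑ p ∈ primesUpTo y, ∑ k ∈ Icc 1 13, Real.log p * ((p : ℝ) ^ (-α)) ^ k := by
  obtain ⟨C, hC0, hC⟩ := exists_sum_log_rpow_le
  set κ : ℝ := 1 - 2 ^ (-(1 / 12) : ℝ) with hκ
  have hκ0 : 0 < κ := by
    have := Real.rpow_lt_one_of_one_lt_of_neg (show (1:ℝ) < 2 by norm_num) (show (-(1 / 12) : ℝ) < 0 by norm_num)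
    linarith
  refine ⟨C / κ, by positivity, fun y α hα => ?_⟩
  have h1 : mu y α - ∑ p ∈ primesUpTo y, Real.log p * (p : ℝ) ^ (-(7 / 6) : ℝ) / κ ≤
      ∑ p ∈ primesUpTo y, ∑ k ∈ Icc 1 13, Real.log p * ((p : ℝ) ^ (-α)) ^ k := by
    unfold mu
    rw [← sum_sub_distrib]
    refine sum_le_sum fun p hp => ?_
    have hp2 := two_le_of_mem hp
    have hp0 : (0:ℝ) < p := by linarith
    have hl0 := log_prime_nonneg hp
    set q := (p : ℝ) ^ (-α) with hq
    have hq0 : 0 < q := by positivity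
    have hqκ : κ ≤ 1 - q := by
      have : q ≤ 2 ^ (-(1 / 12) : ℝ) := by
        calc q ≤ (p : ℝ) ^ (-(1 / 12) : ℝ) := Real.rpow_le_rpow_of_exponent_le (by linarith) (by linarith)
          _ ≤ _ := Real.rpow_le_rpow_of_nonpos (by norm_num) hp2 (by norm_num)
      linarith
    have hq1 : 0 < 1 - q := by linarith
    have h2 : (p : ℝ) ^ α - 1 = (1 - q) / q := by
      rw [hq, Real.rpow_neg hp0.le]
      have : (p : ℝ) ^ α ≠ 0 := by positivity
      field_simp
    have h3 : ∑ k ∈ Icc 1 13, q ^ k = q / (1 - q) - q ^ 14 / (1 - q) := by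
      rw [← sub_div, eq_div_iff hq1.ne']
      simp only [sum_Icc_succ_top, Icc_self, sum_singleton, Nat.reduceLeDiff]
      ring
    have h4 : q ^ 14 ≤ (p : ℝ) ^ (-(7 / 6) : ℝ) := by
      rw [hq, ← Real.rpow_natCast, ← Real.rpow_mul hp0.le]
      apply Real.rpow_le_rpow_of_exponent_le (by linarith)
      push_cast; linarith
    have h5 : q ^ 14 / (1 - q) ≤ (p : ℝ) ^ (-(7 / 6) : ℝ) / κ := by gcongr
    rw [← mul_sum, h3, h2, div_div_eq_mul_div, mul_sub, mul_div_assoc, mul_div_assoc]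
    have := mul_le_mul_of_nonneg_left h5 hl0
    linarith
  have h6 : ∑ p ∈ primesUpTo y, Real.log p * (p : ℝ) ^ (-(7 / 6) : ℝ) / κ ≤ C / κ := by
    rw [← sum_div]
    have := hC (primesUpTo y)
    gcongr
  linarith

/-- `Ψ(X, y) / X ^ α` is almost increasing in `X`. -/
lemma exists_main_comparison : ∃ C y₀ : ℝ, 0 < C ∧ 2 ≤ y₀ ∧ ∀ y α W X : ℝ, y₀ ≤ y → 1 / 12 ≤ α →
    α ≤ 1 → 1 ≤ W → W ≤ X → Real.log X + Real.log y ≤ mu y α →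
    sc y W ≤ C * (W / X) ^ α * sc y X := by
  obtain ⟨c, y₁, hc0, hy₁2, hy₁⟩ := exists_local_comparison
  obtain ⟨C', hC'0, hC'⟩ := exists_truncated_mu_ge
  obtain ⟨y₂, hy₂⟩ := Filter.eventually_atTop.1
    (Real.tendsto_log_atTop.eventually_ge_atTop (max 1 C'))
  refine ⟨1 / c, max y₁ y₂, by positivity, hy₁2.trans (le_max_left _ _),
    fun y α W X hy hα hα1 hW hWX hX => ?_⟩
  have hy1 : y₁ ≤ y := (le_max_left _ _).trans hy
  have hlm := hy₂ y ((le_max_right _ _).trans hy)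
  have hl1 : 1 ≤ Real.log y := (le_max_left _ _).trans hlm
  have hlC : C' ≤ Real.log y := (le_max_right _ _).trans hlm
  have hy2 : 2 ≤ y := by linarith
  have hy0 : 0 < y := by linarith
  have hW0 : 0 < W := by linarith
  have hs := sc_nonneg y W
  have key : ∀ n : ℕ, ∀ X : ℝ, W ≤ X → X ≤ W * y ^ 13 * 2 ^ n → Real.log X + Real.log y ≤ mu y α →
      c * (X / W) ^ α * sc y W ≤ sc y X := by
    intro n
    induction n with
    | zero =>
      intro X hWX hXn hX
      refine hy₁ y α W X hy1 hα hα1 hW hWX ?_ hX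
      have h1 : Real.log X ≤ Real.log (W * y ^ 13) := Real.log_le_log (by linarith) (by simpa using hXn)
      rw [Real.log_mul hW0.ne' (by positivity), Real.log_pow] at h1
      exact_mod_cast h1
    | succ n ih =>
      intro X hWX hXn hX
      rcases le_or_gt X (W * y ^ 13) with h | h
      · exact ih X hWX (h.trans (le_mul_of_one_le_right (by positivity) (one_le_pow₀ (by norm_num)))) hX
      have hX0 : 0 < X := by linarith
      have hX1 : 1 < X := by
        have : W * 1 ≤ W * y ^ 13 := by gcongr; exact one_le_pow₀ (by linarith)
        linarith
      have hlX : 0 < Real.log X := Real.log_pos hX1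
      have h2 := sum_log_mul_sc_le (X := X) (primesUpTo y) subset_rfl 13
      have h3 : (∑ p ∈ primesUpTo y, ∑ k ∈ Icc 1 13, Real.log p * ((p : ℝ) ^ (-α)) ^ k) *
          (c * (X / W) ^ α * sc y W) ≤ sc y X * Real.log X := by
        refine le_trans ?_ h2
        rw [sum_mul]
        refine sum_le_sum fun p hp => ?_
        rw [sum_mul]
        refine sum_le_sum fun k hk => ?_
        rw [mem_Icc] at hk
        have hp2 := two_le_of_mem hp
        have hp0 : (0:ℝ) < p := by linarith
        have hpy := (mem_primesUpTo.1 hp).2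
        have hpk : (p : ℝ) ^ k ≤ y ^ 13 := by
          calc (p : ℝ) ^ k ≤ y ^ k := by gcongr
            _ ≤ y ^ 13 := pow_le_pow_right₀ (by linarith) hk.2
        have hpk2 : 2 ≤ (p : ℝ) ^ k := by
          calc (2:ℝ) ≤ p := hp2
            _ = (p : ℝ) ^ 1 := (pow_one _).symm
            _ ≤ _ := pow_le_pow_right₀ (by linarith) hk.1
        have hle : X / (p : ℝ) ^ k ≤ X := div_le_self hX0.le (by linarith)
        have h4 := ih (X / (p : ℝ) ^ k) (by
            rw [le_div_iff₀ (by positivity)]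
            exact le_trans (by gcongr) h.le) (by
            rw [div_le_iff₀ (by positivity)]
            rw [pow_succ (2:ℝ) n] at hXn
            calc X ≤ W * y ^ 13 * 2 ^ n * 2 := by linarith
              _ ≤ _ := by gcongr) (by
            have := Real.log_le_log (by positivity) hle
            linarith)
        have h5 : (X / (p : ℝ) ^ k / W) ^ α = ((p : ℝ) ^ (-α)) ^ k * (X / W) ^ α := by
          rw [div_right_comm, Real.div_rpow (by positivity) (by positivity), ← Real.rpow_natCast,
            ← Real.rpow_natCast, ← Real.rpow_mul hp0.le, ← Real.rpow_mul hp0.le, div_eq_mul_inv,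
            ← Real.rpow_neg hp0.le, mul_comm]
          congr 2; ring
        rw [h5] at h4
        have := mul_le_mul_of_nonneg_left h4 (log_prime_nonneg hp)
        linarith
      have h6 := hC' y α hα
      have h7 : Real.log X * (c * (X / W) ^ α * sc y W) ≤ Real.log X * sc y X := by
        have h8 : Real.log X ≤ ∑ p ∈ primesUpTo y, ∑ k ∈ Icc 1 13, Real.log p * ((p : ℝ) ^ (-α)) ^ k := by
          linarith
        have h9 : 0 ≤ c * (X / W) ^ α * sc y W := by positivity
        linarith [mul_le_mul_of_nonneg_right h8 h9]
      exact le_of_mul_le_mul_left h7 hlX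
  obtain ⟨n, hn⟩ := pow_unbounded_of_one_lt X (show (1:ℝ) < 2 by norm_num)
  have h1 := key n X hWX (by
    refine hn.le.trans (le_mul_of_one_le_left (by positivity) ?_)
    have : (1:ℝ) ≤ y ^ 13 := one_le_pow₀ (by linarith)
    nlinarith) hX
  have hX0 : 0 < X := by linarith
  have h2 : (W / X) ^ α * (X / W) ^ α = 1 := by
    rw [← Real.mul_rpow (by positivity) (by positivity), div_mul_div_cancel₀ hX0.ne', div_self hW0.ne',
      Real.one_rpow]
  have h3 : 0 ≤ (W / X) ^ α / c := by positivity
  calc sc y W = (W / X) ^ α / c * (c * (X / W) ^ α * sc y W) := by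
        rw [show (W / X) ^ α / c * (c * (X / W) ^ α * sc y W) = ((W / X) ^ α * (X / W) ^ α) * (c / c) * sc y W by ring,
          h2, div_self hc0.ne']; ring
    _ ≤ (W / X) ^ α / c * sc y X := mul_le_mul_of_nonneg_left h1 h3
    _ = _ := by ring

/-- The number of `y`-smooth integers in a residue class modulo `q` and within `Z` of `b`. -/
lemma exists_card_close_le : ∃ C y₀ : ℝ, 0 < C ∧ ∀ (y α X Z b : ℝ) (q : ℕ) (S : Finset ℕ),
    y₀ ≤ y → 1 / 12 ≤ α → α ≤ 1 → 1 ≤ q → 0 < X → Z ≤ X → 0 ≤ Z →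
    Real.log X + Real.log y ≤ mu y α →
    (∀ n ∈ S, 1 ≤ n ∧ IsSmooth y n ∧ |b - n| ≤ Z) → (∀ m ∈ S, ∀ n ∈ S, m ≡ n [MOD q]) →
    (S.card : ℝ) ≤ 3 * y + C * ((Z / (q * X)) ^ α * sc y X * mu y α) := by
  obtain ⟨C₁, hC₁, h₁⟩ := exists_card_class_le
  obtain ⟨C₂, y₀, hC₂, hy₀, h₂⟩ := exists_main_comparison
  refine ⟨C₁ * C₂, max y₀ 3, by positivity,
    fun y α X Z b q S hy hα hα1 hq hX hZX hZ hmu hS hmod => ?_⟩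
  have hy3 : 3 ≤ y := (le_max_right _ _).trans hy
  have hyy : y₀ ≤ y := (le_max_left _ _).trans hy
  have hq1 : (1:ℝ) ≤ q := by exact_mod_cast hq
  have hq0 : (0:ℝ) < q := by linarith
  have hsX := sc_nonneg y X
  have hmu0 : 0 ≤ mu y α := mu_nonneg (by linarith)
  have hS' : ∀ n ∈ S, b - Z ≤ n ∧ (n : ℝ) ≤ b - Z + 2 * Z := by
    intro n hn
    have := abs_le.1 (hS n hn).2.2
    constructor <;> linarith
  rcases lt_or_ge (Z / q) y with h | h
  · have h3 := card_le_of_modEq hq (by positivity) hS' hmod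
    rw [mul_div_assoc] at h3
    have : 0 ≤ C₁ * C₂ * ((Z / (q * X)) ^ α * sc y X * mu y α) := by positivity
    linarith
  · have hW1 : 1 ≤ Z / q := by linarith
    have hWX : Z / q ≤ X := (div_le_self hZ hq1).trans hZX
    have h3 := h₁ y (Z / q) (b - Z) q S (by linarith) hW1 hq
      (fun n hn => ⟨(hS n hn).1, (hS n hn).2.1, (hS' n hn).1, by
        have := (hS' n hn).2
        rwa [mul_assoc, mul_div_cancel₀ _ hq0.ne']⟩) hmod
    have h4 := h₂ y α (Z / q) X hyy hα hα1 hW1 hWX hmu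
    have h5 : 1 + Real.log (Z / q) ≤ mu y α := by
      have h6 := Real.log_le_log (by linarith) hWX
      have h7 : 1 ≤ Real.log y := by
        rw [Real.le_log_iff_exp_le (by linarith)]
        have := Real.exp_one_lt_d9
        linarith
      linarith
    have h8 : 0 ≤ 1 + Real.log (Z / q) := by
      have := Real.log_nonneg hW1
      linarith
    calc (S.card : ℝ) ≤ C₁ * (sc y (Z / q) * (1 + Real.log (Z / q))) := h3
      _ ≤ C₁ * ((C₂ * (Z / q / X) ^ α * sc y X) * mu y α) := by gcongr
      _ = C₁ * C₂ * ((Z / (q * X)) ^ α * sc y X * mu y α) := by rw [div_div]; ring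
      _ ≤ _ := by linarith

/-- The weight `min {A, 1 / |d δ|}`, equal to `A` if `d δ = 0`. -/
def truncInv (A δ d : ℝ) : ℝ := if d * δ = 0 then A else min A (1 / |d * δ|)

lemma truncInv_le (A δ d : ℝ) : truncInv A δ d ≤ A := by
  unfold truncInv
  split_ifs
  · exact le_rfl
  · exact min_le_left _ _

lemma exists_truncInv_le {A X x δ L d : ℝ} {I : ℕ} (hA : 0 < A) (hX : 0 < X) (hx : 0 < x)
    (hAX : A * X = 2 * x) (hL : L = 2 * (1 + |δ * x|)) (hI : L ≤ 2 ^ I) (hd : |d| ≤ X) :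
    ∃ i ∈ range (I + 1), |d| ≤ 2 ^ i * X / L ∧ truncInv A δ d ≤ 8 * A / 2 ^ i := by
  have hL0 : 0 < L := by rw [hL]; positivity
  have hex : ∃ i : ℕ, |d| ≤ 2 ^ i * X / L := ⟨I, by
    rw [le_div_iff₀ hL0, mul_comm]
    gcongr⟩
  have hIle : Nat.find hex ≤ I := Nat.find_min' hex (by
    rw [le_div_iff₀ hL0, mul_comm]
    gcongr)
  refine ⟨Nat.find hex, by simpa [Nat.lt_succ_iff] using hIle, Nat.find_spec hex, ?_⟩
  rcases h : Nat.find hex with _ | k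
  · have := truncInv_le A δ d
    simp only [pow_zero, div_one]
    linarith
  have hk : 2 ^ k * X / L < |d| := not_le.1 (Nat.find_min hex (by omega : k < Nat.find hex))
  have hdx : |δ * x| = |δ| * x := by rw [abs_mul, abs_of_pos hx]
  rcases lt_or_ge (|δ| * x) (1 / 3) with h1 | h1
  · refine (truncInv_le A δ d).trans ?_
    have h2 : (2:ℝ) ^ k < 4 := by
      have := hk.trans_le hd
      rw [div_lt_iff₀ hL0, mul_comm] at this
      have := lt_of_mul_lt_mul_left this hX.le
      rw [hdx] at hL
      linarith
    rw [le_div_iff₀ (by positivity), pow_succ]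
    nlinarith
  · have hδ : 0 < |δ| := by
      by_contra! hcon
      nlinarith
    have hd0 : 0 < |d| := lt_of_le_of_lt (by positivity) hk
    have hne : d * δ ≠ 0 := mul_ne_zero (abs_pos.1 hd0) (abs_pos.1 hδ)
    have h2 : truncInv A δ d ≤ 1 / |d * δ| := by
      unfold truncInv
      rw [if_neg hne]
      exact min_le_right _ _
    refine h2.trans ?_
    rw [abs_mul, div_le_div_iff₀ (by positivity) (by positivity)]
    rw [div_lt_iff₀ hL0] at hk
    have hL8 : L ≤ 8 * (|δ| * x) := by rw [hL, hdx]; linarith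
    have h3 : 2 ^ k * X < |d| * (8 * (|δ| * x)) := hk.trans_le (by gcongr)
    have h4 : 2 ^ k * X * 2 ≤ (8 * A * (|d| * |δ|)) * X := by
      calc 2 ^ k * X * 2 ≤ |d| * (8 * (|δ| * x)) * 2 := by linarith
        _ = 8 * (|d| * |δ|) * (2 * x) := by ring
        _ = _ := by rw [← hAX]; ring
    have h5 : 2 ^ k * 2 ≤ 8 * A * (|d| * |δ|) := by
      refine le_of_mul_le_mul_right ?_ hX
      linarith
    rw [one_mul, pow_succ]
    exact h5

lemma exists_two_pow_ge {L : ℝ} (hL : 2 ≤ L) :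
    ∃ I : ℕ, L ≤ 2 ^ I ∧ ((I + 1 : ℕ) : ℝ) ≤ 6 * Real.log L := by
  have hl2 := Real.log_two_gt_d9
  have hlL : Real.log 2 ≤ Real.log L := Real.log_le_log (by norm_num) hL
  refine ⟨⌈Real.log L / Real.log 2⌉₊, ?_, ?_⟩
  · rw [← Real.rpow_natCast, ← Real.log_le_log_iff (by linarith) (by positivity),
      Real.log_rpow (by norm_num), ← div_le_iff₀ (by linarith)]
    exact Nat.le_ceil _
  · have h1 := Nat.ceil_lt_add_one (a := Real.log L / Real.log 2)
      (div_nonneg (by linarith) (by linarith))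
    have h2 : Real.log L / Real.log 2 ≤ Real.log L * (3 / 2) := by
      rw [div_le_iff₀ (by linarith)]
      nlinarith
    push_cast
    linarith

/-- The sum of the weights over all `n` in a residue class, for a fixed centre `b`. -/
lemma exists_row_le : ∃ C y₀ : ℝ, 0 < C ∧ ∀ (x y α δ L X A b : ℝ) (q : ℕ) (S : Finset ℕ),
    y₀ ≤ y → 0 < y → 1 / 12 ≤ α → α ≤ 1 → 1 ≤ q → 0 < X → 0 < A → 0 < x → A * X = 2 * x →
    L = 2 * (1 + |δ * x|) → Real.log X + Real.log y ≤ mu y α →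
    (∀ n ∈ S, 1 ≤ n ∧ IsSmooth y n ∧ |b - n| ≤ X) → (∀ m ∈ S, ∀ n ∈ S, m ≡ n [MOD q]) →
    ∑ n ∈ S, truncInv A δ (b - n) ≤
      C * (A * y + A * (q * L) ^ (-α) * sc y X * mu y α * Real.log L) := by
  obtain ⟨C, y₀, hC, h₀⟩ := exists_card_close_le
  refine ⟨48 * (1 + C), y₀, by positivity,
    fun x y α δ L X A b q S hy hy0 hα hα1 hq hX hA hx hAX hL hmu hS hmod => ?_⟩
  have hL2 : 2 ≤ L := by
    have := abs_nonneg (δ * x)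
    linarith
  have hL0 : 0 < L := by linarith
  have hq0 : (0:ℝ) < q := by exact_mod_cast hq
  have hsX := sc_nonneg y X
  have hmu0 : 0 ≤ mu y α := mu_nonneg (by linarith)
  have hlL : 0 ≤ Real.log L := Real.log_nonneg (by linarith)
  obtain ⟨I, hI, hIL⟩ := exists_two_pow_ge hL2
  set B := (q * L) ^ (-α) * sc y X * mu y α with hB
  have hB0 : 0 ≤ B := by positivity
  have hcount : ∀ i : ℕ, ((S.filter (fun n : ℕ => |b - n| ≤ 2 ^ i * X / L)).card : ℝ) ≤
      3 * y + C * (2 ^ i * B) := by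
    intro i
    refine (h₀ y α X (min (2 ^ i * X / L) X) b q _ hy hα hα1 hq hX (min_le_right _ _)
      (by positivity) hmu (fun n hn => ?_) (fun m hm n hn =>
        hmod m (mem_filter.1 hm).1 n (mem_filter.1 hn).1)).trans ?_
    · rw [mem_filter] at hn
      exact ⟨(hS n hn.1).1, (hS n hn.1).2.1, le_min hn.2 (hS n hn.1).2.2⟩
    have h1 : (min (2 ^ i * X / L) X / (q * X)) ^ α ≤ 2 ^ i * (q * L) ^ (-α) := by
      calc (min (2 ^ i * X / L) X / (q * X)) ^ α ≤ (2 ^ i * X / L / (q * X)) ^ α := by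
            gcongr
            exact min_le_left _ _
        _ = (2 ^ i * (q * L)⁻¹) ^ α := by congr 1; field_simp
        _ = (2 ^ i : ℝ) ^ α * (q * L) ^ (-α) := by
            rw [Real.mul_rpow (by positivity) (by positivity), Real.inv_rpow (by positivity),
              Real.rpow_neg (by positivity)]
        _ ≤ 2 ^ i * (q * L) ^ (-α) := by
            gcongr
            calc (2 ^ i : ℝ) ^ α ≤ (2 ^ i : ℝ) ^ (1:ℝ) :=
                  Real.rpow_le_rpow_of_exponent_le (one_le_pow₀ (by norm_num)) hα1
              _ = 2 ^ i := Real.rpow_one _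
    have h2 : (min (2 ^ i * X / L) X / (q * X)) ^ α * sc y X * mu y α ≤ 2 ^ i * B := by
      calc _ ≤ 2 ^ i * (q * L) ^ (-α) * sc y X * mu y α := by gcongr
        _ = _ := by rw [hB]; ring
    gcongr
  have hpt : ∀ n ∈ S, truncInv A δ (b - n) ≤ ∑ i ∈ range (I + 1),
      if |b - n| ≤ 2 ^ i * X / L then 8 * A / 2 ^ i else 0 := by
    intro n hn
    obtain ⟨i, hi, h1, h2⟩ := exists_truncInv_le hA hX hx hAX hL hI (hS n hn).2.2
    refine h2.trans ?_
    have h3 := single_le_sum (f := fun i : ℕ =>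
      if |b - n| ≤ 2 ^ i * X / L then 8 * A / 2 ^ i else 0) (fun i _ => by positivity) hi
    simpa only [if_pos h1] using h3
  have hgeo : ∑ i ∈ range (I + 1), (8 * A / 2 ^ i) * (3 * y) ≤ 48 * (A * y) := by
    have h1 := sum_geometric_two_le (I + 1)
    calc ∑ i ∈ range (I + 1), (8 * A / 2 ^ i) * (3 * y)
        = 24 * (A * y) * ∑ i ∈ range (I + 1), (1 / 2 : ℝ) ^ i := by
          rw [mul_sum]
          refine sum_congr rfl fun i _ => ?_
          rw [one_div, inv_pow]
          ring
      _ ≤ 24 * (A * y) * 2 := by gcongr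
      _ = _ := by ring
  calc ∑ n ∈ S, truncInv A δ (b - n)
      ≤ ∑ n ∈ S, ∑ i ∈ range (I + 1),
        if |b - n| ≤ 2 ^ i * X / L then 8 * A / 2 ^ i else 0 := sum_le_sum hpt
    _ = ∑ i ∈ range (I + 1), 8 * A / 2 ^ i *
          ((S.filter (fun n : ℕ => |b - n| ≤ 2 ^ i * X / L)).card : ℝ) := by
        rw [sum_comm]
        refine sum_congr rfl fun i _ => ?_
        rw [← sum_filter, sum_const, nsmul_eq_mul, mul_comm]
    _ ≤ ∑ i ∈ range (I + 1), 8 * A / 2 ^ i * (3 * y + C * (2 ^ i * B)) := by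
        gcongr with i hi
        exact hcount i
    _ = ∑ i ∈ range (I + 1), (8 * A / 2 ^ i) * (3 * y) + ((I + 1 : ℕ) : ℝ) * (8 * A * C * B) := by
        have : ∀ i : ℕ, 8 * A / 2 ^ i * (3 * y + C * (2 ^ i * B)) =
            (8 * A / 2 ^ i) * (3 * y) + 8 * A * C * B := by
          intro i
          field_simp
        simp only [this, sum_add_distrib, sum_const, card_range, nsmul_eq_mul]
    _ ≤ 48 * (A * y) + 6 * Real.log L * (8 * A * C * B) := by gcongr
    _ ≤ 48 * (1 + C) * (A * y + A * B * Real.log L) := by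
        have h1 : 0 ≤ A * y * C := by positivity
        have h2 : 0 ≤ A * B * Real.log L := by positivity
        linarith
    _ = _ := by rw [hB]; ring

lemma sum_truncInv_eq (y X : ℝ) (A δ : ℝ) (q : ℕ) :
    ∑ nn ∈ ((Icc 1 ⌊X⌋₊ ×ˢ Icc 1 ⌊X⌋₊).filter
      (fun nn => IsSmooth y nn.1 ∧ IsSmooth y nn.2 ∧ nn.1 ≡ nn.2 [MOD q])),
      truncInv A δ ((nn.1 : ℝ) - nn.2) =
    ∑ m ∈ sm y X, ∑ n ∈ (sm y X).filter (fun n => m ≡ n [MOD q]), truncInv A δ ((m : ℝ) - n) := by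
  have h : (Icc 1 ⌊X⌋₊ ×ˢ Icc 1 ⌊X⌋₊).filter
      (fun nn => IsSmooth y nn.1 ∧ IsSmooth y nn.2 ∧ nn.1 ≡ nn.2 [MOD q]) =
      (sm y X ×ˢ sm y X).filter (fun nn => nn.1 ≡ nn.2 [MOD q]) := by
    ext nn
    simp only [sm, mem_filter, mem_product]
    tauto
  rw [h, sum_filter, sum_product]
  refine sum_congr rfl fun m _ => ?_
  rw [sum_filter]

lemma sum_truncInv_le {y X A δ K : ℝ} {q : ℕ}
    (h : ∀ m ∈ sm y X, ∑ n ∈ (sm y X).filter (fun n => m ≡ n [MOD q]),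
      truncInv A δ ((m : ℝ) - n) ≤ K) :
    ∑ nn ∈ ((Icc 1 ⌊X⌋₊ ×ˢ Icc 1 ⌊X⌋₊).filter
      (fun nn => IsSmooth y nn.1 ∧ IsSmooth y nn.2 ∧ nn.1 ≡ nn.2 [MOD q])),
      truncInv A δ ((nn.1 : ℝ) - nn.2) ≤ sc y X * K := by
  rw [sum_truncInv_eq]
  refine (sum_le_sum h).trans ?_
  rw [sum_const, nsmul_eq_mul, sc]

end SmoothNumbers

/-- Bound (2.6): the congruence sum with `min{2^(j+1)qLy, 1/|(n₁−n₂)δ|}` over pairs of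
positive `y`-smooth integers `n₁, n₂ ≤ x/(2^j qLy)` with `n₁ ≡ n₂ (mod q)`. -/
theorem congruence_min_sum_bound :
    ∃ C : ℝ, 0 < C ∧
      ∀ (x y : ℝ) (q : ℕ) (δ L : ℝ) (j : ℕ) (α : ℝ),
        3 ≤ x → Real.log x ^ (1.1 : ℝ) ≤ y → y ≤ x ^ ((1 : ℝ) / 3) →
        1 ≤ q → L = 2 * (1 + |δ * x|) →
        (j : ℝ) ≤ Real.log y / Real.log 2 → alphaEq x y α →
        ∑ nn ∈ ((Finset.Icc 1 ⌊x / (2 ^ j * q * L * y)⌋₊ ×ˢ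
              Finset.Icc 1 ⌊x / (2 ^ j * q * L * y)⌋₊).filter
            (fun nn => IsSmooth y nn.1 ∧ IsSmooth y nn.2 ∧ nn.1 ≡ nn.2 [MOD q])),
          (if ((nn.1 : ℝ) - (nn.2 : ℝ)) * δ = 0 then (2 : ℝ) ^ (j + 1) * q * L * y
            else min ((2 : ℝ) ^ (j + 1) * q * L * y)
              (1 / |((nn.1 : ℝ) - (nn.2 : ℝ)) * δ|)) ≤
          C * ((2 : ℝ) ^ j * y * (Psi (x / (2 ^ j * q * L * y)) y : ℝ) ^ 2 *
              ((q : ℝ) * L) ^ (1 - α) * Real.log x * Real.log L +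
            (2 : ℝ) ^ j * q * L * y ^ 2 * (Psi (x / (2 ^ j * q * L * y)) y : ℝ)) := by
  obtain ⟨C₁, y₁, hC₁, h₁⟩ := exists_row_le
  obtain ⟨y₂, hy₂, h₂⟩ := exists_alpha_bounds
  refine ⟨2 * C₁ + 2 * Real.exp (max y₁ y₂), by positivity, ?_⟩
  intro x y q δ L j α hx hxy hyx hq hL hj hα
  have hx0 : 0 < x := by linarith
  have hR : 1 ≤ Real.log x := by
    rw [Real.le_log_iff_exp_le hx0]
    have := Real.exp_one_lt_d9
    linarith
  have hRy : Real.log x ≤ y := by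
    refine le_trans ?_ hxy
    calc Real.log x = Real.log x ^ (1:ℝ) := (Real.rpow_one _).symm
      _ ≤ _ := Real.rpow_le_rpow_of_exponent_le hR (by norm_num)
  have hy0 : 0 < y := by linarith
  have hy1 : 1 ≤ y := by linarith
  have hL2 : 2 ≤ L := by
    have := abs_nonneg (δ * x)
    linarith
  have hq1 : (1:ℝ) ≤ q := by exact_mod_cast hq
  have hlL : 0 ≤ Real.log L := Real.log_nonneg (by linarith)
  have h2j : (1:ℝ) ≤ 2 ^ j := one_le_pow₀ (by norm_num)
  have hm : (1:ℝ) ≤ 2 ^ j * q * L := by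
    calc (1:ℝ) = 1 * 1 * 1 := by norm_num
      _ ≤ 2 ^ j * q * L := by gcongr; linarith
  have hm0 : (0:ℝ) < 2 ^ j * q * L := by linarith
  set X := x / (2 ^ j * q * L * y) with hX
  have hX0 : 0 < X := by positivity
  set A : ℝ := 2 ^ (j + 1) * q * L * y with hA
  have hA2 : A = 2 * (2 ^ j * q * L) * y := by rw [hA]; ring
  have hA0 : 0 < A := by rw [hA2]; positivity
  have hAX : A * X = 2 * x := by
    rw [hA2, hX]
    field_simp
  rw [Psi_eq_sc]
  have hs := sc_nonneg y X
  set F : ℝ := 2 ^ j * y * sc y X ^ 2 * ((q : ℝ) * L) ^ (1 - α) * Real.log x * Real.log L with hF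
  have hF0 : 0 ≤ F := by
    have : 0 ≤ ((q : ℝ) * L) ^ (1 - α) := by positivity
    positivity
  set G : ℝ := 2 ^ j * q * L * y ^ 2 * sc y X with hG
  have hG0 : 0 ≤ G := by positivity
  have hE : 0 < Real.exp (max y₁ y₂) := Real.exp_pos _
  rcases lt_or_ge y (max y₁ y₂) with h | h
  · have hrow : ∀ m ∈ sm y X, ∑ n ∈ (sm y X).filter (fun n => m ≡ n [MOD q]),
        truncInv A δ ((m : ℝ) - n) ≤ 2 * Real.exp (max y₁ y₂) := by
      intro m _
      have h3 : x ≤ Real.exp (max y₁ y₂) := by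
        rw [← Real.log_le_iff_le_exp hx0]
        linarith
      calc ∑ n ∈ (sm y X).filter (fun n => m ≡ n [MOD q]), truncInv A δ ((m : ℝ) - n)
          ≤ ∑ n ∈ (sm y X).filter (fun n => m ≡ n [MOD q]), A :=
            Finset.sum_le_sum fun n _ => truncInv_le A δ _
        _ ≤ ∑ n ∈ sm y X, A :=
            Finset.sum_le_sum_of_subset_of_nonneg (Finset.filter_subset _ _) fun _ _ _ => hA0.le
        _ = A * sc y X := by rw [Finset.sum_const, nsmul_eq_mul, sc, mul_comm]
        _ ≤ A * X := by gcongr; exact sc_le_self hX0.le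
        _ ≤ _ := by rw [hAX]; linarith
    refine (sum_truncInv_le hrow).trans ?_
    have h4 : sc y X ≤ G := by
      calc sc y X = 1 * 1 ^ 2 * sc y X := by ring
        _ ≤ G := by rw [hG]; gcongr
    have h5 : 0 ≤ C₁ * (F + G) := by positivity
    have h6 : Real.exp (max y₁ y₂) * sc y X ≤ Real.exp (max y₁ y₂) * (F + G) := by
      gcongr
      linarith
    linarith
  · have hy1' : y₁ ≤ y := (le_max_left _ _).trans h
    have hmu : mu y α = Real.log x := hα
    have hRy' : Real.log x ≤ y ^ (10 / 11 : ℝ) := by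
      have := Real.rpow_le_rpow (by positivity) hxy (show (0:ℝ) ≤ 10 / 11 by norm_num)
      rw [← Real.rpow_mul (by linarith)] at this
      norm_num at this
      exact this
    have hyR : 3 * Real.log y ≤ Real.log x := by
      have := Real.log_le_log hy0 hyx
      rw [Real.log_rpow hx0] at this
      linarith
    obtain ⟨hα0, hα1⟩ := h₂ x y α ((le_max_right _ _).trans h) hRy' hyR hmu
    have hXy : Real.log X + Real.log y ≤ mu y α := by
      rw [hmu, ← Real.log_mul hX0.ne' hy0.ne']
      apply Real.log_le_log (by positivity)
      have : X * y = x / (2 ^ j * q * L) := by rw [hX]; field_simp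
      rw [this]
      exact div_le_self hx0.le hm
    have hrow : ∀ m ∈ sm y X, ∑ n ∈ (sm y X).filter (fun n => m ≡ n [MOD q]),
        truncInv A δ ((m : ℝ) - n) ≤
        C₁ * (A * y + A * (q * L) ^ (-α) * sc y X * Real.log x * Real.log L) := by
      intro m hm
      rw [mem_sm] at hm
      have hm1 : (1:ℝ) ≤ m := by exact_mod_cast hm.1
      rw [← hmu]
      refine h₁ x y α δ L X A m q _ hy1' hy0 hα0 hα1 hq hX0 hA0 hx0 hAX hL hXy
        (fun n hn => ?_) (fun k hk n hn =>
          (Finset.mem_filter.1 hk).2.symm.trans (Finset.mem_filter.1 hn).2)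
      rw [Finset.mem_filter, mem_sm] at hn
      have hn1 : (1:ℝ) ≤ n := by exact_mod_cast hn.1.1
      refine ⟨hn.1.1, hn.1.2.2, abs_le.2 ⟨?_, ?_⟩⟩ <;> linarith [hn.1.2.1, hm.2.1]
    refine (sum_truncInv_le hrow).trans ?_
    have h4 : sc y X * (C₁ * (A * y + A * (q * L) ^ (-α) * sc y X * Real.log x * Real.log L)) =
        2 * C₁ * (F + G) := by
      rw [hF, hG, hA2, sub_eq_add_neg, Real.rpow_add (by positivity), Real.rpow_one]
      ring
    rw [h4]
    have h5 : 0 ≤ Real.exp (max y₁ y₂) * (F + G) := by positivity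
    linarith
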